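/- (Reaction–convection–diffusion regime.) There exist constants κ, σ, C > 0, independent of ε₁, ε₂ and of p, such that for all parameters with ε₁ ≪ ε₂² ≪ 1 (i.e. uniformly over 0 < ε₁ ≤ ε₂² and ε₂ ≤ 1), the solution u of the two-parameter problem and the weak Galerkin solution u_p of degree p on the Spectral Boundary Layer mesh ω_BL(κ,p) satisfy |||u − u_p|||_p ≤ C e^{−σ p}. -/

import Mathlib

noncomputable section

open MeasureTheory Set

/-- A mesh `0 = x₀ < x₁ < ⋯ < x_N = 1` on the interval `I = (0,1)`. -/
structure Mesh (N : ℕ) where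
  pt : Fin (N + 1) → ℝ
  mono : StrictMono pt
  left : pt 0 = 0
  right : pt (Fin.last N) = 1

namespace Mesh

variable {N : ℕ}

/-- The left endpoint `x_{j-1}` of the `j`-th cell `I_j`. -/
def xl (m : Mesh N) (j : Fin N) : ℝ := m.pt j.castSucc

/-- The right endpoint `x_j` of the `j`-th cell `I_j`. -/
def xr (m : Mesh N) (j : Fin N) : ℝ := m.pt j.succ

/-- The width `h_j` of the `j`-th cell. -/
def width (m : Mesh N) (j : Fin N) : ℝ := m.xr j - m.xl j

end Mesh

/-- `f` coincides (everywhere) with a polynomial of degree at most `p`. -/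
def IsPolyDeg (f : ℝ → ℝ) (p : ℕ) : Prop :=
  ∃ q : Polynomial ℝ, q.natDegree ≤ p ∧ ∀ t, f t = q.eval t

/-- `D` is the weak derivative of degree `p` of the weak function with interior part `v0`
and boundary values `vl`, `vr` on the cell `(a,b)`. -/
def IsWeakDerivOn (a b : ℝ) (p : ℕ) (v0 : ℝ → ℝ) (vl vr : ℝ) (D : ℝ → ℝ) : Prop :=
  IsPolyDeg D p ∧ ∀ q : Polynomial ℝ, q.natDegree ≤ p →
    (∫ t in a..b, D t * q.eval t) =
      -(∫ t in a..b, v0 t * q.derivative.eval t) + vr * q.eval b - vl * q.eval a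

/-- `D` is the (cellwise) weak derivative `D_p v` of the weak function `v = (v0, vb)`. -/
def IsWeakDeriv {N : ℕ} (m : Mesh N) (p : ℕ) (v0 : Fin N → ℝ → ℝ)
    (vb : Fin (N + 1) → ℝ) (D : Fin N → ℝ → ℝ) : Prop :=
  ∀ j, IsWeakDerivOn (m.xl j) (m.xr j) p (v0 j) (vb j.castSucc) (vb j.succ) (D j)

/-- `D` is the weak convection derivative of degree `p` on the cell `(a,b)`,
with convection coefficient `bb`. -/
def IsWeakConvDerivOn (bb : ℝ → ℝ) (a b : ℝ) (p : ℕ) (v0 : ℝ → ℝ) (vl vr : ℝ)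
    (D : ℝ → ℝ) : Prop :=
  IsPolyDeg D p ∧ ∀ q : Polynomial ℝ, q.natDegree ≤ p →
    (∫ t in a..b, D t * q.eval t) =
      -(∫ t in a..b, v0 t * deriv (fun s => bb s * q.eval s) t)
      + vr * (bb b * q.eval b) - vl * (bb a * q.eval a)

/-- `D` is the (cellwise) weak convection derivative `D_p^c v` of `v = (v0, vb)`. -/
def IsWeakConvDeriv {N : ℕ} (m : Mesh N) (bb : ℝ → ℝ) (p : ℕ) (v0 : Fin N → ℝ → ℝ)
    (vb : Fin (N + 1) → ℝ) (D : Fin N → ℝ → ℝ) : Prop :=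
  ∀ j, IsWeakConvDerivOn bb (m.xl j) (m.xr j) p (v0 j) (vb j.castSucc) (vb j.succ) (D j)

/-- The stabilisation bilinear form `S(u,v)`. -/
def Sform {N : ℕ} (m : Mesh N) (σ : Fin N → ℝ)
    (u0 : Fin N → ℝ → ℝ) (ub : Fin (N + 1) → ℝ)
    (v0 : Fin N → ℝ → ℝ) (vb : Fin (N + 1) → ℝ) : ℝ :=
  ∑ j : Fin N, σ j * ((u0 j (m.xr j) - ub j.succ) * (v0 j (m.xr j) - vb j.succ)
    + (u0 j (m.xl j) - ub j.castSucc) * (v0 j (m.xl j) - vb j.castSucc))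

/-- The convection stabilisation bilinear form `S_c(u,v)`. -/
def Scform {N : ℕ} (m : Mesh N) (ε₂ : ℝ) (bb : ℝ → ℝ)
    (u0 : Fin N → ℝ → ℝ) (ub : Fin (N + 1) → ℝ)
    (v0 : Fin N → ℝ → ℝ) (vb : Fin (N + 1) → ℝ) : ℝ :=
  ∑ j : Fin N, ε₂ * bb (m.xr j) * (u0 j (m.xr j) - ub j.succ) * (v0 j (m.xr j) - vb j.succ)

/-- The squared jump seminorm `|v|_J²`. -/
def Jsemi2 {N : ℕ} (m : Mesh N) (ε₂ : ℝ) (bb : ℝ → ℝ)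
    (v0 : Fin N → ℝ → ℝ) (vb : Fin (N + 1) → ℝ) : ℝ :=
  ∑ j : Fin N, (if j.succ = Fin.last N then (1 : ℝ) / 2 else 1) * ε₂ * bb (m.xr j) *
    (v0 j (m.xr j) - vb j.succ) ^ 2

/-- The squared WG energy norm `|||v|||_p²`, where `Dv` is the weak derivative `D_{p-1} v`. -/
def normP2 {N : ℕ} (m : Mesh N) (ε₁ ε₂ : ℝ) (bb : ℝ → ℝ) (σ : Fin N → ℝ)
    (v0 : Fin N → ℝ → ℝ) (vb : Fin (N + 1) → ℝ) (Dv : Fin N → ℝ → ℝ) : ℝ :=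
  ε₁ * (∑ j : Fin N, ∫ t in (m.xl j)..(m.xr j), (Dv j t) ^ 2)
    + (∑ j : Fin N, ∫ t in (m.xl j)..(m.xr j), (v0 j t) ^ 2)
    + Sform m σ v0 vb v0 vb + Scform m ε₂ bb v0 vb v0 vb + Jsemi2 m ε₂ bb v0 vb

/-- The squared WG norm `|||v|||²` (with the broken classical derivative). -/
def normT2 {N : ℕ} (m : Mesh N) (ε₁ ε₂ : ℝ) (bb : ℝ → ℝ) (σ : Fin N → ℝ)
    (v0 : Fin N → ℝ → ℝ) (vb : Fin (N + 1) → ℝ) : ℝ :=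
  ε₁ * (∑ j : Fin N, ∫ t in (m.xl j)..(m.xr j), (deriv (v0 j) t) ^ 2)
    + (∑ j : Fin N, ∫ t in (m.xl j)..(m.xr j), (v0 j t) ^ 2)
    + Sform m σ v0 vb v0 vb + Scform m ε₂ bb v0 vb v0 vb + Jsemi2 m ε₂ bb v0 vb

/-- The WG bilinear form `A_p(u,v)`; `Du = D_{p-1}u`, `Dcu = D_p^c u`, `Dv = D_{p-1}v`. -/
def Aform {N : ℕ} (m : Mesh N) (ε₁ ε₂ : ℝ) (bb rr : ℝ → ℝ) (σ : Fin N → ℝ)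
    (u0 : Fin N → ℝ → ℝ) (ub : Fin (N + 1) → ℝ) (Du Dcu : Fin N → ℝ → ℝ)
    (v0 : Fin N → ℝ → ℝ) (vb : Fin (N + 1) → ℝ) (Dv : Fin N → ℝ → ℝ) : ℝ :=
  ε₁ * (∑ j : Fin N, ∫ t in (m.xl j)..(m.xr j), Du j t * Dv j t)
    + ε₂ * (∑ j : Fin N, ∫ t in (m.xl j)..(m.xr j), Dcu j t * v0 j t)
    + (∑ j : Fin N, ∫ t in (m.xl j)..(m.xr j), rr t * u0 j t * v0 j t)
    + Sform m σ u0 ub v0 vb + Scform m ε₂ bb u0 ub v0 vb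

/-- `u` solves the two-parameter singularly perturbed boundary-value problem
`-ε₁ u'' + ε₂ b u' + r u = f` on `(0,1)`, `u(0) = u(1) = 0`. -/
def SolvesBVP (ε₁ ε₂ : ℝ) (bb rr ff u : ℝ → ℝ) : Prop :=
  u 0 = 0 ∧ u 1 = 0 ∧
    ∀ x ∈ Set.Icc (0 : ℝ) 1,
      -ε₁ * deriv (deriv u) x + ε₂ * bb x * deriv u x + rr x * u x = ff x

/-- `P` is the interpolant `I y` of `y` on the cell `(a,b)`. -/
def IsInterpOn (a b : ℝ) (p : ℕ) (y P : ℝ → ℝ) : Prop :=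
  IsPolyDeg P p ∧ P a = y a ∧ P b = y b ∧
    ∀ q : Polynomial ℝ, q.natDegree ≤ p →
      (∫ t in a..b, (deriv P t - deriv y t) * q.derivative.eval t) = 0

/-- `P` is the (cellwise) interpolant `I y` of `y` on the mesh `m`. -/
def IsInterp {N : ℕ} (m : Mesh N) (p : ℕ) (y : ℝ → ℝ) (P : Fin N → ℝ → ℝ) : Prop :=
  ∀ j, IsInterpOn (m.xl j) (m.xr j) p y (P j)

/-- Glue cellwise functions into a single function on `I` (cells taken left-closed). -/
def glue {N : ℕ} (m : Mesh N) (v0 : Fin N → ℝ → ℝ) : ℝ → ℝ :=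
  fun t => ∑ j : Fin N, Set.indicator (Set.Ico (m.xl j) (m.xr j)) (v0 j) t

/-- The standard penalty parameters `σ_j = ε₁ p² / h_j`. -/
def stdPen {N : ℕ} (m : Mesh N) (ε₁ : ℝ) (p : ℕ) : Fin N → ℝ :=
  fun j => ε₁ * (p : ℝ) ^ 2 / m.width j

/-- Membership of the interior part in the broken Sobolev space `H¹(ω)`. -/
def MemM {N : ℕ} (m : Mesh N) (v0 : Fin N → ℝ → ℝ) : Prop :=
  ∀ j, DifferentiableOn ℝ (v0 j) (Set.Icc (m.xl j) (m.xr j))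

/-- `(up0, upb)`, with weak derivatives `Du = D_{p-1} u_p` and `Dcu = D_p^c u_p`, is a
weak Galerkin solution of degree `p` on the mesh `m`. -/
def IsWGsol {N : ℕ} (m : Mesh N) (ε₁ ε₂ : ℝ) (bb rr ff : ℝ → ℝ) (p : ℕ)
    (up0 : Fin N → ℝ → ℝ) (upb : Fin (N + 1) → ℝ) (Du Dcu : Fin N → ℝ → ℝ) : Prop :=
  (∀ j, IsPolyDeg (up0 j) p) ∧ upb 0 = 0 ∧ upb (Fin.last N) = 0 ∧
    IsWeakDeriv m (p - 1) up0 upb Du ∧ IsWeakConvDeriv m bb p up0 upb Dcu ∧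
    ∀ (w0 : Fin N → ℝ → ℝ) (wb : Fin (N + 1) → ℝ),
      (∀ j, IsPolyDeg (w0 j) p) → wb 0 = 0 → wb (Fin.last N) = 0 →
      ∀ Dw : Fin N → ℝ → ℝ, IsWeakDeriv m (p - 1) w0 wb Dw →
        Aform m ε₁ ε₂ bb rr (stdPen m ε₁ p) up0 upb Du Dcu w0 wb Dw
          = ∑ j : Fin N, ∫ t in (m.xl j)..(m.xr j), ff t * w0 j t

/-- Broken `L²` norm over the mesh of a cellwise-given function. -/
def brokenL2 {N : ℕ} (m : Mesh N) (f : Fin N → ℝ → ℝ) : ℝ :=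
  Real.sqrt (∑ j : Fin N, ∫ t in (m.xl j)..(m.xr j), (f j t) ^ 2)

/-- `L²(a,b)` norm. -/
def intL2 (a b : ℝ) (f : ℝ → ℝ) : ℝ := Real.sqrt (∫ t in a..b, (f t) ^ 2)

/-- Analyticity of the data: `‖g⁽ⁿ⁾‖_{∞,[0,1]} ≲ n! γ_g^n`. -/
def AnalyticData (g : ℝ → ℝ) : Prop :=
  ContDiff ℝ (⊤ : ℕ∞) g ∧ ∃ C γg : ℝ, 0 < C ∧ 0 < γg ∧
    ∀ n : ℕ, ∀ x ∈ Set.Icc (0 : ℝ) 1, |iteratedDeriv n g x| ≤ C * n.factorial * γg ^ n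

/-- The characteristic values `μ₀` (`sgn = -1`) and `μ₁` (`sgn = 1`). -/
def muVal (sgn ε₁ ε₂ : ℝ) (bb rr : ℝ → ℝ) : ℝ :=
  sInf ((fun x => (sgn * ε₂ * bb x + Real.sqrt (ε₂ ^ 2 * (bb x) ^ 2 + 4 * ε₁ * rr x))
      / (2 * ε₁)) '' Set.Icc 0 1)

def mu0 (ε₁ ε₂ : ℝ) (bb rr : ℝ → ℝ) : ℝ := muVal (-1) ε₁ ε₂ bb rr

def mu1 (ε₁ ε₂ : ℝ) (bb rr : ℝ → ℝ) : ℝ := muVal 1 ε₁ ε₂ bb rr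

/-- The Spectral Boundary Layer mesh in the reaction-convection-diffusion regime. -/
def IsSBLmeshRCD {N : ℕ} (κ : ℝ) (p : ℕ) (ε₁ ε₂ : ℝ) (bb rr : ℝ → ℝ) (m : Mesh N) : Prop :=
  ((1 : ℝ) / 2 ≤ κ * p * ε₁ ∧ N = 1) ∨
    (κ * p * ε₂ < 1 / 2 ∧ N = 3 ∧
      m.pt 1 = κ * p / mu0 ε₁ ε₂ bb rr ∧ m.pt 2 = 1 - κ * p / mu1 ε₁ ε₂ bb rr)

/-- The Spectral Boundary Layer mesh in the reaction-diffusion regime. -/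
def IsSBLmeshRD {N : ℕ} (κ : ℝ) (p : ℕ) (ε₁ : ℝ) (m : Mesh N) : Prop :=
  ((1 : ℝ) / 2 ≤ κ * p * ε₁ ∧ N = 1) ∨
    (κ * p * ε₁ < 1 / 2 ∧ N = 3 ∧
      m.pt 1 = κ * p * Real.sqrt ε₁ ∧ m.pt 2 = 1 - κ * p * Real.sqrt ε₁)

/-- The Spectral Boundary Layer mesh in the convection-diffusion regime. -/
def IsSBLmeshCD {N : ℕ} (κ : ℝ) (p : ℕ) (ε₁ : ℝ) (m : Mesh N) : Prop :=
  ((1 : ℝ) / 2 ≤ κ * p * ε₁ ∧ N = 1) ∨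
    (κ * p * ε₁ ≤ 1 / 2 ∧ N = 2 ∧ m.pt 1 = 1 - κ * p * ε₁)

/-- Every real polynomial has a polynomial primitive with prescribed value at a point. -/
lemma exists_poly_primitive (q : Polynomial ℝ) (n : ℕ) (hq : q.natDegree ≤ n) (a c : ℝ) :
    ∃ R : Polynomial ℝ, R.natDegree ≤ n + 1 ∧ R.derivative = q ∧ R.eval a = c := by
  set S : Polynomial ℝ := ∑ i ∈ Finset.range (n + 1),
    Polynomial.monomial (i + 1) (q.coeff i / ((i : ℝ) + 1)) with hS
  have hSd : S.natDegree ≤ n + 1 := by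
    refine Polynomial.natDegree_sum_le_of_forall_le _ _ fun i hi => ?_
    refine (Polynomial.natDegree_monomial_le _).trans ?_
    have := Finset.mem_range.1 hi
    omega
  have hS' : S.derivative = q := by
    rw [hS, Polynomial.derivative_sum]
    conv_rhs => rw [q.as_sum_range' (n + 1) (by omega)]
    refine Finset.sum_congr rfl fun i _ => ?_
    rw [Polynomial.derivative_monomial]
    congr 1
    push_cast
    field_simp
  refine ⟨S + Polynomial.C (c - S.eval a), ?_, ?_, ?_⟩
  · exact (Polynomial.natDegree_add_le _ _).trans (by simp [hSd])
  · simp [hS']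
  · simp

lemma poly_eval_sub_eq_integral (R : Polynomial ℝ) (a b : ℝ) :
    ∫ t in a..b, R.derivative.eval t = R.eval b - R.eval a :=
  intervalIntegral.integral_eq_sub_of_hasDerivAt (fun t _ => R.hasDerivAt t)
    (R.derivative.continuous.intervalIntegrable _ _)

/-- Trace inequality at the right endpoint for polynomials of degree at most `n`. -/
lemma poly_trace_right (q : Polynomial ℝ) (n : ℕ) (hq : q.natDegree ≤ n) {a b : ℝ} (hab : a < b) :
    (b - a) * (q.eval b) ^ 2 ≤ (2 * n + 1) ^ 2 * ∫ t in a..b, (q.eval t) ^ 2 := by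
  obtain ⟨R, hRd, hR', hRa⟩ := exists_poly_primitive (q ^ 2) (2 * n)
    (Polynomial.natDegree_pow_le.trans (by omega)) a 0
  have hprim : ∀ x, ∫ t in a..x, (q.eval t) ^ 2 = R.eval x := by
    intro x
    have := poly_eval_sub_eq_integral R a x
    rw [hR', hRa, sub_zero] at this
    rw [← this]; simp
  rw [hprim b]
  have hmono : ∀ x ∈ Icc a b, 0 ≤ R.eval x ∧ R.eval x ≤ R.eval b := by
    intro x hx
    have h2 : ∫ t in x..b, (q.eval t) ^ 2 = R.eval b - R.eval x := by
      rw [← poly_eval_sub_eq_integral, hR']; simp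
    constructor
    · rw [← hprim x]; exact intervalIntegral.integral_nonneg hx.1 fun t _ => sq_nonneg _
    · have : 0 ≤ ∫ t in x..b, (q.eval t) ^ 2 :=
        intervalIntegral.integral_nonneg hx.2 fun t _ => sq_nonneg _
      linarith
  have hRb := (hmono b ⟨hab.le, le_rfl⟩).1
  suffices h : ∀ J, R.eval b < J → (b - a) * (q.eval b) ^ 2 ≤ (2 * n + 1) ^ 2 * J by
    refine le_of_forall_pos_le_add fun e he => ?_
    have h1 : (0 : ℝ) < (2 * n + 1) ^ 2 := by positivity
    have := h (R.eval b + e / (2 * n + 1) ^ 2) (by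
      have : 0 < e / (2 * n + 1) ^ 2 := by positivity
      linarith)
    rwa [mul_add, mul_div_cancel₀ _ h1.ne'] at this
  intro J hJ
  have hJ0 : 0 < J := hRb.trans_lt hJ
  set A : Polynomial ℝ := Polynomial.C ((b - a) / 2) * Polynomial.X + Polynomial.C ((a + b) / 2)
    with hA
  have hAd : A.natDegree ≤ 1 := by rw [hA]; compute_degree
  set P : Polynomial ℝ := Polynomial.C (2 / J) * R.comp A - 1 with hP
  have hPd : P.degree ≤ ((2 * n + 1 : ℕ) : WithBot ℕ) := by
    rw [← Polynomial.natDegree_le_iff_degree_le]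
    refine (Polynomial.natDegree_sub_le _ _).trans ?_
    rw [Polynomial.natDegree_one, max_eq_left (Nat.zero_le _)]
    refine (Polynomial.natDegree_C_mul_le _ _).trans ?_
    refine Polynomial.natDegree_comp_le.trans ?_
    calc R.natDegree * A.natDegree ≤ (2 * n + 1) * 1 := Nat.mul_le_mul hRd hAd
      _ = _ := by ring
  have hbd : ∀ x ∈ Set.Icc (-1 : ℝ) 1, |P.eval x| ≤ 1 := by
    intro x hx
    have hmem : A.eval x ∈ Icc a b := by
      simp only [hA, Polynomial.eval_add, Polynomial.eval_mul, Polynomial.eval_C, Polynomial.eval_X]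
      constructor <;> nlinarith [hx.1, hx.2]
    obtain ⟨h1, h2⟩ := hmono _ hmem
    have h3 : P.eval x = 2 / J * R.eval (A.eval x) - 1 := by
      simp [hP, Polynomial.eval_comp]
    rw [h3, abs_le]
    have h4 : 0 ≤ 2 / J * R.eval (A.eval x) := by positivity
    have h5 : 2 / J * R.eval (A.eval x) ≤ 2 / J * J := by
      gcongr; linarith
    rw [div_mul_cancel₀ _ hJ0.ne'] at h5
    constructor <;> linarith
  have key := Polynomial.Chebyshev.eval_iterate_derivative_le_of_forall_abs_le_one
    (k := 1) (le_refl (1 : ℝ)) hPd hbd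
  simp only [Function.iterate_one] at key
  rw [Polynomial.Chebyshev.derivative_T_eval_one] at key
  have hPder : (Polynomial.derivative P).eval 1 = (b - a) / J * (q.eval b) ^ 2 := by
    have h1 : A.eval 1 = b := by simp [hA]; ring
    have h2 : A.derivative = Polynomial.C ((b - a) / 2) := by simp [hA]
    simp only [hP, Polynomial.derivative_sub, Polynomial.derivative_mul, Polynomial.derivative_C,
      Polynomial.derivative_comp, hR', h2, Polynomial.eval_sub, Polynomial.eval_add,
      Polynomial.eval_mul, Polynomial.eval_C, Polynomial.eval_comp, h1, Polynomial.eval_pow,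
      Polynomial.derivative_one, Polynomial.eval_zero]
    field_simp
    ring
  rw [hPder] at key
  push_cast at key
  rw [div_mul_eq_mul_div, div_le_iff₀ hJ0] at key
  exact key

/-- Trace inequality at the left endpoint for polynomials of degree at most `n`. -/
lemma poly_trace_left (q : Polynomial ℝ) (n : ℕ) (hq : q.natDegree ≤ n) {a b : ℝ} (hab : a < b) :
    (b - a) * (q.eval a) ^ 2 ≤ (2 * n + 1) ^ 2 * ∫ t in a..b, (q.eval t) ^ 2 := by
  have h := poly_trace_right (q.comp (Polynomial.C (a + b) - Polynomial.X)) n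
    (Polynomial.natDegree_comp_le.trans (by
      have : (Polynomial.C (a + b) - Polynomial.X : Polynomial ℝ).natDegree ≤ 1 := by
        compute_degree
      calc _ ≤ n * 1 := Nat.mul_le_mul hq this
        _ = n := mul_one n)) hab
  simp only [Polynomial.eval_comp, Polynomial.eval_sub, Polynomial.eval_C, Polynomial.eval_X,
    add_sub_cancel_right] at h
  rwa [intervalIntegral.integral_comp_sub_left (fun t => (q.eval t) ^ 2), add_sub_cancel_right,
    add_sub_cancel_left] at h

lemma intervalIntegrable_of_continuousOn_Icc {f : ℝ → ℝ} {a c : ℝ} (hac : a ≤ c)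
    (hf : ContinuousOn f (Icc a c)) : IntervalIntegrable f volume a c := by
  apply ContinuousOn.intervalIntegrable
  rwa [uIcc_of_le hac]

/-- Young's inequality for the integral of a product. -/
lemma abs_integral_mul_le_young {f g : ℝ → ℝ} {a c : ℝ} (hac : a ≤ c)
    (hf : ContinuousOn f (Icc a c)) (hg : ContinuousOn g (Icc a c)) {s : ℝ} (hs : 0 < s) :
    |∫ t in a..c, f t * g t| ≤ s * (∫ t in a..c, f t ^ 2) + 1 / (4 * s) * ∫ t in a..c, g t ^ 2 := by
  have h1 : IntervalIntegrable (fun t => f t ^ 2) volume a c :=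
    intervalIntegrable_of_continuousOn_Icc hac (hf.pow 2)
  have h2 : IntervalIntegrable (fun t => g t ^ 2) volume a c :=
    intervalIntegrable_of_continuousOn_Icc hac (hg.pow 2)
  rw [← intervalIntegral.integral_const_mul, ← intervalIntegral.integral_const_mul,
    ← intervalIntegral.integral_add (h1.const_mul s) (h2.const_mul _)]
  refine (intervalIntegral.abs_integral_le_integral_abs hac).trans ?_
  refine intervalIntegral.integral_mono_on hac
    (intervalIntegrable_of_continuousOn_Icc hac (hf.mul hg).abs)
    ((h1.const_mul s).add (h2.const_mul _)) fun t _ => ?_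
  have h3 : s * f t ^ 2 + 1 / (4 * s) * g t ^ 2 - f t * g t = s * (f t - g t / (2 * s)) ^ 2 := by
    field_simp; ring
  have h4 : s * f t ^ 2 + 1 / (4 * s) * g t ^ 2 + f t * g t = s * (f t + g t / (2 * s)) ^ 2 := by
    field_simp; ring
  rw [abs_le]
  constructor
  · have : 0 ≤ s * (f t + g t / (2 * s)) ^ 2 := by positivity
    linarith
  · have : 0 ≤ s * (f t - g t / (2 * s)) ^ 2 := by positivity
    linarith

/-- The Galerkin identity on one cell: the form tested with `V` minus the load, in terms of the
residual `g` of `w`, the approximation error `w - P` and the coercive part. -/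
lemma cell_identity {a c ε₁ ε₂ σ : ℝ} (hac : a < c) {bb rr ff w w1 w2 g : ℝ → ℝ}
    (hb : ContDiff ℝ (⊤ : ℕ∞) bb) (hr : Continuous rr) (hf : Continuous ff)
    (hw : ∀ x ∈ Icc a c, HasDerivAt w (w1 x) x) (hw1 : ∀ x ∈ Icc a c, HasDerivAt w1 (w2 x) x)
    (hw2 : ContinuousOn w2 (Icc a c))
    (heq : ∀ x ∈ Icc a c, -ε₁ * w2 x + ε₂ * bb x * w1 x + rr x * w x = ff x - g x)
    {p : ℕ} {V P E : Polynomial ℝ} (hP : P.natDegree ≤ p) {vl vr : ℝ}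
    (hE : ∀ q : Polynomial ℝ, q.natDegree ≤ p - 1 → (∫ t in a..c, E.eval t * q.eval t) =
      -(∫ t in a..c, V.eval t * q.derivative.eval t) + vr * q.eval c - vl * q.eval a)
    {Dc : ℝ → ℝ}
    (hDc : (∫ t in a..c, Dc t * V.eval t) =
      -(∫ t in a..c, (P.eval t - V.eval t) * deriv (fun s => bb s * V.eval s) t)
      + (P.eval c - vr) * (bb c * V.eval c) - (P.eval a - vl) * (bb a * V.eval a)) :
    ε₁ * (∫ t in a..c, (P.derivative.eval t - E.eval t) * E.eval t)
      + ε₂ * (∫ t in a..c, Dc t * V.eval t)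
      + (∫ t in a..c, rr t * (P.eval t - V.eval t) * V.eval t)
      - σ * ((V.eval c - vr) ^ 2 + (V.eval a - vl) ^ 2)
      - ε₂ * bb c * (V.eval c - vr) ^ 2 - (∫ t in a..c, ff t * V.eval t)
    = -(ε₁ * (∫ t in a..c, E.eval t ^ 2)
        + (∫ t in a..c, (rr t - ε₂ * deriv bb t / 2) * V.eval t ^ 2)
        + σ * ((V.eval c - vr) ^ 2 + (V.eval a - vl) ^ 2)
        + ε₂ / 2 * (bb c * (V.eval c - vr) ^ 2 + bb a * (V.eval a - vl) ^ 2))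
      - ε₁ * (∫ t in a..c, (w1 t - P.derivative.eval t) * V.derivative.eval t)
      + ε₁ * ((w1 c - P.derivative.eval c) * (V.eval c - vr)
          - (w1 a - P.derivative.eval a) * (V.eval a - vl))
      - ε₂ * (∫ t in a..c, bb t * (w1 t - P.derivative.eval t) * V.eval t)
      - (∫ t in a..c, rr t * (w t - P.eval t) * V.eval t)
      - (∫ t in a..c, g t * V.eval t)
      + ((ε₁ * w1 c * vr - ε₂ / 2 * bb c * vr ^ 2)
        - (ε₁ * w1 a * vl - ε₂ / 2 * bb a * vl ^ 2)) := by
  have hb' : Continuous (deriv bb) := hb.continuous_deriv (by simp)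
  have hbc : Continuous bb := hb.continuous
  have hbd : ∀ x, HasDerivAt bb (deriv bb x) x := fun x =>
    (hb.differentiable (by simp) x).hasDerivAt
  have hwc : ContinuousOn w (Icc a c) := fun x hx => (hw x hx).continuousAt.continuousWithinAt
  have hw1c : ContinuousOn w1 (Icc a c) := fun x hx => (hw1 x hx).continuousAt.continuousWithinAt
  have hg : ∀ x ∈ Icc a c, g x = ff x - (-ε₁ * w2 x + ε₂ * bb x * w1 x + rr x * w x) := by
    intro x hx; rw [heq x hx]; ring
  have hgc : ContinuousOn g (Icc a c) := by
    refine ContinuousOn.congr ?_ hg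
    fun_prop
  have hII : ∀ {f : ℝ → ℝ}, ContinuousOn f (Icc a c) → IntervalIntegrable f volume a c :=
    fun h => intervalIntegrable_of_continuousOn_Icc hac.le h
  have hder : ∀ t, deriv (fun s => bb s * V.eval s) t
      = deriv bb t * V.eval t + bb t * V.derivative.eval t := fun t =>
    ((hbd t).mul (V.hasDerivAt t)).deriv
  simp only [hder] at hDc
  have hEP := hE P.derivative ((Polynomial.natDegree_derivative_le P).trans
    (Nat.sub_le_sub_right hP 1))
  have hsplit : (∫ t in a..c, (P.derivative.eval t - E.eval t) * E.eval t)
      = (∫ t in a..c, E.eval t * P.derivative.eval t) - ∫ t in a..c, E.eval t ^ 2 := by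
    rw [← intervalIntegral.integral_sub (hII (by fun_prop)) (hII (by fun_prop))]
    congr 1; ext t; ring
  -- everything else is the integral of an exact derivative
  have hFTC := intervalIntegral.integral_eq_sub_of_hasDerivAt
    (f := fun t => ε₁ * (w1 t - P.derivative.eval t) * V.eval t
      - ε₂ * P.eval t * bb t * V.eval t + ε₂ / 2 * bb t * V.eval t ^ 2)
    (f' := fun t => ε₁ * (-(V.eval t * P.derivative.derivative.eval t))
      + ε₂ * (-((P.eval t - V.eval t) * (deriv bb t * V.eval t + bb t * V.derivative.eval t)))
      + rr t * (P.eval t - V.eval t) * V.eval t - ff t * V.eval t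
      + (rr t - ε₂ * deriv bb t / 2) * V.eval t ^ 2
      + ε₁ * ((w1 t - P.derivative.eval t) * V.derivative.eval t)
      + ε₂ * (bb t * (w1 t - P.derivative.eval t) * V.eval t)
      + rr t * (w t - P.eval t) * V.eval t + g t * V.eval t) (a := a) (b := c) ?_ ?_
  · rw [intervalIntegral.integral_add, intervalIntegral.integral_add, intervalIntegral.integral_add,
      intervalIntegral.integral_add, intervalIntegral.integral_add, intervalIntegral.integral_sub,
      intervalIntegral.integral_add, intervalIntegral.integral_add,
      intervalIntegral.integral_const_mul, intervalIntegral.integral_const_mul,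
      intervalIntegral.integral_const_mul, intervalIntegral.integral_const_mul,
      intervalIntegral.integral_neg, intervalIntegral.integral_neg] at hFTC
    · rw [hsplit, hEP, hDc]
      linear_combination hFTC
    all_goals exact hII (by fun_prop)
  · intro t ht
    rw [uIcc_of_le hac.le] at ht
    have h1 := ((((hw1 t ht).sub (P.derivative.hasDerivAt t)).const_mul ε₁).mul (V.hasDerivAt t))
    have h2 := ((((P.hasDerivAt t).const_mul ε₂).mul (hbd t)).mul (V.hasDerivAt t))
    have h3 := (((hbd t).const_mul (ε₂ / 2)).mul ((V.hasDerivAt t).pow 2))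
    refine ((h1.sub h2).add h3).congr_deriv ?_
    rw [hg t ht]
    simp only [Pi.mul_apply, Pi.pow_apply, Pi.sub_apply]
    push_cast
    ring
  · exact hII (by fun_prop)

/-- The inverse-type bound: the classical derivative of a discrete weak function is controlled by
its weak derivative and its jumps. -/
lemma integral_derivative_sq_le {a c : ℝ} (hac : a < c) {p : ℕ} (hp : 1 ≤ p)
    {V E : Polynomial ℝ} (hV : V.natDegree ≤ p) (hEd : E.natDegree ≤ p - 1) {vl vr : ℝ}
    (hE : ∀ q : Polynomial ℝ, q.natDegree ≤ p - 1 → (∫ t in a..c, E.eval t * q.eval t) =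
      -(∫ t in a..c, V.eval t * q.derivative.eval t) + vr * q.eval c - vl * q.eval a) :
    (∫ t in a..c, V.derivative.eval t ^ 2) ≤ 2 * (∫ t in a..c, E.eval t ^ 2)
      + 16 * ((p : ℝ) ^ 2 / (c - a)) * ((V.eval c - vr) ^ 2 + (V.eval a - vl) ^ 2) := by
  have hII : ∀ {f : ℝ → ℝ}, ContinuousOn f (Icc a c) → IntervalIntegrable f volume a c :=
    fun h => intervalIntegrable_of_continuousOn_Icc hac.le h
  set q := V.derivative - E with hq
  have hqd : q.natDegree ≤ p - 1 := (Polynomial.natDegree_sub_le _ _).trans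
    (max_le ((Polynomial.natDegree_derivative_le V).trans (Nat.sub_le_sub_right hV 1)) hEd)
  have hpr : ((2 * (p - 1 : ℕ) + 1 : ℝ)) ^ 2 ≤ 4 * (p : ℝ) ^ 2 := by
    have h1 : (1 : ℝ) ≤ p := by exact_mod_cast hp
    push_cast [Nat.cast_sub hp]
    nlinarith
  have hX0 : 0 ≤ ∫ t in a..c, q.eval t ^ 2 :=
    intervalIntegral.integral_nonneg hac.le fun t _ => sq_nonneg _
  have hr := (poly_trace_right q (p - 1) hqd hac).trans (mul_le_mul_of_nonneg_right hpr hX0)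
  have hl := (poly_trace_left q (p - 1) hqd hac).trans (mul_le_mul_of_nonneg_right hpr hX0)
  have hFTC := intervalIntegral.integral_eq_sub_of_hasDerivAt
    (f := fun t => V.eval t * q.eval t)
    (f' := fun t => V.derivative.eval t * q.eval t + V.eval t * q.derivative.eval t)
    (a := a) (b := c) (fun t _ => (V.hasDerivAt t).mul (q.hasDerivAt t))
    (hII (by fun_prop))
  rw [intervalIntegral.integral_add (hII (by fun_prop)) (hII (by fun_prop))] at hFTC
  have hqq : (∫ t in a..c, q.eval t ^ 2) = (∫ t in a..c, V.derivative.eval t * q.eval t)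
      - ∫ t in a..c, E.eval t * q.eval t := by
    rw [← intervalIntegral.integral_sub (hII (by fun_prop)) (hII (by fun_prop))]
    congr 1; ext t; simp only [hq, Polynomial.eval_sub]; ring
  have hX : (∫ t in a..c, q.eval t ^ 2)
      = (V.eval c - vr) * q.eval c - (V.eval a - vl) * q.eval a := by
    rw [hqq, hE q hqd]; linarith
  have hVle : (∫ t in a..c, V.derivative.eval t ^ 2)
      ≤ 2 * (∫ t in a..c, E.eval t ^ 2) + 2 * ∫ t in a..c, q.eval t ^ 2 := by
    rw [← intervalIntegral.integral_const_mul, ← intervalIntegral.integral_const_mul,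
      ← intervalIntegral.integral_add (hII (by fun_prop)) (hII (by fun_prop))]
    refine intervalIntegral.integral_mono_on hac.le (hII (by fun_prop)) (hII (by fun_prop))
      fun t _ => ?_
    simp only [hq, Polynomial.eval_sub]
    nlinarith [sq_nonneg (V.derivative.eval t - 2 * E.eval t)]
  set X := ∫ t in a..c, q.eval t ^ 2
  have hpp : (0 : ℝ) < p := by exact_mod_cast hp
  have hh : 0 < c - a := sub_pos.2 hac
  have hA : 0 < 4 * (p : ℝ) ^ 2 / (c - a) := by positivity
  have young : ∀ j y : ℝ, (c - a) * y ^ 2 ≤ 4 * (p : ℝ) ^ 2 * X →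
      |j * y| ≤ 4 * (p : ℝ) ^ 2 / (c - a) * j ^ 2 + X / 4 := by
    intro j y hy
    set A := 4 * (p : ℝ) ^ 2 / (c - a) with hAdef
    have h1 : y ^ 2 ≤ A * X := by
      rw [hAdef, div_mul_eq_mul_div, le_div_iff₀ hh]; linarith
    have h2 : A * j ^ 2 + X / 4 - j * y ≥ A * (j - y / (2 * A)) ^ 2 := by
      have : A * (j - y / (2 * A)) ^ 2 = A * j ^ 2 - j * y + y ^ 2 / (4 * A) := by
        field_simp; ring
      have h3 : y ^ 2 / (4 * A) ≤ X / 4 := by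
        rw [div_le_iff₀ (by positivity)]; linarith
      linarith
    have h2' : A * j ^ 2 + X / 4 + j * y ≥ A * (j + y / (2 * A)) ^ 2 := by
      have : A * (j + y / (2 * A)) ^ 2 = A * j ^ 2 + j * y + y ^ 2 / (4 * A) := by
        field_simp; ring
      have h3 : y ^ 2 / (4 * A) ≤ X / 4 := by
        rw [div_le_iff₀ (by positivity)]; linarith
      linarith
    have h4 : 0 ≤ A * (j - y / (2 * A)) ^ 2 := by positivity
    have h5 : 0 ≤ A * (j + y / (2 * A)) ^ 2 := by positivity
    rw [abs_le]; constructor <;> linarith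
  have y1 := (le_abs_self _).trans (young (V.eval c - vr) _ hr)
  have y2 := (neg_le_abs _).trans (young (V.eval a - vl) _ hl)
  have h3 : 16 * ((p : ℝ) ^ 2 / (c - a)) = 4 * (4 * (p : ℝ) ^ 2 / (c - a)) := by ring
  rw [h3]
  linarith

/-- The coercive quantity on a cell. -/
def cellK (a c ε₁ ε₂ γ σ : ℝ) (bb : ℝ → ℝ) (V E : Polynomial ℝ) (vl vr : ℝ) : ℝ :=
  ε₁ * (∫ t in a..c, E.eval t ^ 2) + γ * (∫ t in a..c, V.eval t ^ 2)
    + σ * ((V.eval c - vr) ^ 2 + (V.eval a - vl) ^ 2)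
    + ε₂ / 2 * (bb c * (V.eval c - vr) ^ 2 + bb a * (V.eval a - vl) ^ 2)

lemma abs_mul_le_young (x y : ℝ) {s : ℝ} (hs : 0 < s) :
    |x * y| ≤ s * x ^ 2 + 1 / (4 * s) * y ^ 2 := by
  have h3 : s * x ^ 2 + 1 / (4 * s) * y ^ 2 - x * y = s * (x - y / (2 * s)) ^ 2 := by
    field_simp; ring
  have h4 : s * x ^ 2 + 1 / (4 * s) * y ^ 2 + x * y = s * (x + y / (2 * s)) ^ 2 := by
    field_simp; ring
  have h5 : 0 ≤ s * (x + y / (2 * s)) ^ 2 := by positivity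
  have h6 : 0 ≤ s * (x - y / (2 * s)) ^ 2 := by positivity
  rw [abs_le]
  constructor <;> linarith

lemma integral_mul_sq_le {f k : ℝ → ℝ} {a c B : ℝ} (hac : a ≤ c) (hf : ContinuousOn f (Icc a c))
    (hk : ContinuousOn k (Icc a c)) (hB : ∀ t ∈ Icc a c, |k t| ≤ B) :
    (∫ t in a..c, (k t * f t) ^ 2) ≤ B ^ 2 * ∫ t in a..c, f t ^ 2 := by
  rw [← intervalIntegral.integral_const_mul]
  refine intervalIntegral.integral_mono_on hac
    (intervalIntegrable_of_continuousOn_Icc hac ((hk.mul hf).pow 2))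
    (intervalIntegrable_of_continuousOn_Icc hac (by fun_prop)) fun t ht => ?_
  rw [mul_pow]
  refine mul_le_mul_of_nonneg_right ?_ (sq_nonneg _)
  rw [← sq_abs (k t)]
  exact pow_le_pow_left₀ (abs_nonneg _) (hB t ht) 2

set_option maxHeartbeats 2000000 in
/-- The consistency terms on a cell are absorbed by half the coercive part. -/
lemma cell_rest_bound {a c ε₁ ε₂ γ B η : ℝ} (hac : a < c) (hε₁ : 0 < ε₁)
    (hε₁' : ε₁ ≤ 1) (hε₂ : 0 < ε₂) (hγ : 0 < γ) (hB1 : 1 ≤ B) {bb rr Q Q1 g A e e1 : ℝ → ℝ}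
    (hb : ContDiff ℝ (⊤ : ℕ∞) bb) (hr : Continuous rr)
    (hbB : ∀ t ∈ Icc a c, |bb t| ≤ B) (hb'B : ∀ t ∈ Icc a c, |deriv bb t| ≤ B)
    (hrB : ∀ t ∈ Icc a c, |rr t| ≤ B) (hbpos : ∀ t ∈ Icc a c, 0 < bb t)
    (hQ : ContinuousOn Q (Icc a c)) (hQ1 : ContinuousOn Q1 (Icc a c))
    (hA : ContinuousOn A (Icc a c)) (he1 : ContinuousOn e1 (Icc a c))
    (hg : ContinuousOn g (Icc a c))
    (he : ∀ x ∈ Icc a c, HasDerivAt e (e1 x) x)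
    (hsplit : ∀ x ∈ Icc a c, Q1 x = A x + e1 x)
    {p : ℕ} (hp : 1 ≤ p) {V E : Polynomial ℝ} (hV : V.natDegree ≤ p) (hEd : E.natDegree ≤ p - 1)
    {vl vr : ℝ}
    (hE : ∀ q : Polynomial ℝ, q.natDegree ≤ p - 1 → (∫ t in a..c, E.eval t * q.eval t) =
      -(∫ t in a..c, V.eval t * q.derivative.eval t) + vr * q.eval c - vl * q.eval a)
    (n1 : ε₁ * (∫ t in a..c, Q1 t ^ 2) ≤ η ^ 2)
    (n2 : ε₁ * (c - a) * A c ^ 2 ≤ η ^ 2) (n2' : ε₁ ^ 2 * e1 c ^ 2 ≤ ε₂ * bb c * η ^ 2)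
    (n3 : ε₁ * (c - a) * Q1 a ^ 2 ≤ η ^ 2)
    (n4 : ε₂ ^ 2 * (∫ t in a..c, A t ^ 2) ≤ η ^ 2)
    (n5 : ε₂ ^ 2 / ε₁ * (∫ t in a..c, e t ^ 2) ≤ η ^ 2)
    (n6 : ε₂ * e c ^ 2 ≤ η ^ 2) (n7 : ε₂ * e a ^ 2 ≤ η ^ 2)
    (n8 : (∫ t in a..c, Q t ^ 2) ≤ η ^ 2) (n9 : (∫ t in a..c, g t ^ 2) ≤ η ^ 2) :
    - ε₁ * (∫ t in a..c, Q1 t * V.derivative.eval t)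
      + ε₁ * (Q1 c * (V.eval c - vr) - Q1 a * (V.eval a - vl))
      - ε₂ * (∫ t in a..c, bb t * Q1 t * V.eval t)
      - (∫ t in a..c, rr t * Q t * V.eval t)
      - (∫ t in a..c, g t * V.eval t)
    ≤ cellK a c ε₁ ε₂ γ (ε₁ * (p : ℝ) ^ 2 / (c - a)) bb V E vl vr / 2
      + (148 * B ^ 2 + 16 * B ^ 2 / γ) * η ^ 2
      - (ε₂ * bb c * e c * vr - ε₂ * bb a * e a * vl) := by
  have hII : ∀ {f : ℝ → ℝ}, ContinuousOn f (Icc a c) → IntervalIntegrable f volume a c :=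
    fun h => intervalIntegrable_of_continuousOn_Icc hac.le h
  have hb' : Continuous (deriv bb) := hb.continuous_deriv (by simp)
  have hbc : Continuous bb := hb.continuous
  have hbd : ∀ x, HasDerivAt bb (deriv bb x) x := fun x =>
    (hb.differentiable (by simp) x).hasDerivAt
  have hec : ContinuousOn e (Icc a c) := fun x hx => (he x hx).continuousAt.continuousWithinAt
  have hh : 0 < c - a := sub_pos.2 hac
  have hpp : (1 : ℝ) ≤ p := by exact_mod_cast hp
  have hY := integral_derivative_sq_le hac hp hV hEd hE
  -- integrate the `e`-part by parts
  have hFTC := intervalIntegral.integral_eq_sub_of_hasDerivAt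
    (f := fun t => bb t * e t * V.eval t)
    (f' := fun t => bb t * e1 t * V.eval t + deriv bb t * e t * V.eval t
      + bb t * e t * V.derivative.eval t) (a := a) (b := c) (fun t ht => by
        rw [uIcc_of_le hac.le] at ht
        refine (((hbd t).mul (he t ht)).mul (V.hasDerivAt t)).congr_deriv ?_
        simp only [Pi.mul_apply]
        ring) (hII (by fun_prop))
  rw [intervalIntegral.integral_add (hII (by fun_prop)) (hII (by fun_prop)),
    intervalIntegral.integral_add (hII (by fun_prop)) (hII (by fun_prop))] at hFTC
  have hconv : (∫ t in a..c, bb t * Q1 t * V.eval t)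
      = (∫ t in a..c, bb t * A t * V.eval t) + ∫ t in a..c, bb t * e1 t * V.eval t := by
    rw [← intervalIntegral.integral_add (hII (by fun_prop)) (hII (by fun_prop))]
    refine intervalIntegral.integral_congr fun t ht => ?_
    rw [uIcc_of_le hac.le] at ht
    simp only [hsplit t ht]; ring
  have y1 := abs_integral_mul_le_young (f := Q1) (g := fun t => V.derivative.eval t) hac.le hQ1
    (by fun_prop) (s := 64) (by norm_num)
  have y2 := abs_integral_mul_le_young (f := fun t => bb t * A t) (g := fun t => V.eval t) hac.le
    (by fun_prop) (by fun_prop) (s := 4 * ε₂ / γ) (by positivity)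
  have y3 := abs_integral_mul_le_young (f := fun t => deriv bb t * e t) (g := fun t => V.eval t)
    hac.le (by fun_prop) (by fun_prop) (s := 4 * ε₂ / γ) (by positivity)
  have y4 := abs_integral_mul_le_young (f := fun t => bb t * e t)
    (g := fun t => V.derivative.eval t)
    hac.le (by fun_prop) (by fun_prop) (s := 64 * ε₂ / ε₁) (by positivity)
  have y5 := abs_integral_mul_le_young (f := fun t => rr t * Q t)
    (g := fun t => V.eval t) hac.le (by fun_prop) (by fun_prop) (s := 4 / γ) (by positivity)
  have y6 := abs_integral_mul_le_young (f := g)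
    (g := fun t => V.eval t) hac.le (by fun_prop) (by fun_prop) (s := 4 / γ) (by positivity)
  have z2 := integral_mul_sq_le hac.le hA hbc.continuousOn hbB
  have z3 := integral_mul_sq_le hac.le hec hb'.continuousOn hb'B
  have z4 := integral_mul_sq_le hac.le hec hbc.continuousOn hbB
  have z5 := integral_mul_sq_le hac.le hQ hr.continuousOn hrB
  have x1 := abs_mul_le_young (A c) (V.eval c - vr) (s := 4 * (c - a)) (by positivity)
  have x2 := abs_mul_le_young (Q1 a) (V.eval a - vl) (s := 4 * (c - a)) (by positivity)
  have x3 := abs_mul_le_young (e c) (V.eval c - vr) (s := 4) (by positivity)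
  have x4 := abs_mul_le_young (e a) (V.eval a - vl) (s := 4) (by positivity)
  have hcmem : c ∈ Icc a c := right_mem_Icc.2 hac.le
  have hamem : a ∈ Icc a c := left_mem_Icc.2 hac.le
  have hbcp := hbpos c hcmem
  have hbap := hbpos a hamem
  have hbcB := (le_abs_self _).trans (hbB c hcmem)
  have hbaB := (le_abs_self _).trans (hbB a hamem)
  rw [hconv]
  unfold cellK
  set iA := ∫ t in a..c, bb t * A t * V.eval t
  set ie1 := ∫ t in a..c, bb t * e1 t * V.eval t
  set ib' := ∫ t in a..c, deriv bb t * e t * V.eval t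
  set ibV := ∫ t in a..c, bb t * e t * V.derivative.eval t
  set iQ1 := ∫ t in a..c, Q1 t * V.derivative.eval t
  set irQ := ∫ t in a..c, rr t * Q t * V.eval t
  set ig := ∫ t in a..c, g t * V.eval t
  set Y := ∫ t in a..c, V.derivative.eval t ^ 2
  set X := ∫ t in a..c, V.eval t ^ 2
  set Z := ∫ t in a..c, E.eval t ^ 2
  set jr := V.eval c - vr with hjr
  set jl := V.eval a - vl with hjl
  set σ := ε₁ * (p : ℝ) ^ 2 / (c - a) with hσ
  have e1' : ie1 = bb c * e c * (jr + vr) - bb a * e a * (jl + vl) - ib' - ibV := by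
    rw [hjr, hjl]; linarith
  have hX0 : 0 ≤ X := intervalIntegral.integral_nonneg hac.le fun t _ => sq_nonneg _
  have hZ0 : 0 ≤ Z := intervalIntegral.integral_nonneg hac.le fun t _ => sq_nonneg _
  have hY' : ε₁ * Y ≤ 2 * (ε₁ * Z) + 16 * σ * (jr ^ 2 + jl ^ 2) := by
    have := mul_le_mul_of_nonneg_left hY hε₁.le
    have h2 : ε₁ * (2 * Z + 16 * ((p : ℝ) ^ 2 / (c - a)) * (jr ^ 2 + jl ^ 2))
      = 2 * (ε₁ * Z) + 16 * σ * (jr ^ 2 + jl ^ 2) := by rw [hσ]; ring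
    linarith
  have hσh : ε₁ / (c - a) ≤ σ := by
    rw [hσ]; gcongr; exact le_mul_of_one_le_right hε₁.le (one_le_pow₀ hpp)
  have t1 : |ε₁ * iQ1| ≤ 64 * η ^ 2 + ε₁ * Y / 256 := by
    rw [abs_mul, abs_of_pos hε₁]
    calc ε₁ * |iQ1| ≤ ε₁ * (64 * (∫ t in a..c, Q1 t ^ 2) + 1 / (4 * 64) * Y) := by gcongr
      _ ≤ _ := by linarith
  have bsq : (1 : ℝ) ≤ B ^ 2 := one_le_pow₀ hB1
  have t2 : |ε₂ * iA| ≤ 4 * B ^ 2 / γ * η ^ 2 + γ * X / 16 := by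
    rw [abs_mul, abs_of_pos hε₂]
    calc ε₂ * |iA| ≤ ε₂ * (4 * ε₂ / γ * (B ^ 2 * ∫ t in a..c, A t ^ 2)
            + 1 / (4 * (4 * ε₂ / γ)) * X) := by
          refine mul_le_mul_of_nonneg_left (y2.trans ?_) hε₂.le
          gcongr
      _ = 4 * B ^ 2 / γ * (ε₂ ^ 2 * ∫ t in a..c, A t ^ 2) + γ * X / 16 := by
          field_simp; ring
      _ ≤ _ := by gcongr
  have n5' : ε₂ ^ 2 * (∫ t in a..c, e t ^ 2) ≤ η ^ 2 := by
    have h0 : 0 ≤ ∫ t in a..c, e t ^ 2 :=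
      intervalIntegral.integral_nonneg hac.le fun t _ => sq_nonneg _
    refine le_trans ?_ n5
    refine mul_le_mul_of_nonneg_right ?_ h0
    rw [le_div_iff₀ hε₁]; exact mul_le_of_le_one_right (sq_nonneg _) hε₁'
  have t3 : |ε₂ * ib'| ≤ 4 * B ^ 2 / γ * η ^ 2 + γ * X / 16 := by
    rw [abs_mul, abs_of_pos hε₂]
    calc ε₂ * |ib'| ≤ ε₂ * (4 * ε₂ / γ * (B ^ 2 * ∫ t in a..c, e t ^ 2)
            + 1 / (4 * (4 * ε₂ / γ)) * X) := by
          refine mul_le_mul_of_nonneg_left (y3.trans ?_) hε₂.le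
          gcongr
      _ = 4 * B ^ 2 / γ * (ε₂ ^ 2 * ∫ t in a..c, e t ^ 2) + γ * X / 16 := by
          field_simp; ring
      _ ≤ _ := by gcongr
  have t4 : |ε₂ * ibV| ≤ 64 * B ^ 2 * η ^ 2 + ε₁ * Y / 256 := by
    rw [abs_mul, abs_of_pos hε₂]
    calc ε₂ * |ibV| ≤ ε₂ * (64 * ε₂ / ε₁ * (B ^ 2 * ∫ t in a..c, e t ^ 2)
            + 1 / (4 * (64 * ε₂ / ε₁)) * Y) := by
          refine mul_le_mul_of_nonneg_left (y4.trans ?_) hε₂.le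
          gcongr
      _ = 64 * B ^ 2 * (ε₂ ^ 2 / ε₁ * ∫ t in a..c, e t ^ 2) + ε₁ * Y / 256 := by
          field_simp; ring
      _ ≤ _ := by gcongr
  have t5 : |irQ| ≤ 4 * B ^ 2 / γ * η ^ 2 + γ * X / 16 := by
    calc |irQ| ≤ 4 / γ * (B ^ 2 * ∫ t in a..c, Q t ^ 2)
            + 1 / (4 * (4 / γ)) * X := by
          refine y5.trans ?_
          gcongr
      _ = 4 * B ^ 2 / γ * (∫ t in a..c, Q t ^ 2) + γ * X / 16 := by
          field_simp; ring
      _ ≤ _ := by gcongr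
  have t6 : |ig| ≤ 4 * B ^ 2 / γ * η ^ 2 + γ * X / 16 := by
    calc |ig| ≤ 4 / γ * (∫ t in a..c, g t ^ 2) + 1 / (4 * (4 / γ)) * X := y6
      _ ≤ 4 / γ * (B ^ 2 * η ^ 2) + 1 / (4 * (4 / γ)) * X := by
          gcongr; exact n9.trans (le_mul_of_one_le_left (sq_nonneg η) bsq)
      _ = _ := by field_simp; ring
  have jt : ∀ q j : ℝ, ε₁ * (c - a) * q ^ 2 ≤ η ^ 2 →
      |q * j| ≤ 4 * (c - a) * q ^ 2 + 1 / (4 * (4 * (c - a))) * j ^ 2 →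
      |ε₁ * (q * j)| ≤ 4 * η ^ 2 + σ * j ^ 2 / 16 := by
    intro q j h1 h2
    rw [abs_mul, abs_of_pos hε₁]
    calc ε₁ * |q * j| ≤ ε₁ * (4 * (c - a) * q ^ 2 + 1 / (4 * (4 * (c - a))) * j ^ 2) := by gcongr
      _ = 4 * (ε₁ * (c - a) * q ^ 2) + ε₁ / (c - a) * j ^ 2 / 16 := by field_simp; ring
      _ ≤ _ := by gcongr
  have et : ∀ q j β : ℝ, 0 < β → β ≤ B → ε₂ * q ^ 2 ≤ η ^ 2 →
      |q * j| ≤ 4 * q ^ 2 + 1 / (4 * 4) * j ^ 2 →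
      |ε₂ * β * (q * j)| ≤ 4 * B ^ 2 * η ^ 2 + ε₂ * β * j ^ 2 / 16 := by
    intro q j β hβ hβB h1 h2
    rw [abs_mul, abs_of_pos (by positivity : 0 < ε₂ * β)]
    calc ε₂ * β * |q * j| ≤ ε₂ * β * (4 * q ^ 2 + 1 / (4 * 4) * j ^ 2) := by gcongr
      _ = 4 * β * (ε₂ * q ^ 2) + ε₂ * β * j ^ 2 / 16 := by ring
      _ ≤ _ := by
        have : β ≤ B ^ 2 := hβB.trans (le_self_pow₀ hB1 two_ne_zero)
        gcongr
  have j1 := jt _ _ n2 x1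
  have j1' : |ε₁ * (e1 c * jr)| ≤ 4 * η ^ 2 + ε₂ * bb c * jr ^ 2 / 16 := by
    have hs : 0 < ε₂ * bb c := by positivity
    have h := abs_mul_le_young (ε₁ * e1 c) jr (s := 4 / (ε₂ * bb c)) (by positivity)
    rw [← mul_assoc]
    refine h.trans ?_
    have h1 : 4 / (ε₂ * bb c) * (ε₁ * e1 c) ^ 2 ≤ 4 * η ^ 2 := by
      rw [mul_pow, div_mul_eq_mul_div, div_le_iff₀ hs]; linarith
    have h2 : 1 / (4 * (4 / (ε₂ * bb c))) * jr ^ 2 = ε₂ * bb c * jr ^ 2 / 16 := by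
      field_simp; ring
    rw [h2]; linarith
  have hQc : Q1 c = A c + e1 c := hsplit c hcmem
  have j2 := jt _ _ n3 x2
  have j3 := et _ _ _ hbcp hbcB n6 x3
  have j4 := et _ _ _ hbap hbaB n7 x4
  rw [e1']
  have hσ0 : 0 ≤ σ := (by positivity : 0 ≤ ε₁ / (c - a)).trans hσh
  have p1 : 0 ≤ σ * jr ^ 2 := by positivity
  have p2 : 0 ≤ σ * jl ^ 2 := by positivity
  have p3 : 0 ≤ ε₂ * bb c * jr ^ 2 := by positivity
  have p4 : 0 ≤ ε₂ * bb a * jl ^ 2 := by positivity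
  have p5 : 0 ≤ ε₁ * Z := by positivity
  have p6 : 0 ≤ γ * X := by positivity
  have p7 : η ^ 2 ≤ B ^ 2 * η ^ 2 := le_mul_of_one_le_left (sq_nonneg η) bsq
  have hC : (148 * B ^ 2 + 16 * B ^ 2 / γ) * η ^ 2
      = 148 * (B ^ 2 * η ^ 2) + 4 * (4 * B ^ 2 / γ * η ^ 2) := by ring
  rw [hC]
  clear n1 n2 n2' n3 n4 n5 n6 n7 n8 n9 n5' hY x1 x2 x3 x4 y1 y2 y3 y4 y5 y6 z2 z3 z4 z5 hFTC hconv e1'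
    hbcp hbap hbcB hbaB hX0 hZ0 hσh bsq jt et hσ0 hC hε₁' hh hpp hB1 hac
  have q1 := neg_le_abs (ε₁ * iQ1)
  have q2 := neg_le_abs (ε₂ * iA)
  have q3 := le_abs_self (ε₂ * ib')
  have q4 := le_abs_self (ε₂ * ibV)
  have q5 := neg_le_abs irQ
  have q6 := neg_le_abs ig
  have q7 := le_abs_self (ε₁ * (A c * jr))
  have q7' := le_abs_self (ε₁ * (e1 c * jr))
  rw [hQc]
  have q8 := neg_le_abs (ε₁ * (Q1 a * jl))
  have q9 := neg_le_abs (ε₂ * bb c * (e c * jr))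
  have q10 := le_abs_self (ε₂ * bb a * (e a * jl))
  linarith

lemma sum_succ_sub_castSucc {N : ℕ} (G : Fin (N + 1) → ℝ) :
    ∑ j : Fin N, (G j.succ - G j.castSucc) = G (Fin.last N) - G 0 := by
  have h1 := Fin.sum_univ_succ G
  have h2 := Fin.sum_univ_castSucc G
  rw [Finset.sum_sub_distrib]
  linarith

namespace Mesh

variable {N : ℕ} (m : Mesh N)

lemma xl_lt_xr (j : Fin N) : m.xl j < m.xr j := m.mono (Fin.castSucc_lt_succ)

lemma pt_mem (i : Fin (N + 1)) : m.pt i ∈ Icc (0 : ℝ) 1 := by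
  constructor
  · rw [← m.left]; exact m.mono.monotone (Fin.zero_le i)
  · rw [← m.right]; exact m.mono.monotone (Fin.le_last i)

lemma cell_subset (j : Fin N) : Icc (m.xl j) (m.xr j) ⊆ Icc (0 : ℝ) 1 :=
  Icc_subset_Icc (m.pt_mem _).1 (m.pt_mem _).2

lemma sum_integral_cell {f : ℝ → ℝ} (hf : ContinuousOn f (Icc 0 1)) :
    ∑ j : Fin N, (∫ t in (m.xl j)..(m.xr j), f t) = ∫ t in (0 : ℝ)..1, f t := by
  have hII : ∀ i, IntervalIntegrable f volume 0 (m.pt i) := fun i =>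
    intervalIntegrable_of_continuousOn_Icc (m.pt_mem i).1
      (hf.mono (Icc_subset_Icc le_rfl (m.pt_mem i).2))
  have h := sum_succ_sub_castSucc (fun i => ∫ t in (0 : ℝ)..(m.pt i), f t)
  simp only [m.left, m.right, intervalIntegral.integral_same, sub_zero] at h
  rw [← h]
  refine Finset.sum_congr rfl fun j _ => ?_
  rw [intervalIntegral.integral_interval_sub_left (hII _) (hII _)]
  rfl

lemma one_le_card {N : ℕ} (m : Mesh N) : 1 ≤ N := by
  rcases Nat.eq_zero_or_pos N with rfl | h
  · have h1 := m.left
    have h2 := m.right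
    have : Fin.last 0 = 0 := rfl
    rw [this, h1] at h2
    exact absurd h2 (by norm_num)
  · exact h

end Mesh

/-- The energy estimate for the boundary-value problem. -/
lemma energy_estimate {ε₁ ε₂ γ η : ℝ} (hγ : 0 < γ) {bb rr ρ ρ1 ρ2 g : ℝ → ℝ}
    (hb : ContDiff ℝ (⊤ : ℕ∞) bb) (hr : Continuous rr)
    (hco : ∀ x ∈ Icc (0 : ℝ) 1, γ ≤ rr x - ε₂ * deriv bb x / 2)
    (hρ : ∀ x ∈ Icc (0 : ℝ) 1, HasDerivAt ρ (ρ1 x) x)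
    (hρ1 : ∀ x ∈ Icc (0 : ℝ) 1, HasDerivAt ρ1 (ρ2 x) x)
    (hρ2 : ContinuousOn ρ2 (Icc 0 1)) (h0 : ρ 0 = 0) (h1 : ρ 1 = 0)
    (heq : ∀ x ∈ Icc (0 : ℝ) 1, -ε₁ * ρ2 x + ε₂ * bb x * ρ1 x + rr x * ρ x = g x)
    (hg : ∀ x ∈ Icc (0 : ℝ) 1, |g x| ≤ η) :
    ε₁ * (∫ t in (0 : ℝ)..1, ρ1 t ^ 2) + γ * (∫ t in (0 : ℝ)..1, ρ t ^ 2) / 2 ≤ η ^ 2 / γ := by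
  have hb' : Continuous (deriv bb) := hb.continuous_deriv (by simp)
  have hbc : Continuous bb := hb.continuous
  have hbd : ∀ x, HasDerivAt bb (deriv bb x) x := fun x =>
    (hb.differentiable (by simp) x).hasDerivAt
  have hρc : ContinuousOn ρ (Icc 0 1) := fun x hx => (hρ x hx).continuousAt.continuousWithinAt
  have hρcont : ContinuousOn ρ1 (Icc 0 1) := fun x hx => (hρ1 x hx).continuousAt.continuousWithinAt
  have hgc : ContinuousOn g (Icc 0 1) := by
    refine ContinuousOn.congr (f := fun x => -ε₁ * ρ2 x + ε₂ * bb x * ρ1 x + rr x * ρ x) ?_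
      (fun x hx => (heq x hx).symm)
    fun_prop
  have hII : ∀ {f : ℝ → ℝ}, ContinuousOn f (Icc 0 1) → IntervalIntegrable f volume 0 1 :=
    fun h => intervalIntegrable_of_continuousOn_Icc zero_le_one h
  have hFTC := intervalIntegral.integral_eq_sub_of_hasDerivAt
    (f := fun t => -ε₁ * (ρ1 t * ρ t) + ε₂ / 2 * bb t * ρ t ^ 2)
    (f' := fun t => g t * ρ t - ε₁ * ρ1 t ^ 2 - (rr t - ε₂ * deriv bb t / 2) * ρ t ^ 2)
    (a := 0) (b := 1) (fun t ht => by
      rw [uIcc_of_le zero_le_one] at ht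
      refine ((((hρ1 t ht).mul (hρ t ht)).const_mul (-ε₁)).add
        (((hbd t).const_mul (ε₂ / 2)).mul ((hρ t ht).pow 2))).congr_deriv ?_
      rw [← heq t ht]
      simp only [Pi.pow_apply]
      push_cast
      ring) (hII (by fun_prop))
  rw [intervalIntegral.integral_sub (hII (by fun_prop)) (hII (by fun_prop)),
    intervalIntegral.integral_sub (hII (by fun_prop)) (hII (by fun_prop)),
    intervalIntegral.integral_const_mul, h0, h1] at hFTC
  have hlow : γ * (∫ t in (0 : ℝ)..1, ρ t ^ 2)
      ≤ ∫ t in (0 : ℝ)..1, (rr t - ε₂ * deriv bb t / 2) * ρ t ^ 2 := by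
    rw [← intervalIntegral.integral_const_mul]
    exact intervalIntegral.integral_mono_on zero_le_one (hII (by fun_prop)) (hII (by fun_prop))
      fun t ht => mul_le_mul_of_nonneg_right (hco t ht) (sq_nonneg _)
  have hy := (le_abs_self _).trans (abs_integral_mul_le_young zero_le_one hgc hρc
    (s := 1 / (2 * γ)) (by positivity))
  have hg2 : (∫ t in (0 : ℝ)..1, g t ^ 2) ≤ η ^ 2 := by
    have : (∫ t in (0 : ℝ)..1, g t ^ 2) ≤ ∫ t in (0 : ℝ)..1, η ^ 2 :=
      intervalIntegral.integral_mono_on zero_le_one (hII (by fun_prop)) (hII (by fun_prop))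
        fun t ht => by
          rw [← sq_abs]; exact pow_le_pow_left₀ (abs_nonneg _) (hg t ht) 2
    simpa using this
  have h3 : 1 / (2 * γ) * (∫ t in (0 : ℝ)..1, g t ^ 2) ≤ 1 / (2 * γ) * η ^ 2 := by gcongr
  have h4 : 1 / (4 * (1 / (2 * γ))) = γ / 2 := by field_simp; norm_num
  have h5 : 1 / (2 * γ) * η ^ 2 = η ^ 2 / γ / 2 := by field_simp
  have h6 : 0 ≤ η ^ 2 / γ := by positivity
  rw [h4] at hy
  linarith

lemma integral_sq_add_le {f k : ℝ → ℝ} {a c : ℝ} (hac : a ≤ c) (hf : ContinuousOn f (Icc a c))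
    (hk : ContinuousOn k (Icc a c)) :
    (∫ t in a..c, (f t + k t) ^ 2) ≤ 2 * (∫ t in a..c, f t ^ 2) + 2 * ∫ t in a..c, k t ^ 2 := by
  rw [← intervalIntegral.integral_const_mul, ← intervalIntegral.integral_const_mul,
    ← intervalIntegral.integral_add (intervalIntegrable_of_continuousOn_Icc hac (by fun_prop))
      (intervalIntegrable_of_continuousOn_Icc hac (by fun_prop))]
  refine intervalIntegral.integral_mono_on hac
    (intervalIntegrable_of_continuousOn_Icc hac (by fun_prop))
    (intervalIntegrable_of_continuousOn_Icc hac (by fun_prop)) fun t _ => ?_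
  nlinarith [sq_nonneg (f t - k t)]

/-- The weak derivative of the error `u - u_p` on one cell. -/
lemma weakDeriv_error_bound {a c : ℝ} (hac : a < c) {u u1 : ℝ → ℝ}
    (hu : ∀ x ∈ Icc a c, HasDerivAt u (u1 x) x) (hu1 : ContinuousOn u1 (Icc a c))
    {U F P : Polynomial ℝ} {n : ℕ} {bl br : ℝ} {D : ℝ → ℝ}
    (hF : ∀ q : Polynomial ℝ, q.natDegree ≤ n → (∫ t in a..c, F.eval t * q.eval t) =
      -(∫ t in a..c, U.eval t * q.derivative.eval t) + br * q.eval c - bl * q.eval a)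
    (hD : IsWeakDerivOn a c n (fun t => u t - U.eval t) (u a - bl) (u c - br) D) :
    (∫ t in a..c, D t ^ 2) ≤ 2 * (∫ t in a..c, (u1 t - P.derivative.eval t) ^ 2)
      + 2 * ∫ t in a..c, (P.derivative - F).eval t ^ 2 := by
  have hII : ∀ {f : ℝ → ℝ}, ContinuousOn f (Icc a c) → IntervalIntegrable f volume a c :=
    fun h => intervalIntegrable_of_continuousOn_Icc hac.le h
  have huc : ContinuousOn u (Icc a c) := fun x hx => (hu x hx).continuousAt.continuousWithinAt
  obtain ⟨⟨q, hqd, hq⟩, hw⟩ := hD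
  obtain rfl : D = fun t => q.eval t := funext hq
  have h1 := hw q hqd
  have h2 := hF q hqd
  have hFTC := intervalIntegral.integral_eq_sub_of_hasDerivAt
    (f := fun t => u t * q.eval t) (f' := fun t => u1 t * q.eval t + u t * q.derivative.eval t)
    (a := a) (b := c) (fun t ht => by
      rw [uIcc_of_le hac.le] at ht
      exact (hu t ht).mul (q.hasDerivAt t)) (hII (by fun_prop))
  rw [intervalIntegral.integral_add (hII (by fun_prop)) (hII (by fun_prop))] at hFTC
  have h3 : (∫ t in a..c, (u t - U.eval t) * q.derivative.eval t)
      = (∫ t in a..c, u t * q.derivative.eval t) - ∫ t in a..c, U.eval t * q.derivative.eval t := by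
    rw [← intervalIntegral.integral_sub (hII (by fun_prop)) (hII (by fun_prop))]
    congr 1; ext t; ring
  have h4 : (∫ t in a..c, ((u1 t - P.derivative.eval t) + (P.derivative - F).eval t) * q.eval t)
      = (∫ t in a..c, u1 t * q.eval t) - ∫ t in a..c, F.eval t * q.eval t := by
    rw [← intervalIntegral.integral_sub (hII (by fun_prop)) (hII (by fun_prop))]
    congr 1; ext t; simp only [Polynomial.eval_sub]; ring
  have h5 : (∫ t in a..c, q.eval t ^ 2)
      = ∫ t in a..c, ((u1 t - P.derivative.eval t) + (P.derivative - F).eval t) * q.eval t := by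
    have : (∫ t in a..c, q.eval t ^ 2) = ∫ t in a..c, q.eval t * q.eval t := by
      congr 1; ext t; ring
    rw [this, h1, h4, h2, h3]; linarith
  have h6 := (le_abs_self _).trans (abs_integral_mul_le_young (s := 1 / 2)
    (f := fun t => (u1 t - P.derivative.eval t) + (P.derivative - F).eval t)
    (g := fun t => q.eval t) hac.le (by fun_prop) (by fun_prop) (by norm_num))
  have h7 := integral_sq_add_le (f := fun t => u1 t - P.derivative.eval t)
    (k := fun t => (P.derivative - F).eval t) hac.le (by fun_prop) (by fun_prop)
  show (∫ t in a..c, q.eval t ^ 2) ≤ _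
  rw [← h5] at h6
  have h8 : (1 : ℝ) / (4 * (1 / 2)) = 1 / 2 := by norm_num
  rw [h8] at h6
  linarith

set_option maxHeartbeats 1000000 in
/-- Quasi-optimality of the weak Galerkin method: the energy error is controlled by the residual of
an approximate solution `w` and the error of a continuous piecewise polynomial approximation of it.
The error of the derivative is split as `A + e'`; the part `e` is integrated by parts in the
convective term. -/
theorem galerkin_error {N : ℕ} (m : Mesh N) {ε₁ ε₂ γ B η : ℝ} (hε₁ : 0 < ε₁)
    (hε₁' : ε₁ ≤ 1) (hε₂ : 0 < ε₂) (hγ : 0 < γ) (hB1 : 1 ≤ B) {bb rr ff : ℝ → ℝ}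
    (hb : ContDiff ℝ (⊤ : ℕ∞) bb) (hr : Continuous rr) (hf : Continuous ff)
    (hbB : ∀ t ∈ Icc (0 : ℝ) 1, |bb t| ≤ B) (hb'B : ∀ t ∈ Icc (0 : ℝ) 1, |deriv bb t| ≤ B)
    (hrB : ∀ t ∈ Icc (0 : ℝ) 1, |rr t| ≤ B) (hbpos : ∀ t ∈ Icc (0 : ℝ) 1, 0 < bb t)
    (hco : ∀ x ∈ Icc (0 : ℝ) 1, γ ≤ rr x - ε₂ * deriv bb x / 2)
    {u w w1 w2 g : ℝ → ℝ} (hu : ContDiff ℝ (⊤ : ℕ∞) u) (hsol : SolvesBVP ε₁ ε₂ bb rr ff u)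
    (hw : ∀ x ∈ Icc (0 : ℝ) 1, HasDerivAt w (w1 x) x)
    (hw1 : ∀ x ∈ Icc (0 : ℝ) 1, HasDerivAt w1 (w2 x) x)
    (hw2 : ContinuousOn w2 (Icc 0 1)) (hw0 : w 0 = 0) (hwe : w 1 = 0)
    (heq : ∀ x ∈ Icc (0 : ℝ) 1, -ε₁ * w2 x + ε₂ * bb x * w1 x + rr x * w x = ff x - g x)
    (hg : ∀ x ∈ Icc (0 : ℝ) 1, |g x| ≤ η)
    {p : ℕ} (hp : 1 ≤ p) {up0 : Fin N → ℝ → ℝ} {upb : Fin (N + 1) → ℝ} {Dup Dcup : Fin N → ℝ → ℝ}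
    (hwg : IsWGsol m ε₁ ε₂ bb rr ff p up0 upb Dup Dcup)
    {D : Fin N → ℝ → ℝ} (hD : IsWeakDeriv m (p - 1) (fun j t => u t - up0 j t)
          (fun i => u (m.pt i) - upb i) D)
    {P : Fin N → Polynomial ℝ} (hPd : ∀ j, (P j).natDegree ≤ p) {Pb : Fin (N + 1) → ℝ}
    (hPr : ∀ j, (P j).eval (m.xr j) = Pb j.succ) (hPl : ∀ j, (P j).eval (m.xl j) = Pb j.castSucc)
    (hPb0 : Pb 0 = 0) (hPbN : Pb (Fin.last N) = 0)
    {A e e1 : Fin N → ℝ → ℝ} {eb : Fin (N + 1) → ℝ}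
    (her : ∀ j, e j (m.xr j) = eb j.succ) (hel : ∀ j, e j (m.xl j) = eb j.castSucc)
    (hA : ∀ j, ContinuousOn (A j) (Icc (m.xl j) (m.xr j)))
    (he1 : ∀ j, ContinuousOn (e1 j) (Icc (m.xl j) (m.xr j)))
    (he : ∀ j, ∀ x ∈ Icc (m.xl j) (m.xr j), HasDerivAt (e j) (e1 j x) x)
    (hsplit : ∀ j, ∀ x ∈ Icc (m.xl j) (m.xr j),
      w1 x - (P j).derivative.eval x = A j x + e1 j x)
    (n1 : ∀ j, ε₁ * (∫ t in (m.xl j)..(m.xr j), (w1 t - (P j).derivative.eval t) ^ 2) ≤ η ^ 2)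
    (n2 : ∀ j, ε₁ * m.width j * A j (m.xr j) ^ 2 ≤ η ^ 2)
    (n2' : ∀ j, ε₁ ^ 2 * e1 j (m.xr j) ^ 2 ≤ ε₂ * bb (m.xr j) * η ^ 2)
    (n3 : ∀ j, ε₁ * m.width j * (w1 (m.xl j) - (P j).derivative.eval (m.xl j)) ^ 2 ≤ η ^ 2)
    (n4 : ∀ j, ε₂ ^ 2 * (∫ t in (m.xl j)..(m.xr j), A j t ^ 2) ≤ η ^ 2)
    (n5 : ∀ j, ε₂ ^ 2 / ε₁ * (∫ t in (m.xl j)..(m.xr j), e j t ^ 2) ≤ η ^ 2)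
    (n6 : ∀ i, ε₂ * eb i ^ 2 ≤ η ^ 2)
    (n8 : ∀ j, (∫ t in (m.xl j)..(m.xr j), (w t - (P j).eval t) ^ 2) ≤ η ^ 2) :
    normP2 m ε₁ ε₂ bb (stdPen m ε₁ p)
        (fun j t => u t - up0 j t) (fun i => u (m.pt i) - upb i) D
      ≤ ((6 + 4 / γ) * (2 * (148 * B ^ 2 + 16 * B ^ 2 / γ)) + 8 / γ + 16 / γ ^ 2 + 8)
        * N * η ^ 2 := by
  obtain ⟨hup, hupb0, hupbN, hDup, hDcup, hgal⟩ := hwg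
  choose U hUd hU using hup
  have hF' : ∀ j, IsPolyDeg (Dup j) (p - 1) := fun j => (hDup j).1
  choose F hFd hF using hF'
  obtain rfl : up0 = fun j t => (U j).eval t := funext fun j => funext (hU j)
  obtain rfl : Dup = fun j t => (F j).eval t := funext fun j => funext (hF j)
  clear hU hF
  set vb : Fin (N + 1) → ℝ := fun i => Pb i - upb i with hvb
  set V : Fin N → Polynomial ℝ := fun j => P j - U j with hVdef
  set E : Fin N → Polynomial ℝ := fun j => (P j).derivative - F j with hEdef
  have hac := m.xl_lt_xr
  have hsub := m.cell_subset
  have hVd : ∀ j, (V j).natDegree ≤ p := fun j =>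
    (Polynomial.natDegree_sub_le _ _).trans (max_le (hPd j) (hUd j))
  have hEd : ∀ j, (E j).natDegree ≤ p - 1 := fun j =>
    (Polynomial.natDegree_sub_le _ _).trans (max_le
      ((Polynomial.natDegree_derivative_le _).trans (Nat.sub_le_sub_right (hPd j) 1)) (hFd j))
  have hE : ∀ j, ∀ q : Polynomial ℝ, q.natDegree ≤ p - 1 →
      (∫ t in (m.xl j)..(m.xr j), (E j).eval t * q.eval t) =
      -(∫ t in (m.xl j)..(m.xr j), (V j).eval t * q.derivative.eval t)
        + vb j.succ * q.eval (m.xr j) - vb j.castSucc * q.eval (m.xl j) := by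
    intro j q hq
    have hII : ∀ {f : ℝ → ℝ}, Continuous f → IntervalIntegrable f volume (m.xl j) (m.xr j) :=
      fun h => h.intervalIntegrable _ _
    have h1 := (hDup j).2 q hq
    have hFTC := intervalIntegral.integral_eq_sub_of_hasDerivAt
      (f := fun t => (P j).eval t * q.eval t)
      (f' := fun t => (P j).derivative.eval t * q.eval t + (P j).eval t * q.derivative.eval t)
      (a := m.xl j) (b := m.xr j) (fun t _ => ((P j).hasDerivAt t).mul (q.hasDerivAt t))
      (hII (by fun_prop))
    rw [intervalIntegral.integral_add (hII (by fun_prop)) (hII (by fun_prop))] at hFTC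
    have h2 : (∫ t in (m.xl j)..(m.xr j), (E j).eval t * q.eval t)
        = (∫ t in (m.xl j)..(m.xr j), (P j).derivative.eval t * q.eval t)
          - ∫ t in (m.xl j)..(m.xr j), (F j).eval t * q.eval t := by
      rw [← intervalIntegral.integral_sub (hII (by fun_prop)) (hII (by fun_prop))]
      congr 1; ext t; simp only [hEdef, Polynomial.eval_sub]; ring
    have h3 : (∫ t in (m.xl j)..(m.xr j), (V j).eval t * q.derivative.eval t)
        = (∫ t in (m.xl j)..(m.xr j), (P j).eval t * q.derivative.eval t)
          - ∫ t in (m.xl j)..(m.xr j), (U j).eval t * q.derivative.eval t := by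
      rw [← intervalIntegral.integral_sub (hII (by fun_prop)) (hII (by fun_prop))]
      congr 1; ext t; simp only [hVdef, Polynomial.eval_sub]; ring
    rw [h2, h3, h1]
    simp only [hvb]
    rw [← hPr, ← hPl]
    linarith
  have hDc : ∀ j, (∫ t in (m.xl j)..(m.xr j), Dcup j t * (V j).eval t) =
      -(∫ t in (m.xl j)..(m.xr j),
        ((P j).eval t - (V j).eval t) * deriv (fun s => bb s * (V j).eval s) t)
      + ((P j).eval (m.xr j) - vb j.succ) * (bb (m.xr j) * (V j).eval (m.xr j))
      - ((P j).eval (m.xl j) - vb j.castSucc) * (bb (m.xl j) * (V j).eval (m.xl j)) := by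
    intro j
    rw [(hDcup j).2 (V j) (hVd j), hPr, hPl]
    have : ∀ t, (P j).eval t - (V j).eval t = (U j).eval t := by
      intro t; simp [hVdef]
    simp only [this, hvb]
    ring
  have hwc : ContinuousOn w (Icc 0 1) := fun x hx => (hw x hx).continuousAt.continuousWithinAt
  have hw1c : ContinuousOn w1 (Icc 0 1) := fun x hx => (hw1 x hx).continuousAt.continuousWithinAt
  have hgc : ContinuousOn g (Icc 0 1) := by
    refine ContinuousOn.congr
      (f := fun x => ff x - (-ε₁ * w2 x + ε₂ * bb x * w1 x + rr x * w x)) ?_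
      (fun x hx => by linarith [heq x hx])
    have := hb.continuous
    fun_prop
  have hwidth : ∀ j, m.xr j - m.xl j ≤ 1 := fun j => by
    have h1 := (m.pt_mem j.succ).2
    have h2 := (m.pt_mem j.castSucc).1
    unfold Mesh.xr Mesh.xl; linarith
  have hη : 0 ≤ η := (abs_nonneg _).trans (hg 0 (by simp))
  have hg2 : ∀ j, (∫ t in (m.xl j)..(m.xr j), g t ^ 2) ≤ η ^ 2 := by
    intro j
    have h1 : (∫ t in (m.xl j)..(m.xr j), g t ^ 2) ≤ ∫ t in (m.xl j)..(m.xr j), η ^ 2 :=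
      intervalIntegral.integral_mono_on (hac j).le
        (intervalIntegrable_of_continuousOn_Icc (hac j).le ((hgc.mono (hsub j)).pow 2))
        (by simp)
        fun t ht => by
          rw [← sq_abs]; exact pow_le_pow_left₀ (abs_nonneg _) (hg t (hsub j ht)) 2
    rw [intervalIntegral.integral_const, smul_eq_mul] at h1
    nlinarith [hwidth j, sq_nonneg η]
  set C₀ := 148 * B ^ 2 + 16 * B ^ 2 / γ with hC₀
  set K : Fin N → ℝ := fun j => cellK (m.xl j) (m.xr j) ε₁ ε₂ γ (stdPen m ε₁ p j) bb (V j) (E j)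
    (vb j.castSucc) (vb j.succ) with hK
  set G : Fin (N + 1) → ℝ := fun i => ε₁ * w1 (m.pt i) * vb i - ε₂ / 2 * bb (m.pt i) * vb i ^ 2
    - ε₂ * bb (m.pt i) * eb i * vb i with hG
  have hcell : ∀ j,
      ε₁ * (∫ t in (m.xl j)..(m.xr j), (F j).eval t * (E j).eval t)
        + ε₂ * (∫ t in (m.xl j)..(m.xr j), Dcup j t * (V j).eval t)
        + (∫ t in (m.xl j)..(m.xr j), rr t * (U j).eval t * (V j).eval t)
        + stdPen m ε₁ p j * (((U j).eval (m.xr j) - upb j.succ) * ((V j).eval (m.xr j) - vb j.succ)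
          + ((U j).eval (m.xl j) - upb j.castSucc) * ((V j).eval (m.xl j) - vb j.castSucc))
        + ε₂ * bb (m.xr j) * ((U j).eval (m.xr j) - upb j.succ) * ((V j).eval (m.xr j) - vb j.succ)
        - (∫ t in (m.xl j)..(m.xr j), ff t * (V j).eval t)
      ≤ -(K j) / 2 + C₀ * η ^ 2 + (G j.succ - G j.castSucc) := by
    intro j
    have hid := cell_identity (σ := stdPen m ε₁ p j) (hac j) hb hr hf
      (fun x hx => hw x (hsub j hx)) (fun x hx => hw1 x (hsub j hx)) (hw2.mono (hsub j))
      (fun x hx => heq x (hsub j hx)) (hPd j) (hE j) (hDc j)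
    have hQc : ContinuousOn (fun t => w t - (P j).eval t) (Icc (m.xl j) (m.xr j)) := by
      have := hwc.mono (hsub j); fun_prop
    have hQ1c : ContinuousOn (fun t => w1 t - (P j).derivative.eval t) (Icc (m.xl j) (m.xr j)) := by
      have := hw1c.mono (hsub j); fun_prop
    have hrest := cell_rest_bound (hac j) hε₁ hε₁' hε₂ hγ hB1 hb hr
      (fun t ht => hbB t (hsub j ht)) (fun t ht => hb'B t (hsub j ht))
      (fun t ht => hrB t (hsub j ht)) (fun t ht => hbpos t (hsub j ht)) hQc hQ1c (hA j) (he1 j)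
      (hgc.mono (hsub j)) (he j) (hsplit j) hp (hVd j) (hEd j) (hE j) (n1 j) (n2 j) (n2' j) (n3 j) (n4 j)
      (n5 j) (by rw [her]; exact n6 _) (by rw [hel]; exact n6 _) (n8 j) (hg2 j)
    have hKlow : K j ≤ ε₁ * (∫ t in (m.xl j)..(m.xr j), (E j).eval t ^ 2)
        + (∫ t in (m.xl j)..(m.xr j), (rr t - ε₂ * deriv bb t / 2) * (V j).eval t ^ 2)
        + stdPen m ε₁ p j * (((V j).eval (m.xr j) - vb j.succ) ^ 2
          + ((V j).eval (m.xl j) - vb j.castSucc) ^ 2)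
        + ε₂ / 2 * (bb (m.xr j) * ((V j).eval (m.xr j) - vb j.succ) ^ 2
          + bb (m.xl j) * ((V j).eval (m.xl j) - vb j.castSucc) ^ 2) := by
      have hb' : Continuous (deriv bb) := hb.continuous_deriv (by simp)
      have : γ * (∫ t in (m.xl j)..(m.xr j), (V j).eval t ^ 2)
          ≤ ∫ t in (m.xl j)..(m.xr j), (rr t - ε₂ * deriv bb t / 2) * (V j).eval t ^ 2 := by
        rw [← intervalIntegral.integral_const_mul]
        exact intervalIntegral.integral_mono_on (hac j).le
          (Continuous.intervalIntegrable (by fun_prop) _ _)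
          (Continuous.intervalIntegrable (by fun_prop) _ _)
          fun t ht => mul_le_mul_of_nonneg_right (hco t (hsub j ht)) (sq_nonneg _)
      simp only [hK, cellK]
      linarith
    have e1 : ∀ t, (P j).derivative.eval t - (E j).eval t = (F j).eval t := by
      intro t; simp [hEdef]
    have e2 : ∀ t, (P j).eval t - (V j).eval t = (U j).eval t := by
      intro t; simp [hVdef]
    have e3 : (U j).eval (m.xr j) - upb j.succ = -((V j).eval (m.xr j) - vb j.succ) := by
      simp only [hVdef, hvb, Polynomial.eval_sub, hPr]; ring
    have e4 : (U j).eval (m.xl j) - upb j.castSucc = -((V j).eval (m.xl j) - vb j.castSucc) := by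
      simp only [hVdef, hvb, Polynomial.eval_sub, hPl]; ring
    simp only [e1, e2] at hid
    rw [e3, e4]
    rw [her, hel] at hrest
    have hKr : cellK (m.xl j) (m.xr j) ε₁ ε₂ γ (ε₁ * (p : ℝ) ^ 2 / (m.xr j - m.xl j)) bb (V j) (E j)
      (vb j.castSucc) (vb j.succ) = K j := rfl
    rw [hKr] at hrest
    simp only [hG]
    have hx1 : m.pt j.succ = m.xr j := rfl
    have hx2 : m.pt j.castSucc = m.xl j := rfl
    rw [hx1, hx2]
    linarith
  have hsum := Finset.sum_le_sum fun j (_ : j ∈ Finset.univ) => hcell j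
  have hgal' := hgal (fun j t => (V j).eval t) vb (fun j => ⟨V j, hVd j, fun _ => rfl⟩)
    (by simp [hvb, hPb0, hupb0]) (by simp [hvb, hPbN, hupbN]) (fun j t => (E j).eval t)
    (fun j => ⟨⟨E j, hEd j, fun _ => rfl⟩, hE j⟩)
  have hzero : vb 0 = 0 := by simp [hvb, hPb0, hupb0]
  have hlast : vb (Fin.last N) = 0 := by simp [hvb, hPbN, hupbN]
  have hKsum : ∑ j, K j ≤ 2 * (N * (C₀ * η ^ 2)) := by
    simp only [Finset.sum_add_distrib, Finset.sum_sub_distrib, ← Finset.mul_sum] at hsum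
    have htel := sum_succ_sub_castSucc G
    have hG0 : G (Fin.last N) - G 0 = 0 := by simp [hG, hzero, hlast]
    rw [Finset.sum_sub_distrib, hG0] at htel
    unfold Aform Sform Scform at hgal'
    rw [hgal', sub_self, htel] at hsum
    rw [Finset.sum_const, Finset.card_univ, Fintype.card_fin, nsmul_eq_mul, ← Finset.sum_div,
      Finset.sum_neg_distrib] at hsum
    linarith
  -- the distance between the exact and the approximate solution
  obtain ⟨hu0, hue, hueq⟩ := hsol
  have hud : ∀ x, HasDerivAt u (deriv u x) x := fun x =>
    (hu.differentiable (by simp) x).hasDerivAt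
  have hu' : ContDiff ℝ (⊤ : ℕ∞) (deriv u) := by
    have h1 : ContDiff ℝ ((⊤ : ℕ∞) + 1) u := by simpa using hu
    exact (contDiff_succ_iff_deriv.1 h1).2.2
  have hud1 : ∀ x, HasDerivAt (deriv u) (deriv (deriv u) x) x := fun x =>
    (hu'.differentiable (by simp) x).hasDerivAt
  have hu1c : Continuous (deriv u) := hu'.continuous
  have hu2c : Continuous (deriv (deriv u)) := hu'.continuous_deriv (by simp)
  have hen := energy_estimate (ρ := fun t => u t - w t) (ρ1 := fun t => deriv u t - w1 t)
    (ρ2 := fun t => deriv (deriv u) t - w2 t) (ε₁ := ε₁) hγ hb hr hco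
    (fun x hx => (hud x).sub (hw x hx)) (fun x hx => (hud1 x).sub (hw1 x hx))
    (hu2c.continuousOn.sub hw2) (by simp [hu0, hw0]) (by simp [hue, hwe])
    (fun x hx => by linarith [heq x hx, hueq x hx]) hg
  have hρc : ContinuousOn (fun t => u t - w t) (Icc 0 1) := hu.continuous.continuousOn.sub hwc
  have hρcont : ContinuousOn (fun t => deriv u t - w1 t) (Icc 0 1) := hu1c.continuousOn.sub hw1c
  have hs1 := m.sum_integral_cell (hρcont.pow 2)
  have hs2 := m.sum_integral_cell (hρc.pow 2)
  simp only [Pi.pow_apply] at hs1 hs2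
  rw [← hs1, ← hs2] at hen
  have hcellN : ∀ j,
      ε₁ * (∫ t in (m.xl j)..(m.xr j), (D j t) ^ 2)
        + (∫ t in (m.xl j)..(m.xr j), (u t - (U j).eval t) ^ 2)
        + stdPen m ε₁ p j * ((u (m.xr j) - (U j).eval (m.xr j) - (u (m.pt j.succ) - upb j.succ))
            * (u (m.xr j) - (U j).eval (m.xr j) - (u (m.pt j.succ) - upb j.succ))
          + (u (m.xl j) - (U j).eval (m.xl j) - (u (m.pt j.castSucc) - upb j.castSucc))
            * (u (m.xl j) - (U j).eval (m.xl j) - (u (m.pt j.castSucc) - upb j.castSucc)))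
        + ε₂ * bb (m.xr j) * (u (m.xr j) - (U j).eval (m.xr j) - (u (m.pt j.succ) - upb j.succ))
          * (u (m.xr j) - (U j).eval (m.xr j) - (u (m.pt j.succ) - upb j.succ))
        + (if j.succ = Fin.last N then (1 : ℝ) / 2 else 1) * ε₂ * bb (m.xr j) *
          (u (m.xr j) - (U j).eval (m.xr j) - (u (m.pt j.succ) - upb j.succ)) ^ 2
      ≤ (6 + 4 / γ) * K j + 8 * η ^ 2
        + 4 * (ε₁ * ∫ t in (m.xl j)..(m.xr j), (deriv u t - w1 t) ^ 2)
        + 4 * ∫ t in (m.xl j)..(m.xr j), (u t - w t) ^ 2 := by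
    intro j
    have hwj := hwc.mono (hsub j)
    have hw1j := hw1c.mono (hsub j)
    have huc := hu.continuous
    have hd := weakDeriv_error_bound (P := P j) (hac j) (fun x _ => hud x) hu1c.continuousOn
      (hDup j).2 (hD j)
    have h1 := integral_sq_add_le (f := fun t => deriv u t - w1 t)
      (k := fun t => w1 t - (P j).derivative.eval t) (hac j).le (by fun_prop) (by fun_prop)
    have h2 := integral_sq_add_le (f := fun t => u t - w t)
      (k := fun t => w t - (P j).eval t) (hac j).le (by fun_prop) (by fun_prop)
    have h3 := integral_sq_add_le (f := fun t => u t - (P j).eval t)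
      (k := fun t => (V j).eval t) (hac j).le (by fun_prop) (by fun_prop)
    have i1 : ∀ t, deriv u t - w1 t + (w1 t - (P j).derivative.eval t)
        = deriv u t - (P j).derivative.eval t := fun t => by ring
    have i2 : ∀ t, u t - w t + (w t - (P j).eval t) = u t - (P j).eval t := fun t => by ring
    have i3 : ∀ t, u t - (P j).eval t + (V j).eval t = u t - (U j).eval t := fun t => by
      simp only [hVdef, Polynomial.eval_sub]; ring
    simp only [i1] at h1
    simp only [i2] at h2
    simp only [i3] at h3
    have hx1 : m.pt j.succ = m.xr j := rfl
    have hx2 : m.pt j.castSucc = m.xl j := rfl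
    have e3 : u (m.xr j) - (U j).eval (m.xr j) - (u (m.xr j) - upb j.succ)
        = (V j).eval (m.xr j) - vb j.succ := by
      simp only [hVdef, hvb, Polynomial.eval_sub, hPr]; ring
    have e4 : u (m.xl j) - (U j).eval (m.xl j) - (u (m.xl j) - upb j.castSucc)
        = (V j).eval (m.xl j) - vb j.castSucc := by
      simp only [hVdef, hvb, Polynomial.eval_sub, hPl]; ring
    rw [hx1, hx2, e3, e4]
    set jr := (V j).eval (m.xr j) - vb j.succ
    set jl := (V j).eval (m.xl j) - vb j.castSucc
    have hbr := hbpos _ (m.pt_mem j.succ)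
    have hbl := hbpos _ (m.pt_mem j.castSucc)
    rw [hx1] at hbr
    rw [hx2] at hbl
    have hpen : 0 ≤ stdPen m ε₁ p j := by
      have : 0 < m.width j := sub_pos.2 (hac j)
      unfold stdPen; positivity
    have hK' : K j = ε₁ * (∫ t in (m.xl j)..(m.xr j), (E j).eval t ^ 2)
        + γ * (∫ t in (m.xl j)..(m.xr j), (V j).eval t ^ 2)
        + stdPen m ε₁ p j * (jr ^ 2 + jl ^ 2)
        + ε₂ / 2 * (bb (m.xr j) * jr ^ 2 + bb (m.xl j) * jl ^ 2) := rfl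
    have hif : (if j.succ = Fin.last N then (1 : ℝ) / 2 else 1) ≤ 1 := by split_ifs <;> norm_num
    have p1 : 0 ≤ ε₂ * bb (m.xr j) * jr ^ 2 := by positivity
    have p2 : 0 ≤ ε₂ * bb (m.xl j) * jl ^ 2 := by positivity
    have p3 : 0 ≤ stdPen m ε₁ p j * (jr ^ 2 + jl ^ 2) := by positivity
    have p4 : 0 ≤ ∫ t in (m.xl j)..(m.xr j), (E j).eval t ^ 2 :=
      intervalIntegral.integral_nonneg (hac j).le fun t _ => sq_nonneg _
    have p5 : 0 ≤ ∫ t in (m.xl j)..(m.xr j), (V j).eval t ^ 2 :=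
      intervalIntegral.integral_nonneg (hac j).le fun t _ => sq_nonneg _
    have hJ : (if j.succ = Fin.last N then (1 : ℝ) / 2 else 1) * ε₂ * bb (m.xr j) * jr ^ 2
        ≤ ε₂ * bb (m.xr j) * jr ^ 2 := by
      calc _ = (if j.succ = Fin.last N then (1 : ℝ) / 2 else 1) * (ε₂ * bb (m.xr j) * jr ^ 2) := by
            ring
        _ ≤ _ := mul_le_of_le_one_left p1 hif
    have hVγ : (∫ t in (m.xl j)..(m.xr j), (V j).eval t ^ 2) ≤ K j / γ := by
      rw [le_div_iff₀ hγ, hK']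
      have := mul_nonneg hε₁.le p4
      linarith
    have hd' := mul_le_mul_of_nonneg_left hd hε₁.le
    have h1' := mul_le_mul_of_nonneg_left h1 hε₁.le
    have hKj : 6 * K j = 6 * (ε₁ * (∫ t in (m.xl j)..(m.xr j), (E j).eval t ^ 2)
        + γ * (∫ t in (m.xl j)..(m.xr j), (V j).eval t ^ 2)
        + stdPen m ε₁ p j * (jr ^ 2 + jl ^ 2)
        + ε₂ / 2 * (bb (m.xr j) * jr ^ 2 + bb (m.xl j) * jl ^ 2)) := by rw [hK']
    have p6 := mul_nonneg hε₁.le p4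
    have p7 := mul_nonneg hγ.le p5
    have hsplitK : (6 + 4 / γ) * K j = 6 * K j + 4 * (K j / γ) := by ring
    have hKγ0 : 0 ≤ K j / γ := p5.trans hVγ
    rw [hsplitK]
    have n1j := n1 j
    have n8j := n8 j
    linarith
  have hfin := Finset.sum_le_sum fun j (_ : j ∈ Finset.univ) => hcellN j
  simp only [Finset.sum_add_distrib, ← Finset.mul_sum] at hfin
  rw [Finset.sum_const, Finset.card_univ, Fintype.card_fin, nsmul_eq_mul] at hfin
  unfold normP2 Sform Scform Jsemi2
  refine hfin.trans ?_
  have hN : (1 : ℝ) ≤ N := by exact_mod_cast m.one_le_card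
  set I1 := ∑ j, ∫ t in (m.xl j)..(m.xr j), (deriv u t - w1 t) ^ 2
  set I0 := ∑ j, ∫ t in (m.xl j)..(m.xr j), (u t - w t) ^ 2
  have hI1 : 0 ≤ I1 := Finset.sum_nonneg fun j _ =>
    intervalIntegral.integral_nonneg (hac j).le fun t _ => sq_nonneg _
  have hI0 : 0 ≤ I0 := Finset.sum_nonneg fun j _ =>
    intervalIntegral.integral_nonneg (hac j).le fun t _ => sq_nonneg _
  have q1 : ε₁ * I1 ≤ η ^ 2 / γ := by
    have := mul_nonneg hγ.le hI0; linarith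
  have q2 : I0 ≤ 2 * η ^ 2 / γ ^ 2 := by
    have h1 : γ * I0 / 2 ≤ η ^ 2 / γ := by
      have := mul_nonneg hε₁.le hI1; linarith
    rw [le_div_iff₀ (by positivity)]
    rw [le_div_iff₀ hγ] at h1
    linarith
  have q3 : (6 + 4 / γ) * ∑ j, K j ≤ (6 + 4 / γ) * (2 * (N * (C₀ * η ^ 2))) := by gcongr
  have q4 : η ^ 2 / γ ≤ N * (η ^ 2 / γ) := le_mul_of_one_le_left (by positivity) hN
  have q5 : 2 * η ^ 2 / γ ^ 2 ≤ N * (2 * η ^ 2 / γ ^ 2) :=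
    le_mul_of_one_le_left (by positivity) hN
  have q6 : ((6 + 4 / γ) * (2 * C₀) + 8 / γ + 16 / γ ^ 2 + 8) * N * η ^ 2
      = (6 + 4 / γ) * (2 * (N * (C₀ * η ^ 2))) + 8 * (N * (η ^ 2 / γ))
        + 8 * (N * (2 * η ^ 2 / γ ^ 2)) + N * (8 * η ^ 2) := by ring
  rw [q6]
  have q7 : 0 ≤ N * (η ^ 2 / γ) := by positivity
  have q8 : 0 ≤ N * (2 * η ^ 2 / γ ^ 2) := by positivity
  linarith

/-- The open neighbourhood of radius `δ` of the real interval `[a,c]` in the complex plane. -/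
def tube (a c δ : ℝ) : Set ℂ := {z | ∃ x ∈ Icc a c, ‖z - (x : ℂ)‖ < δ}

lemma isOpen_tube (a c δ : ℝ) : IsOpen (tube a c δ) := by
  have : tube a c δ = ⋃ x ∈ Icc a c, Metric.ball (x : ℂ) δ := by
    ext z; simp [tube, dist_eq_norm]
  rw [this]
  exact isOpen_biUnion fun x _ => Metric.isOpen_ball

lemma ofReal_mem_tube {a c δ x : ℝ} (hδ : 0 < δ) (hx : x ∈ Icc a c) : (x : ℂ) ∈ tube a c δ :=
  ⟨x, hx, by simpa using hδ⟩

lemma tube_mono {a c δ δ' : ℝ} (h : δ ≤ δ') : tube a c δ ⊆ tube a c δ' :=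
  fun _ ⟨x, hx, hz⟩ => ⟨x, hx, hz.trans_le h⟩

lemma closedBall_subset_tube {a c δ s : ℝ} {z : ℂ} (hz : z ∈ tube a c δ) :
    Metric.closedBall z s ⊆ tube a c (δ + s) := by
  obtain ⟨x, hx, hzx⟩ := hz
  intro w hw
  refine ⟨x, hx, ?_⟩
  rw [Metric.mem_closedBall, dist_eq_norm] at hw
  calc ‖w - x‖ = ‖(z - x) + (w - z)‖ := by ring_nf
    _ ≤ ‖z - x‖ + ‖w - z‖ := norm_add_le _ _
    _ < δ + s := by linarith

lemma convex_tube (a c δ : ℝ) : Convex ℝ (tube a c δ) := by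
  rintro z ⟨x, hx, hzx⟩ w ⟨y, hy, hwy⟩ s t hs ht hst
  refine ⟨s * x + t * y, by simpa using convex_Icc a c hx hy hs ht hst, ?_⟩
  have h1 : s • z + t • w - ((s * x + t * y : ℝ) : ℂ) = s • (z - x) + t • (w - y) := by
    simp only [Complex.real_smul]; push_cast; ring
  rw [h1]
  refine (norm_add_le _ _).trans_lt ?_
  rw [norm_smul, norm_smul, Real.norm_of_nonneg hs, Real.norm_of_nonneg ht]
  rcases hs.eq_or_lt with rfl | hs'
  · have : t = 1 := by linarith
    subst this; simpa using hwy
  · have h2 : s * ‖z - x‖ < s * δ := mul_lt_mul_of_pos_left hzx hs'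
    have h3 : t * ‖w - y‖ ≤ t * δ := mul_le_mul_of_nonneg_left hwy.le ht
    have h4 : s * δ + t * δ = δ := by rw [← add_mul, hst, one_mul]
    linarith

/-- Cauchy's estimate on tubes. -/
lemma norm_deriv_le_of_tube {F : ℂ → ℂ} {a c δ s M : ℝ} (hs : 0 < s)
    (hF : DifferentiableOn ℂ F (tube a c (δ + s))) (hM : ∀ z ∈ tube a c (δ + s), ‖F z‖ ≤ M)
    {z : ℂ} (hz : z ∈ tube a c δ) : ‖deriv F z‖ ≤ M / s := by
  have hsub := closedBall_subset_tube (s := s) hz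
  refine Complex.norm_deriv_le_of_forall_mem_sphere_norm_le hs ?_
    fun w hw => hM w (hsub (Metric.sphere_subset_closedBall hw))
  refine DifferentiableOn.diffContOnCl (hF.mono ?_)
  rw [closure_ball _ hs.ne']
  exact hsub

/-- The Joukowski map. -/
def joukowski (ζ : ℂ) : ℂ := (ζ + ζ⁻¹) / 2

lemma joukowski_exp (θ : ℝ) : joukowski (Complex.exp (θ * Complex.I)) = (Real.cos θ : ℝ) := by
  rw [joukowski, ← Complex.exp_neg, Complex.ofReal_cos, Complex.cos]
  ring_nf

lemma joukowski_mem_tube {ζ : ℂ} {η : ℝ} (h1 : 1 ≤ ‖ζ‖) (h2 : ‖ζ‖ - 1 < η) :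
    joukowski ζ ∈ tube (-1) 1 η := by
  have hr : 0 < ‖ζ‖ := by linarith
  refine ⟨Real.cos ζ.arg, ⟨Real.neg_one_le_cos _, Real.cos_le_one _⟩, ?_⟩
  rw [← joukowski_exp]
  set ω := Complex.exp (ζ.arg * Complex.I) with hω
  have hζ : ζ = ‖ζ‖ * ω := (Complex.norm_mul_exp_arg_mul_I ζ).symm
  have hωn : ‖ω‖ = 1 := Complex.norm_exp_ofReal_mul_I _
  set r := ‖ζ‖ with hrdef
  have h3 : joukowski ζ - joukowski ω = ((r - 1 : ℝ) : ℂ) * ω / 2 + ((r⁻¹ - 1 : ℝ) : ℂ) * ω⁻¹ / 2 := by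
    rw [hζ, joukowski, joukowski, mul_inv]; push_cast; ring
  rw [h3]
  refine (norm_add_le _ _).trans_lt ?_
  rw [norm_div, norm_div, norm_mul, norm_mul, norm_inv, hωn, Complex.norm_real, Complex.norm_real,
    Real.norm_of_nonneg (by linarith), Real.norm_of_nonpos
      (by have : r⁻¹ ≤ 1 := inv_le_one_of_one_le₀ h1
          linarith)]
  have h4 : 1 - r⁻¹ ≤ r - 1 := by
    have : r + r⁻¹ - 2 = (r - 1) ^ 2 / r := by field_simp; ring
    have h5 : 0 ≤ (r - 1) ^ 2 / r := by positivity
    linarith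
  norm_num
  linarith

/-- Fourier (Chebyshev) coefficients of a function holomorphic near `[-1,1]` decay geometrically. -/
lemma norm_chebyshev_coeff_le {F : ℂ → ℂ} {η M : ℝ} (hη : 0 < η)
    (hF : DifferentiableOn ℂ F (tube (-1) 1 η)) (hM : ∀ z ∈ tube (-1) 1 η, ‖F z‖ ≤ M) (n : ℕ) :
    ‖∫ θ in (0 : ℝ)..(2 * Real.pi),
      Complex.exp (-(n * θ * Complex.I)) * F (Real.cos θ : ℝ)‖
      ≤ 2 * Real.pi * M * ((1 + η / 2)⁻¹) ^ n := by
  set ρ := 1 + η / 2 with hρ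
  have hρ0 : 0 < ρ := by positivity
  set G : ℂ → ℂ := fun ζ => F (joukowski ζ) * (ζ ^ (n + 1))⁻¹ with hG
  have hdiff : ∀ ζ : ℂ, 1 ≤ ‖ζ‖ → ‖ζ‖ ≤ ρ → DifferentiableAt ℂ G ζ := by
    intro ζ h1 h2
    have hζ : ζ ≠ 0 := by rintro rfl; simp at h1; linarith
    have hm : joukowski ζ ∈ tube (-1) 1 η := joukowski_mem_tube h1 (by linarith)
    have hFd := hF.differentiableAt ((isOpen_tube _ _ _).mem_nhds hm)
    have hj : DifferentiableAt ℂ joukowski ζ := by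
      unfold joukowski
      exact (differentiableAt_id.add (differentiableAt_inv hζ)).div_const 2
    exact (hFd.comp ζ hj).mul ((differentiableAt_id.pow _).inv (pow_ne_zero _ hζ))
  have hshift := Complex.circleIntegral_eq_of_differentiable_on_annulus_off_countable
    (c := 0) (r := 1) (R := ρ) one_pos (by linarith) (f := G) (s := ∅) countable_empty
    (fun ζ hζ => by
      simp only [mem_sdiff, Metric.mem_closedBall, Metric.mem_ball, dist_zero_right, not_lt] at hζ
      exact (hdiff ζ hζ.2 hζ.1).continuousAt.continuousWithinAt)
    (fun ζ hζ => by
      simp only [mem_sdiff, Metric.mem_closedBall, Metric.mem_ball, dist_zero_right, not_le] at hζ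
      exact hdiff ζ hζ.1.2.le hζ.1.1.le)
  have hone : (∮ z in C(0, 1), G z) = Complex.I * ∫ θ in (0 : ℝ)..(2 * Real.pi),
      Complex.exp (-(n * θ * Complex.I)) * F (Real.cos θ : ℝ) := by
    rw [circleIntegral, ← intervalIntegral.integral_const_mul]
    congr 1
    ext θ
    simp only [hG, deriv_circleMap, circleMap_zero, Complex.ofReal_one, one_mul, smul_eq_mul,
      joukowski_exp]
    have h1 : (Complex.exp (θ * Complex.I) ^ (n + 1))⁻¹
        = Complex.exp (-(n * θ * Complex.I)) * (Complex.exp (θ * Complex.I))⁻¹ := by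
      rw [← Complex.exp_nat_mul, ← Complex.exp_neg, ← Complex.exp_neg, ← Complex.exp_add]
      congr 1; push_cast; ring
    rw [h1]
    have h2 : Complex.exp (θ * Complex.I) ≠ 0 := Complex.exp_ne_zero _
    field_simp
  have hbound := circleIntegral.norm_integral_le_of_norm_le_const (c := 0) hρ0.le
    (f := G) (C := M * (ρ ^ (n + 1))⁻¹) (fun ζ hζ => by
      rw [mem_sphere_zero_iff_norm] at hζ
      simp only [hG, norm_mul, norm_inv, norm_pow, hζ]
      gcongr
      exact hM _ (joukowski_mem_tube (by rw [hζ]; linarith) (by rw [hζ]; linarith)))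
  rw [hshift, hone, norm_mul, Complex.norm_I, one_mul] at hbound
  refine hbound.trans (le_of_eq ?_)
  rw [inv_pow, pow_succ]
  field_simp

/-- Geometric polynomial approximation of functions holomorphic near `[-1,1]`. -/
lemma exists_poly_approx_unit {F : ℂ → ℂ} {η M : ℝ} (hη : 0 < η)
    (hF : DifferentiableOn ℂ F (tube (-1) 1 η)) (hM : ∀ z ∈ tube (-1) 1 η, ‖F z‖ ≤ M) (n : ℕ) :
    ∃ q : Polynomial ℝ, q.natDegree ≤ n ∧ ∀ x ∈ Icc (-1 : ℝ) 1,
      |(F x).re - q.eval x| ≤ 2 * M * ((1 + η / 2)⁻¹) ^ (n + 1) / (1 - (1 + η / 2)⁻¹) := by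
  set θ := (1 + η / 2)⁻¹ with hθ
  have hθ0 : 0 < θ := by positivity
  have hθ1 : θ < 1 := inv_lt_one_of_one_lt₀ (by linarith)
  have : Fact (0 < 2 * Real.pi) := ⟨Real.two_pi_pos⟩
  have hmem : ∀ x ∈ Icc (-1 : ℝ) 1, (x : ℂ) ∈ tube (-1) 1 η := fun x hx => ofReal_mem_tube hη hx
  have hcos : ∀ t : Real.Angle, Real.Angle.cos t ∈ Icc (-1 : ℝ) 1 := by
    intro t
    induction t using Real.Angle.induction_on with
    | _ y => rw [Real.Angle.cos_coe]; exact ⟨Real.neg_one_le_cos _, Real.cos_le_one _⟩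
  let f : C(AddCircle (2 * Real.pi), ℂ) :=
    ⟨fun t => F ((Real.Angle.cos t : ℝ) : ℂ), by
      have h1 : Continuous fun t : Real.Angle => ((Real.Angle.cos t : ℝ) : ℂ) :=
        Complex.continuous_ofReal.comp Real.Angle.continuous_cos
      exact hF.continuousOn.comp_continuous h1 fun t => hmem _ (hcos t)⟩
  have hfcoe : ∀ y : ℝ, f (y : AddCircle (2 * Real.pi)) = F ((Real.cos y : ℝ) : ℂ) := fun y => rfl
  have hfneg : ∀ t, f (-t) = f t := fun t =>
    congrArg (fun c : ℝ => F (c : ℂ)) (Real.Angle.cos_neg t)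
  have heven : ∀ k : ℤ, fourierCoeff f (-k) = fourierCoeff f k := by
    intro k
    unfold fourierCoeff
    rw [← integral_neg_eq_self]
    congr 1; ext t
    rw [hfneg]
    simp [fourier_apply]
  have hcoef : ∀ k : ℕ, ‖fourierCoeff f k‖ ≤ M * θ ^ k := by
    intro k
    rw [fourierCoeff_eq_intervalIntegral f k 0, zero_add]
    have h1 : (∫ x in (0 : ℝ)..(2 * Real.pi),
        (fourier (-(k : ℤ)) (x : AddCircle (2 * Real.pi))) • f (x : AddCircle (2 * Real.pi)))
        = ∫ y in (0 : ℝ)..(2 * Real.pi),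
          Complex.exp (-(k * y * Complex.I)) * F (Real.cos y : ℝ) := by
      congr 1; ext y
      rw [fourier_coe_apply, hfcoe, smul_eq_mul]
      congr 2
      have := Real.pi_ne_zero
      push_cast
      field_simp
    rw [h1, norm_smul, Real.norm_of_nonneg (by positivity)]
    calc 1 / (2 * Real.pi) * _ ≤ 1 / (2 * Real.pi) * (2 * Real.pi * M * θ ^ k) := by
          gcongr; exact norm_chebyshev_coeff_le hη hF hM k
      _ = _ := by have := Real.pi_pos; field_simp
  have hsum : Summable (fourierCoeff f) := by
    have hg : Summable fun k : ℕ => M * θ ^ k :=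
      (summable_geometric_of_lt_one hθ0.le hθ1).mul_left M
    refine Summable.of_nat_of_neg (Summable.of_norm_bounded hg hcoef)
      (Summable.of_norm_bounded hg fun k => ?_)
    rw [heven]; exact hcoef k
  refine ⟨∑ k ∈ Finset.range (n + 1), Polynomial.C (2 * (fourierCoeff f k).re) *
      Polynomial.Chebyshev.T ℝ k - Polynomial.C (fourierCoeff f 0).re, ?_, ?_⟩
  · refine (Polynomial.natDegree_sub_le _ _).trans (max_le ?_ (by simp))
    refine Polynomial.natDegree_sum_le_of_forall_le _ _ fun k hk => ?_
    refine (Polynomial.natDegree_C_mul_le _ _).trans ?_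
    rw [Polynomial.Chebyshev.natDegree_T]
    simpa using Nat.lt_succ_iff.1 (Finset.mem_range.1 hk)
  · intro x hx
    set y := Real.arccos x
    have hxy : x = Real.cos y := (Real.cos_arccos hx.1 hx.2).symm
    have h1 := (has_pointwise_sum_fourier_series_of_summable hsum
      (y : AddCircle (2 * Real.pi))).nat_add_neg
    have h2 := Complex.hasSum_re h1
    have hterm : ∀ k : ℕ, (fourierCoeff f (k : ℤ) • fourier (k : ℤ) (y : AddCircle (2 * Real.pi))
        + fourierCoeff f (-(k : ℤ)) • fourier (-(k : ℤ)) (y : AddCircle (2 * Real.pi))).re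
        = 2 * (fourierCoeff f k).re * (Polynomial.Chebyshev.T ℝ k).eval x := by
      intro k
      rw [heven, hxy, Polynomial.Chebyshev.T_real_cos, fourier_coe_apply, fourier_coe_apply,
        ← smul_add, smul_eq_mul]
      have h3 : Complex.exp (2 * Real.pi * Complex.I * (k : ℤ) * y / (2 * Real.pi : ℝ))
          + Complex.exp (2 * Real.pi * Complex.I * (-(k : ℤ) : ℤ) * y / (2 * Real.pi : ℝ))
          = ((2 * Real.cos (k * y) : ℝ) : ℂ) := by
        have hpi : (Real.pi : ℂ) ≠ 0 := by exact_mod_cast Real.pi_ne_zero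
        push_cast
        rw [Complex.cos]
        have e1 : 2 * (Real.pi : ℂ) * Complex.I * k * y / (2 * Real.pi) = k * y * Complex.I := by
          field_simp
        have e2 : 2 * (Real.pi : ℂ) * Complex.I * (-k) * y / (2 * Real.pi)
            = -(k * y) * Complex.I := by
          field_simp
        rw [e1, e2]; ring
      rw [h3, Complex.re_mul_ofReal]
      push_cast
      ring
    simp only [hterm] at h2
    have hT : ∀ k : ℕ, |(Polynomial.Chebyshev.T ℝ k).eval x| ≤ 1 := by
      intro k
      rw [hxy, Polynomial.Chebyshev.T_real_cos]; exact Real.abs_cos_le_one _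
    have h4 := norm_sub_le_of_geometric_bound_of_hasSum (C := 2 * M) hθ1 (fun k => by
      rw [Real.norm_eq_abs, abs_mul, abs_mul, abs_two]
      calc 2 * |(fourierCoeff f k).re| * |(Polynomial.Chebyshev.T ℝ k).eval x|
          ≤ 2 * (M * θ ^ k) * 1 := by
            gcongr
            · exact mul_nonneg zero_le_two ((norm_nonneg _).trans (hcoef k))
            · exact (Complex.abs_re_le_norm _).trans (hcoef k)
            · exact hT k
        _ = 2 * M * θ ^ k := by ring) h2 (n + 1)
    rw [Real.norm_eq_abs, abs_sub_comm] at h4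
    refine le_trans (le_of_eq ?_) h4
    congr 1
    rw [hfcoe, ← hxy]
    simp only [Polynomial.eval_sub, Polynomial.eval_finsetSum, Polynomial.eval_mul,
      Polynomial.eval_C, Complex.add_re]
    have : (fourierCoeff f 0 • fourier 0 (y : AddCircle (2 * Real.pi))).re
      = (fourierCoeff f 0).re := by simp
    rw [this]; ring

lemma exists_poly_approx_interval {F : ℂ → ℂ} {a c η M : ℝ} (hac : a < c) (hη : 0 < η)
    (hF : DifferentiableOn ℂ F (tube a c (η * (c - a))))
    (hM : ∀ z ∈ tube a c (η * (c - a)), ‖F z‖ ≤ M) (n : ℕ) :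
    ∃ q : Polynomial ℝ, q.natDegree ≤ n ∧ ∀ x ∈ Icc a c,
      |(F x).re - q.eval x| ≤ 2 * M / η * ((1 + η)⁻¹) ^ n := by
  set h := c - a with hh
  have hpos : 0 < h := sub_pos.2 hac
  have hmaps : ∀ z ∈ tube (-1) 1 (2 * η), (a : ℂ) + h * (z + 1) / 2 ∈ tube a c (η * h) := by
    rintro z ⟨x, hx, hz⟩
    refine ⟨a + h * (x + 1) / 2, ⟨?_, ?_⟩, ?_⟩
    · have : 0 ≤ h * (x + 1) := mul_nonneg hpos.le (by linarith [hx.1])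
      linarith
    · have : h * (x + 1) ≤ h * 2 := mul_le_mul_of_nonneg_left (by linarith [hx.2]) hpos.le
      linarith
    · have : (a : ℂ) + h * (z + 1) / 2 - ((a + h * (x + 1) / 2 : ℝ) : ℂ)
          = ((h / 2 : ℝ) : ℂ) * (z - x) := by push_cast; ring
      rw [this, norm_mul, Complex.norm_real, Real.norm_of_nonneg (by positivity)]
      calc h / 2 * ‖z - x‖ < h / 2 * (2 * η) := mul_lt_mul_of_pos_left hz (by positivity)
        _ = η * h := by ring
  obtain ⟨q, hqd, hq⟩ := exists_poly_approx_unit (F := fun z => F (a + h * (z + 1) / 2))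
    (η := 2 * η) (M := M) (by positivity)
    (hF.comp (by fun_prop) hmaps) (fun z hz => hM _ (hmaps z hz)) n
  refine ⟨q.comp (Polynomial.C (2 / h) * Polynomial.X + Polynomial.C (-(2 * a / h + 1))), ?_, ?_⟩
  · rw [Polynomial.natDegree_comp]
    have := Polynomial.natDegree_linear_le (a := 2 / h) (b := -(2 * a / h + 1))
    calc _ ≤ q.natDegree * 1 := Nat.mul_le_mul_left _ this
      _ ≤ n := by simpa using hqd
  · intro x hx
    have hx' : 2 / h * x + -(2 * a / h + 1) ∈ Icc (-1 : ℝ) 1 := by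
      have e1 : 2 / h * x + -(2 * a / h + 1) = 2 * (x - a) / h - 1 := by field_simp; ring
      rw [e1]
      constructor
      · have : 0 ≤ 2 * (x - a) / h := div_nonneg (by linarith [hx.1]) hpos.le
        linarith
      · have : 2 * (x - a) / h ≤ 2 := (div_le_iff₀ hpos).2 (by linarith [hx.2])
        linarith
    have := hq _ hx'
    rw [Polynomial.eval_comp]
    simp only [Polynomial.eval_add, Polynomial.eval_mul, Polynomial.eval_C, Polynomial.eval_X]
    have e2 : (a : ℂ) + h * (((2 / h * x + -(2 * a / h + 1) : ℝ) : ℂ) + 1) / 2 = x := by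
      have : (h : ℂ) ≠ 0 := by exact_mod_cast hpos.ne'
      push_cast; field_simp; ring
    rw [e2] at this
    refine this.trans (le_of_eq ?_)
    have e3 : 1 + 2 * η / 2 = 1 + η := by ring
    rw [e3, pow_succ]
    have : (1 : ℝ) + η ≠ 0 := by positivity
    have h4 : 1 - (1 + η)⁻¹ = η * (1 + η)⁻¹ := by field_simp; ring
    rw [h4]; field_simp

/-- The exponential rate of polynomial approximation of functions holomorphic in a relative
neighbourhood of size `2η` of an interval. -/
def approxRate (η : ℝ) (p : ℕ) : ℝ := 4 * (1 + η) / η ^ 2 * ((1 + η)⁻¹) ^ p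

lemma approxRate_pos {η : ℝ} (hη : 0 < η) (p : ℕ) : 0 < approxRate η p := by
  unfold approxRate; positivity

lemma hasDerivAt_re {F : ℂ → ℂ} {S : Set ℂ} (hS : IsOpen S) (hF : DifferentiableOn ℂ F S) {x : ℝ}
    (hx : (x : ℂ) ∈ S) : HasDerivAt (fun t : ℝ => (F t).re) (deriv F x).re x :=
  HasDerivAt.real_of_complex ((hF.differentiableAt (hS.mem_nhds hx)).hasDerivAt)

lemma abs_sub_le_of_hasDerivAt {f f' : ℝ → ℝ} {a c K : ℝ}
    (hf : ∀ x ∈ Icc a c, HasDerivAt f (f' x) x) (hK : ∀ x ∈ Icc a c, |f' x| ≤ K)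
    {x y : ℝ} (hx : x ∈ Icc a c) (hy : y ∈ Icc a c) : |f y - f x| ≤ K * |y - x| :=
  Convex.norm_image_sub_le_of_norm_hasDerivWithin_le
    (fun z hz => (hf z hz).hasDerivWithinAt) hK (convex_Icc a c) hx hy

/-- Polynomial approximation of a holomorphic function in `W^{1,∞}`, exact at the endpoints. -/
theorem exists_poly_approx_deriv {F : ℂ → ℂ} {a c η M : ℝ} (hac : a < c) (hη : 0 < η)
    (hF : DifferentiableOn ℂ F (tube a c (2 * η * (c - a))))
    (hM : ∀ z ∈ tube a c (2 * η * (c - a)), ‖F z‖ ≤ M) {p : ℕ} (hp : 1 ≤ p) :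
    ∃ q : Polynomial ℝ, q.natDegree ≤ p ∧ q.eval a = (F a).re ∧ q.eval c = (F c).re ∧
      ∀ x ∈ Icc a c, |(deriv F x).re - q.derivative.eval x| ≤ approxRate η p * M / (c - a) ∧
        |(F x).re - q.eval x| ≤ approxRate η p * M := by
  set h := c - a with hh
  have hpos : 0 < h := sub_pos.2 hac
  have hηh : 0 < η * h := by positivity
  have hsum : 2 * η * h = η * h + η * h := by ring
  rw [hsum] at hF hM
  have hFsub := hF.mono (tube_mono (a := a) (c := c) (by linarith : η * h ≤ η * h + η * h))
  obtain ⟨q1, hq1d, hq1⟩ := exists_poly_approx_interval (F := deriv F) (M := M / (η * h)) hac hη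
    (hFsub.deriv (isOpen_tube _ _ _)) (fun z hz => norm_deriv_le_of_tube hηh hF hM hz) (p - 1)
  obtain ⟨Q, hQd, hQ', hQa⟩ := exists_poly_primitive q1 (p - 1) hq1d a (F a).re
  set K := 2 * (M / (η * h)) / η * ((1 + η)⁻¹) ^ (p - 1) with hK
  have hrate : 2 * K = approxRate η p * M / h := by
    obtain ⟨k, rfl⟩ : ∃ k, p = k + 1 := ⟨p - 1, by omega⟩
    rw [hK, approxRate, Nat.add_sub_cancel, pow_succ]
    have h1 : (1 + η) * (1 + η)⁻¹ = 1 := mul_inv_cancel₀ (by positivity)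
    calc _ = 4 / η ^ 2 * ((1 + η)⁻¹) ^ k * M / h * 1 := by field_simp; ring
      _ = 4 / η ^ 2 * ((1 + η)⁻¹) ^ k * M / h * ((1 + η) * (1 + η)⁻¹) := by rw [h1]
      _ = _ := by ring
  have ha : a ∈ Icc a c := ⟨le_rfl, hac.le⟩
  have hc : c ∈ Icc a c := ⟨hac.le, le_rfl⟩
  have hd : ∀ x ∈ Icc a c, HasDerivAt (fun t : ℝ => (F t).re - Q.eval t)
      ((deriv F x).re - q1.eval x) x := fun x hx => by
    have h1 := hasDerivAt_re (isOpen_tube _ _ _) hFsub (ofReal_mem_tube hηh hx)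
    have h2 := Q.hasDerivAt x
    rw [hQ'] at h2
    exact h1.sub h2
  have hval : ∀ x ∈ Icc a c, |(F x).re - Q.eval x| ≤ K * (x - a) := fun x hx => by
    have := abs_sub_le_of_hasDerivAt hd hq1 ha hx
    simp only [hQa, sub_self, sub_zero] at this
    rwa [abs_of_nonneg (by linarith [hx.1] : 0 ≤ x - a)] at this
  have hK0 : 0 ≤ K := (abs_nonneg _).trans (hq1 a ha)
  set d := ((F c).re - Q.eval c) / h with hdd
  have hdK : |d| ≤ K := by
    rw [hdd, abs_div, abs_of_pos hpos, div_le_iff₀ hpos]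
    exact hval c hc
  have hdh : d * h = (F c).re - Q.eval c := by rw [hdd]; field_simp
  refine ⟨Q + Polynomial.C d * (Polynomial.X - Polynomial.C a), ?_, ?_, ?_, ?_⟩
  · refine (Polynomial.natDegree_add_le _ _).trans (max_le (by omega) ?_)
    refine (Polynomial.natDegree_C_mul_le _ _).trans ?_
    rw [Polynomial.natDegree_X_sub_C]; exact hp
  · simp [hQa]
  · simp only [Polynomial.eval_add, Polynomial.eval_mul, Polynomial.eval_C, Polynomial.eval_sub,
      Polynomial.eval_X, ← hh, hdh]; ring
  · intro x hx
    have hv : |(F x).re - Q.eval x - d * (x - a)| ≤ 2 * K * (x - a) := by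
      refine (abs_sub _ _).trans ?_
      have h1 := hval x hx
      have h2 : |d * (x - a)| ≤ K * (x - a) := by
        rw [abs_mul, abs_of_nonneg (by linarith [hx.1] : 0 ≤ x - a)]
        exact mul_le_mul_of_nonneg_right hdK (by linarith [hx.1])
      linarith
    refine ⟨?_, ?_⟩
    · rw [← hrate]
      simp only [Polynomial.derivative_add, hQ', Polynomial.derivative_mul, Polynomial.derivative_C,
        zero_mul, Polynomial.derivative_sub, Polynomial.derivative_X, sub_zero, mul_one, zero_add,
        Polynomial.eval_add, Polynomial.eval_C]
      rw [← sub_sub]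
      refine (abs_sub _ _).trans ?_
      linarith [hq1 x hx]
    · simp only [Polynomial.eval_add, Polynomial.eval_mul, Polynomial.eval_C, Polynomial.eval_sub,
        Polynomial.eval_X]
      rw [← sub_sub]
      refine hv.trans ?_
      have : approxRate η p * M = 2 * K * h := by rw [hrate]; field_simp
      rw [this]
      exact mul_le_mul_of_nonneg_left (by linarith [hx.2]) (by linarith)

/-- The complex Taylor series of a real function `g` centred at the real point `x`. -/
def taylorC (g : ℝ → ℝ) (x : ℝ) (z : ℂ) : ℂ :=
  ∑' n : ℕ, ((iteratedDeriv n g x / n.factorial : ℝ) : ℂ) * (z - x) ^ n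

lemma abs_taylor_coeff_le {g : ℝ → ℝ} {A K x : ℝ}
    (h : ∀ n : ℕ, |iteratedDeriv n g x| ≤ A * n.factorial * K ^ n) (n : ℕ) :
    |iteratedDeriv n g x / n.factorial| ≤ A * K ^ n := by
  have hn : (0 : ℝ) < n.factorial := by exact_mod_cast n.factorial_pos
  rw [abs_div, abs_of_pos hn, div_le_iff₀ hn]
  linarith [h n]

lemma norm_taylor_term_le {g : ℝ → ℝ} {A K x : ℝ} (hK : 0 < K)
    (h : ∀ n : ℕ, |iteratedDeriv n g x| ≤ A * n.factorial * K ^ n) (n : ℕ) {z : ℂ}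
    (hz : z ∈ Metric.ball (x : ℂ) (1 / (2 * K))) :
    ‖((iteratedDeriv n g x / n.factorial : ℝ) : ℂ) * (z - x) ^ n‖ ≤ A * (1 / 2) ^ n := by
  rw [Metric.mem_ball, dist_eq_norm] at hz
  have hA : 0 ≤ A * K ^ n := (abs_nonneg _).trans (abs_taylor_coeff_le h n)
  rw [norm_mul, norm_pow, Complex.norm_real]
  calc _ ≤ A * K ^ n * (1 / (2 * K)) ^ n :=
        mul_le_mul (abs_taylor_coeff_le h n) (pow_le_pow_left₀ (norm_nonneg _) hz.le n)
          (by positivity) hA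
    _ = A * (1 / 2) ^ n := by rw [mul_assoc, ← mul_pow]; congr 2; field_simp

lemma differentiableOn_taylorC {g : ℝ → ℝ} {A K x : ℝ} (hK : 0 < K)
    (h : ∀ n : ℕ, |iteratedDeriv n g x| ≤ A * n.factorial * K ^ n) :
    DifferentiableOn ℂ (taylorC g x) (Metric.ball (x : ℂ) (1 / (2 * K))) :=
  Complex.differentiableOn_tsum_of_summable_norm (summable_geometric_two.mul_left A)
    (fun n => by fun_prop) Metric.isOpen_ball fun n _ hw => norm_taylor_term_le hK h n hw

lemma norm_taylorC_le {g : ℝ → ℝ} {A K x : ℝ} (hK : 0 < K)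
    (h : ∀ n : ℕ, |iteratedDeriv n g x| ≤ A * n.factorial * K ^ n) {z : ℂ}
    (hz : z ∈ Metric.ball (x : ℂ) (1 / (2 * K))) : ‖taylorC g x z‖ ≤ 2 * A := by
  have h1 := tsum_of_norm_bounded (hasSum_geometric_two.mul_left A)
    fun n => norm_taylor_term_le hK h n hz
  rw [mul_comm]; exact h1

lemma taylorC_ofReal {g : ℝ → ℝ} {A K x y : ℝ} (hK : 0 < K) (hg : ContDiff ℝ (⊤ : ℕ∞) g)
    (h : ∀ n : ℕ, ∀ t ∈ Icc (0 : ℝ) 1, |iteratedDeriv n g t| ≤ A * n.factorial * K ^ n)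
    (hx : x ∈ Icc (0 : ℝ) 1) (hy : y ∈ Icc (0 : ℝ) 1) (hxy : |y - x| < 1 / (2 * K)) :
    taylorC g x y = g y := by
  have hzy : (y : ℂ) ∈ Metric.ball (x : ℂ) (1 / (2 * K)) := by
    rw [Metric.mem_ball, dist_eq_norm, ← Complex.ofReal_sub, Complex.norm_real]; exact hxy
  have hA : 0 ≤ A := by simpa using (abs_nonneg _).trans (h 0 x hx)
  have hsum : Summable fun n : ℕ => ((iteratedDeriv n g x / n.factorial : ℝ) : ℂ) *
      ((y : ℂ) - x) ^ n := Summable.of_norm_bounded (summable_geometric_two.mul_left A)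
    fun n => norm_taylor_term_le hK (fun n => h n x hx) n hzy
  refine tendsto_nhds_unique (hsum.hasSum.tendsto_sum_nat.comp (Filter.tendsto_add_atTop_nat 1)) ?_
  have hb : ∀ n : ℕ, ‖(∑ i ∈ Finset.range (n + 1),
      ((iteratedDeriv i g x / i.factorial : ℝ) : ℂ) * ((y : ℂ) - x) ^ i) - g y‖
        ≤ A * (1 / 2) ^ (n + 1) := by
    intro n
    have e1 : (∑ i ∈ Finset.range (n + 1), ((iteratedDeriv i g x / i.factorial : ℝ) : ℂ) *
        ((y : ℂ) - x) ^ i) - g y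
        = ((-(g y - ∑ i ∈ Finset.range (n + 1), iteratedDeriv i g x / i.factorial * (y - x) ^ i) : ℝ)
          : ℂ) := by push_cast; ring
    rw [e1, Complex.norm_real, norm_neg, Real.norm_eq_abs]
    rcases eq_or_ne x y with rfl | hne
    · rw [Finset.sum_eq_single 0 (by intro b _ hb; simp [hb]) (by simp)]
      simp; positivity
    obtain ⟨t, ht, hT⟩ := taylor_mean_remainder_lagrange_iteratedDeriv (n := n) hne
      ((hg.of_le (by exact_mod_cast le_top)).contDiffOn)
    have ht' : t ∈ Icc (0 : ℝ) 1 :=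
      (Set.uIcc_subset_Icc hx hy) (uIoo_subset_uIcc_self ht)
    rw [taylor_within_apply] at hT
    have e2 : ∀ i ∈ Finset.range (n + 1),
        (((i.factorial : ℝ))⁻¹ * (y - x) ^ i) • iteratedDerivWithin i g (uIcc x y) x
        = iteratedDeriv i g x / i.factorial * (y - x) ^ i := by
      intro i _
      rw [iteratedDerivWithin_eq_iteratedDeriv (uniqueDiffOn_uIcc hne)
        (hg.contDiffAt.of_le (by exact_mod_cast le_top)) left_mem_uIcc, smul_eq_mul]
      ring
    rw [Finset.sum_congr rfl e2] at hT
    rw [hT]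
    have hc := abs_taylor_coeff_le (fun n => h n t ht') (n + 1)
    rw [mul_div_right_comm, abs_mul, abs_pow]
    calc _ ≤ A * K ^ (n + 1) * (1 / (2 * K)) ^ (n + 1) :=
          mul_le_mul hc (pow_le_pow_left₀ (abs_nonneg _) hxy.le _) (by positivity) (by positivity)
      _ = A * (1 / 2) ^ (n + 1) := by rw [mul_assoc, ← mul_pow]; congr 2; field_simp
  rw [tendsto_iff_norm_sub_tendsto_zero]
  refine squeeze_zero (fun _ => norm_nonneg _) hb ?_
  have : Filter.Tendsto (fun n : ℕ => A * (1 / 2 : ℝ) ^ (n + 1)) Filter.atTop (nhds (A * 0)) :=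
    ((tendsto_pow_atTop_nhds_zero_of_lt_one (by norm_num) (by norm_num)).comp
      (Filter.tendsto_add_atTop_nat 1)).const_mul A
  simpa using this

lemma taylorC_eq_taylorC {g : ℝ → ℝ} {A K x y : ℝ} (hK : 0 < K) (hg : ContDiff ℝ (⊤ : ℕ∞) g)
    (h : ∀ n : ℕ, ∀ t ∈ Icc (0 : ℝ) 1, |iteratedDeriv n g t| ≤ A * n.factorial * K ^ n)
    (hx : x ∈ Icc (0 : ℝ) 1) (hy : y ∈ Icc (0 : ℝ) 1) (hxy : |x - y| < 1 / (2 * K)) {z : ℂ}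
    (hzx : z ∈ Metric.ball (x : ℂ) (1 / (2 * K))) (hzy : z ∈ Metric.ball (y : ℂ) (1 / (2 * K))) :
    taylorC g x z = taylorC g y z := by
  have hR : 0 < 1 / (2 * K) := by positivity
  have hxx : (x : ℂ) ∈ Metric.ball (x : ℂ) (1 / (2 * K)) ∩ Metric.ball (y : ℂ) (1 / (2 * K)) := by
    refine ⟨Metric.mem_ball_self hR, ?_⟩
    rw [Metric.mem_ball, dist_eq_norm, ← Complex.ofReal_sub, Complex.norm_real]; exact hxy
  refine AnalyticOnNhd.eqOn_of_preconnected_of_frequently_eq (z₀ := (x : ℂ))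
    (U := Metric.ball (x : ℂ) (1 / (2 * K)) ∩ Metric.ball (y : ℂ) (1 / (2 * K)))
    (((differentiableOn_taylorC hK fun n => h n x hx).mono inter_subset_left).analyticOnNhd
      (Metric.isOpen_ball.inter Metric.isOpen_ball))
    (((differentiableOn_taylorC hK fun n => h n y hy).mono inter_subset_right).analyticOnNhd
      (Metric.isOpen_ball.inter Metric.isOpen_ball))
    ((convex_ball _ _).inter (convex_ball _ _)).isPreconnected hxx ?_ ⟨hzx, hzy⟩
  have hne : (nhdsWithin x (Icc 0 1 \ {x})).NeBot :=
    mem_closure_iff_nhdsWithin_neBot.1 (by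
      have := (accPt_principal_iff_nhdsWithin (x := x) (s := Icc (0:ℝ) 1)).1 ?_
      · exact mem_closure_iff_nhdsWithin_neBot.2 this
      · exact isPreconnected_Icc.preperfect_of_nontrivial
          ⟨0, by simp, 1, by simp, by norm_num⟩ x hx)
  have hmap : Filter.Tendsto (fun t : ℝ => (t : ℂ)) (nhdsWithin x (Icc 0 1 \ {x}))
      (nhdsWithin (x : ℂ) {(x : ℂ)}ᶜ) := by
    refine tendsto_nhdsWithin_iff.2 ⟨(Complex.continuous_ofReal.tendsto x).mono_left
      nhdsWithin_le_nhds, ?_⟩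
    filter_upwards [self_mem_nhdsWithin] with t ht
    simpa using ht.2
  refine hmap.frequently (Filter.Eventually.frequently ?_)
  have hc1 : ∀ᶠ t : ℝ in nhdsWithin x (Icc 0 1 \ {x}), |t - x| < 1 / (2 * K) ∧ |t - y| < 1 / (2 * K) := by
    refine nhdsWithin_le_nhds (Filter.Eventually.and ?_ ?_)
    · exact (by fun_prop : Continuous fun t : ℝ => |t - x|).continuousAt.eventually_lt
        continuousAt_const (by simpa using hR)
    · exact (by fun_prop : Continuous fun t : ℝ => |t - y|).continuousAt.eventually_lt
        continuousAt_const hxy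
  filter_upwards [self_mem_nhdsWithin, hc1] with t ht ht'
  rw [taylorC_ofReal hK hg h hx ht.1 ht'.1, taylorC_ofReal hK hg h hy ht.1 ht'.2]

/-- A real-analytic function with uniform bounds on its Taylor coefficients on `[0,1]` extends
holomorphically to a tube. -/
theorem exists_holomorphic_extension {g : ℝ → ℝ} {A K : ℝ} (hK : 0 < K)
    (hg : ContDiff ℝ (⊤ : ℕ∞) g)
    (h : ∀ n : ℕ, ∀ t ∈ Icc (0 : ℝ) 1, |iteratedDeriv n g t| ≤ A * n.factorial * K ^ n) :
    ∃ G : ℂ → ℂ, DifferentiableOn ℂ G (tube 0 1 (1 / (4 * K))) ∧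
      (∀ z ∈ tube 0 1 (1 / (4 * K)), ‖G z‖ ≤ 2 * A) ∧ ∀ x ∈ Icc (0 : ℝ) 1, G x = g x := by
  classical
  have hR : 0 < 1 / (4 * K) := by positivity
  have hRR : 1 / (4 * K) + 1 / (4 * K) = 1 / (2 * K) := by field_simp; norm_num
  set c : ℂ → ℝ := fun z => if hz : z ∈ tube 0 1 (1 / (4 * K)) then hz.choose else 0 with hc
  have hcspec : ∀ z ∈ tube 0 1 (1 / (4 * K)), c z ∈ Icc (0 : ℝ) 1 ∧ ‖z - c z‖ < 1 / (4 * K) := by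
    intro z hz
    simp only [hc, dif_pos hz]
    exact hz.choose_spec
  have hcb : ∀ z ∈ tube 0 1 (1 / (4 * K)), z ∈ Metric.ball (c z : ℂ) (1 / (2 * K)) := by
    intro z hz
    rw [Metric.mem_ball, dist_eq_norm]
    linarith [(hcspec z hz).2]
  have hagree : ∀ z ∈ tube 0 1 (1 / (4 * K)), ∀ x ∈ Icc (0 : ℝ) 1, ‖z - x‖ < 1 / (4 * K) →
      taylorC g (c z) z = taylorC g x z := by
    intro z hz x hx hzx
    refine taylorC_eq_taylorC hK hg h (hcspec z hz).1 hx ?_ (hcb z hz) ?_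
    · have : ((c z - x : ℝ) : ℂ) = (z - x) - (z - c z) := by push_cast; ring
      rw [← Real.norm_eq_abs, ← Complex.norm_real, this]
      exact (norm_sub_le _ _).trans_lt (by linarith [(hcspec z hz).2])
    · rw [Metric.mem_ball, dist_eq_norm]; linarith
  refine ⟨fun z => taylorC g (c z) z, ?_, ?_, ?_⟩
  · intro z hz
    obtain ⟨x, hx, hzx⟩ := id hz
    have hd : DifferentiableAt ℂ (taylorC g x) z :=
      (differentiableOn_taylorC hK fun n => h n x hx).differentiableAt
        (Metric.isOpen_ball.mem_nhds (by rw [Metric.mem_ball, dist_eq_norm]; linarith))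
    refine (hd.congr_of_eventuallyEq ?_).differentiableWithinAt
    filter_upwards [(isOpen_tube _ _ _).mem_nhds hz,
      Metric.isOpen_ball.mem_nhds (show z ∈ Metric.ball (x : ℂ) (1 / (4 * K)) by
        rwa [Metric.mem_ball, dist_eq_norm])] with w hw hw'
    rw [Metric.mem_ball, dist_eq_norm] at hw'
    exact hagree w hw x hx hw'
  · intro z hz
    exact norm_taylorC_le hK (fun n => h n _ (hcspec z hz).1) (hcb z hz)
  · intro x hx
    have hz := ofReal_mem_tube hR hx
    change taylorC g (c x) x = g x
    rw [hagree x hz x hx (by simpa using hR)]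
    exact taylorC_ofReal hK hg h hx hx (by simp; positivity)

lemma abs_leibniz_sum_le {A K L V : ℝ} (hA : 0 ≤ A) (hK : 0 ≤ K) (hKL : 2 * K ≤ L) (hL : 0 < L)
    {β v : ℕ → ℝ} {n : ℕ} (hV : 0 ≤ V)
    (hβ : ∀ i, |β i| ≤ A * i.factorial * K ^ i) (hv : ∀ k ≤ n, |v k| ≤ V * k.factorial * L ^ k) :
    |∑ i ∈ Finset.range (n + 1), (n.choose i : ℝ) * β i * v (n - i)|
      ≤ 2 * A * V * n.factorial * L ^ n := by
  refine (Finset.abs_sum_le_sum_abs _ _).trans ?_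
  have hterm : ∀ i ∈ Finset.range (n + 1), |(n.choose i : ℝ) * β i * v (n - i)|
      ≤ A * V * n.factorial * L ^ n * (1 / 2) ^ i := by
    intro i hi
    have hin : i ≤ n := by simpa [Nat.lt_succ_iff] using hi
    rw [abs_mul, abs_mul, Nat.abs_cast]
    have h1 : K ^ i ≤ L ^ i * (1 / 2) ^ i := by
      rw [← mul_pow]; exact pow_le_pow_left₀ hK (by linarith) i
    have hfac : (n.choose i : ℝ) * i.factorial * (n - i).factorial = n.factorial := by
      exact_mod_cast Nat.choose_mul_factorial_mul_factorial hin
    have hpow : L ^ i * L ^ (n - i) = L ^ n := by rw [← pow_add]; congr 1; omega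
    calc _ ≤ (n.choose i : ℝ) * (A * i.factorial * (L ^ i * (1 / 2) ^ i))
          * (V * (n - i).factorial * L ^ (n - i)) := by
            have := (hβ i).trans (mul_le_mul_of_nonneg_left h1 (by positivity : 0 ≤ A * i.factorial))
            exact mul_le_mul (mul_le_mul_of_nonneg_left this (by positivity))
              (hv _ (Nat.sub_le _ _)) (abs_nonneg _) (by positivity)
      _ = A * V * ((n.choose i : ℝ) * i.factorial * (n - i).factorial) * (L ^ i * L ^ (n - i))
          * (1 / 2) ^ i := by ring
      _ = _ := by rw [hfac, hpow]
  refine (Finset.sum_le_sum hterm).trans ?_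
  rw [← Finset.mul_sum]
  have hgeo : ∑ i ∈ Finset.range (n + 1), (1 / 2 : ℝ) ^ i ≤ 2 := by
    exact (summable_geometric_two.sum_le_tsum (Finset.range (n + 1))
      (fun i _ => by positivity)).trans_eq tsum_geometric_two
  calc _ ≤ A * V * n.factorial * L ^ n * 2 := mul_le_mul_of_nonneg_left hgeo (by positivity)
    _ = _ := by ring

lemma bvp_iteratedDeriv {ε₁ ε₂ : ℝ} {bb rr ff u : ℝ → ℝ} (hb : ContDiff ℝ (⊤ : ℕ∞) bb)
    (hr : ContDiff ℝ (⊤ : ℕ∞) rr) (hf : ContDiff ℝ (⊤ : ℕ∞) ff) (hu : ContDiff ℝ (⊤ : ℕ∞) u)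
    (hsol : SolvesBVP ε₁ ε₂ bb rr ff u) (n : ℕ) {x : ℝ} (hx : x ∈ Icc (0 : ℝ) 1) :
    ε₁ * iteratedDeriv (n + 2) u x
      = ε₂ * (∑ i ∈ Finset.range (n + 1), (n.choose i : ℝ) * iteratedDeriv i bb x
          * iteratedDeriv (n - i + 1) u x)
        + (∑ i ∈ Finset.range (n + 1), (n.choose i : ℝ) * iteratedDeriv i rr x
          * iteratedDeriv (n - i) u x) - iteratedDeriv n ff x := by
  have hu1 : ContDiff ℝ (⊤ : ℕ∞) (deriv u) := (contDiff_infty_iff_deriv.1 hu).2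
  have hu2 : ContDiff ℝ (⊤ : ℕ∞) (deriv (deriv u)) := (contDiff_infty_iff_deriv.1 hu1).2
  have hn : ∀ {g : ℝ → ℝ}, ContDiff ℝ (⊤ : ℕ∞) g → ∀ y, ContDiffAt ℝ (n : ℕ) g y :=
    fun hg y => (hg.of_le (by exact_mod_cast le_top)).contDiffAt
  have hbu : ContDiff ℝ (⊤ : ℕ∞) fun y => bb y * deriv u y := hb.mul hu1
  have hru : ContDiff ℝ (⊤ : ℕ∞) fun y => rr y * u y := hr.mul hu
  have hcont : ∀ {g : ℝ → ℝ}, ContDiff ℝ (⊤ : ℕ∞) g → Continuous (iteratedDeriv n g) :=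
    fun hg => hg.continuous_iteratedDeriv n (by exact_mod_cast le_top)
  have hclosed : EqOn (iteratedDeriv n fun y => ε₁ * deriv (deriv u) y)
      (iteratedDeriv n fun y => ε₂ * (bb y * deriv u y) + rr y * u y - ff y)
      (closure (Ioo (0 : ℝ) 1)) := by
    refine EqOn.closure (fun y hy => ?_) (hcont (contDiff_const.mul hu2))
      (hcont (((contDiff_const.mul hbu).add hru).sub hf))
    refine Filter.EventuallyEq.iteratedDeriv_eq n ?_
    filter_upwards [isOpen_Ioo.mem_nhds hy] with t ht
    have := hsol.2.2 t (Ioo_subset_Icc_self ht)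
    linarith
  rw [closure_Ioo (by norm_num)] at hclosed
  have := hclosed hx
  rw [iteratedDeriv_fun_sub ((hn (contDiff_const.mul hbu) x).add (hn hru x)) (hn hf x),
    iteratedDeriv_fun_add (hn (contDiff_const.mul hbu) x) (hn hru x),
    iteratedDeriv_const_mul_field, iteratedDeriv_const_mul_field,
    iteratedDeriv_fun_mul (hn hb x) (hn hu1 x), iteratedDeriv_fun_mul (hn hr x) (hn hu x)] at this
  simp only [← iteratedDeriv_succ'] at this
  exact this

/-- Partial sums of the exponential series. -/
def expSum (X : ℝ) (n : ℕ) : ℝ := ∑ k ∈ Finset.range (n + 1), X ^ k / k.factorial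

lemma one_le_expSum {X : ℝ} (hX : 0 ≤ X) (n : ℕ) : 1 ≤ expSum X n := by
  have := Finset.single_le_sum (f := fun k : ℕ => X ^ k / (k.factorial : ℝ))
    (s := Finset.range (n + 1)) (fun i _ => by positivity) (Finset.mem_range.2 (Nat.succ_pos n))
  simpa [expSum] using this

lemma expSum_mono {X : ℝ} (hX : 0 ≤ X) : Monotone (expSum X) := by
  refine monotone_nat_of_le_succ fun n => ?_
  rw [expSum, expSum, Finset.sum_range_succ _ (n + 1)]
  have : 0 ≤ X ^ (n + 1) / ((n + 1).factorial : ℝ) := by positivity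
  linarith

lemma mul_expSum_le {X : ℝ} (hX : 0 ≤ X) (n : ℕ) :
    X * expSum X n ≤ (n + 1) * expSum X (n + 1) := by
  rw [expSum, expSum, Finset.sum_range_succ' _ (n + 1), Finset.mul_sum, mul_add, Finset.mul_sum]
  have : ∀ k ∈ Finset.range (n + 1), X * (X ^ k / (k.factorial : ℝ))
      ≤ (n + 1) * (X ^ (k + 1) / ((k + 1).factorial : ℝ)) := by
    intro k hk
    have hk' : (k : ℝ) + 1 ≤ n + 1 := by
      have : k ≤ n := by simpa [Nat.lt_succ_iff] using hk
      exact_mod_cast Nat.succ_le_succ this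
    have e : X * (X ^ k / (k.factorial : ℝ)) = (k + 1) * (X ^ (k + 1) / ((k + 1).factorial : ℝ)) := by
      rw [Nat.factorial_succ]; push_cast; field_simp; ring
    rw [e]
    exact mul_le_mul_of_nonneg_right hk' (by positivity)
  have h2 := Finset.sum_le_sum this
  have h3 : 0 ≤ ((n : ℝ) + 1) * (X ^ 0 / (Nat.factorial 0 : ℝ)) := by positivity
  linarith

lemma abs_iteratedDeriv_bvp_le {ε₁ ε₂ A K M : ℝ} (hε₁ : 0 < ε₁) (hε₂ : 0 < ε₂) (hε₂' : ε₂ ≤ 1)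
    (hA : 1 ≤ A) (hK : 1 ≤ K) (hM : 1 ≤ M) {bb rr ff u : ℝ → ℝ} (hb : ContDiff ℝ (⊤ : ℕ∞) bb)
    (hr : ContDiff ℝ (⊤ : ℕ∞) rr) (hf : ContDiff ℝ (⊤ : ℕ∞) ff) (hu : ContDiff ℝ (⊤ : ℕ∞) u)
    (hsol : SolvesBVP ε₁ ε₂ bb rr ff u) {x : ℝ} (hx : x ∈ Icc (0 : ℝ) 1)
    (hbA : ∀ n : ℕ, |iteratedDeriv n bb x| ≤ A * n.factorial * K ^ n)
    (hrA : ∀ n : ℕ, |iteratedDeriv n rr x| ≤ A * n.factorial * K ^ n)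
    (hfA : ∀ n : ℕ, |iteratedDeriv n ff x| ≤ A * n.factorial * K ^ n)
    (hu0 : |u x| ≤ M) (hu1 : |deriv u x| ≤ M) (n : ℕ) :
    |iteratedDeriv n u x| ≤ M * Real.exp (1 / ε₁) * n.factorial * (5 * A + 2 * K) ^ n := by
  set L := 5 * A + 2 * K with hL
  have hL1 : 1 ≤ L := by linarith
  set X := 1 / ε₁ with hX
  have hX0 : 0 ≤ X := by positivity
  have hT1 := one_le_expSum hX0
  have main : ∀ n, |iteratedDeriv n u x| ≤ M * expSum X n * n.factorial * L ^ n := by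
    intro n
    induction n using Nat.strong_induction_on with
    | _ n ih =>
      rcases n with _ | _ | n
      · rw [iteratedDeriv_zero]
        simp only [Nat.factorial_zero, Nat.cast_one, mul_one, pow_zero]
        exact hu0.trans (le_mul_of_one_le_right (by linarith) (hT1 0))
      · rw [zero_add, iteratedDeriv_one]
        simp only [Nat.factorial_one, Nat.cast_one, mul_one, pow_one]
        refine hu1.trans ?_
        rw [mul_assoc]
        exact le_mul_of_one_le_right (by linarith) (one_le_mul_of_one_le_of_one_le (hT1 1) hL1)
      · set T := expSum X (n + 1) with hT
        have hT0 : 1 ≤ T := hT1 _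
        have hmono : ∀ k ≤ n + 1, |iteratedDeriv k u x| ≤ M * T * k.factorial * L ^ k := by
          intro k hk
          refine (ih k (by omega)).trans ?_
          have := expSum_mono hX0 hk
          gcongr
        have e := bvp_iteratedDeriv hb hr hf hu hsol n hx
        have s1 := abs_leibniz_sum_le (n := n) (V := M * T * L * (n + 1)) (by linarith : 0 ≤ A)
          (by linarith : 0 ≤ K) (by linarith : 2 * K ≤ L) (by linarith) (by positivity) hbA
          (v := fun k => iteratedDeriv (k + 1) u x) (fun k hk => by
            refine (hmono (k + 1) (by omega)).trans ?_
            rw [Nat.factorial_succ, pow_succ]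
            push_cast
            have hk' : (k : ℝ) + 1 ≤ n + 1 := by exact_mod_cast Nat.succ_le_succ hk
            calc M * T * ((k + 1) * k.factorial) * (L ^ k * L)
                = M * T * L * k.factorial * L ^ k * (k + 1) := by ring
              _ ≤ M * T * L * k.factorial * L ^ k * (n + 1) :=
                mul_le_mul_of_nonneg_left hk' (by positivity)
              _ = _ := by ring)
        have s2 := abs_leibniz_sum_le (n := n) (V := M * T) (by linarith : 0 ≤ A)
          (by linarith : 0 ≤ K) (by linarith : 2 * K ≤ L) (by linarith) (by positivity) hrA
          (v := fun k => iteratedDeriv k u x) (fun k hk => hmono k (by omega))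
        set Sb := ∑ i ∈ Finset.range (n + 1), (n.choose i : ℝ) * iteratedDeriv i bb x
          * iteratedDeriv (n - i + 1) u x
        set Sr := ∑ i ∈ Finset.range (n + 1), (n.choose i : ℝ) * iteratedDeriv i rr x
          * iteratedDeriv (n - i) u x
        have hY : ε₁ * |iteratedDeriv (n + 2) u x|
            ≤ 5 * A * M * T * ((n + 1).factorial) * L ^ (n + 1) := by
          have a1 : ε₁ * |iteratedDeriv (n + 2) u x| = |ε₂ * Sb + Sr - iteratedDeriv n ff x| := by
            rw [← e, abs_mul, abs_of_pos hε₁]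
          have a2 : |ε₂ * Sb + Sr - iteratedDeriv n ff x| ≤ |Sb| + |Sr| + |iteratedDeriv n ff x| := by
            refine (abs_sub _ _).trans (add_le_add_left ((abs_add_le _ _).trans
              (add_le_add_left ?_ _)) _)
            rw [abs_mul, abs_of_pos hε₂]
            exact mul_le_of_le_one_left (abs_nonneg _) hε₂'
          have hfacn : (0 : ℝ) < n.factorial := by exact_mod_cast n.factorial_pos
          have hbase : (n.factorial : ℝ) * L ^ n ≤ (n + 1) * n.factorial * L ^ n * L := by
            have : (1 : ℝ) ≤ (n + 1) * L := one_le_mul_of_one_le_of_one_le (by linarith [n.cast_nonneg (α := ℝ)]) hL1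
            calc _ ≤ (n.factorial : ℝ) * L ^ n * ((n + 1) * L) :=
                  le_mul_of_one_le_right (by positivity) this
              _ = _ := by ring
          have a3 : |iteratedDeriv n ff x| ≤ A * M * T * (n.factorial * L ^ n) := by
            refine (hfA n).trans ?_
            have : K ^ n ≤ L ^ n := pow_le_pow_left₀ (by linarith) (by linarith) n
            have hMT : 1 ≤ M * T := one_le_mul_of_one_le_of_one_le hM hT0
            calc A * n.factorial * K ^ n ≤ A * n.factorial * L ^ n :=
                  mul_le_mul_of_nonneg_left this (by positivity)
              _ ≤ A * n.factorial * L ^ n * (M * T) := le_mul_of_one_le_right (by positivity) hMT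
              _ = _ := by ring
          have hAMT : 0 ≤ A * M * T := by positivity
          have a4 := mul_le_mul_of_nonneg_left hbase hAMT
          rw [Nat.factorial_succ, pow_succ]
          push_cast
          rw [a1]
          refine a2.trans ?_
          have b1 : |Sb| ≤ 2 * (A * M * T * ((n + 1) * n.factorial * L ^ n * L)) :=
            s1.trans (le_of_eq (by ring))
          have b2 : |Sr| ≤ 2 * (A * M * T * (n.factorial * L ^ n)) := s2.trans (le_of_eq (by ring))
          have b3 : 5 * A * M * T * ((n + 1) * n.factorial) * (L ^ n * L)
            = 5 * (A * M * T * ((n + 1) * n.factorial * L ^ n * L)) := by ring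
          rw [b3]
          linarith
        have hXT := mul_expSum_le hX0 (n + 1)
        have hfin : |iteratedDeriv (n + 2) u x| = X * (ε₁ * |iteratedDeriv (n + 2) u x|) := by
          rw [hX]; field_simp
        rw [show n + 1 + 1 = n + 2 from rfl, hfin]
        calc X * (ε₁ * |iteratedDeriv (n + 2) u x|)
            ≤ X * (5 * A * M * T * ((n + 1).factorial) * L ^ (n + 1)) :=
              mul_le_mul_of_nonneg_left hY hX0
          _ = (X * T) * (5 * A) * (M * ((n + 1).factorial) * L ^ (n + 1)) := by ring
          _ ≤ (((n + 1 : ℕ) + 1) * expSum X (n + 2)) * L * (M * ((n + 1).factorial) * L ^ (n + 1)) := by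
              refine mul_le_mul_of_nonneg_right (mul_le_mul hXT (by linarith) (by linarith) ?_)
                (by positivity)
              have := hT1 (n + 2)
              positivity
          _ = M * expSum X (n + 2) * ((n + 2).factorial) * L ^ (n + 2) := by
              rw [Nat.factorial_succ (n + 1), pow_succ L (n + 1)]; push_cast; ring
  refine (main n).trans ?_
  have : expSum X n ≤ Real.exp X := Real.sum_le_exp_of_nonneg hX0 _
  gcongr

/-- Quantitative assumptions on the data of the two-parameter problem. -/
structure DataBounds (bb rr ff : ℝ → ℝ) (A K γ β : ℝ) : Prop where
  hb : ContDiff ℝ (⊤ : ℕ∞) bb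
  hr : ContDiff ℝ (⊤ : ℕ∞) rr
  hf : ContDiff ℝ (⊤ : ℕ∞) ff
  hA : 1 ≤ A
  hK : 1 ≤ K
  hγ : 0 < γ
  hβ : 0 < β
  hbA : ∀ n : ℕ, ∀ x ∈ Icc (0 : ℝ) 1, |iteratedDeriv n bb x| ≤ A * n.factorial * K ^ n
  hrA : ∀ n : ℕ, ∀ x ∈ Icc (0 : ℝ) 1, |iteratedDeriv n rr x| ≤ A * n.factorial * K ^ n
  hfA : ∀ n : ℕ, ∀ x ∈ Icc (0 : ℝ) 1, |iteratedDeriv n ff x| ≤ A * n.factorial * K ^ n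
  hbβ : ∀ x ∈ Icc (0 : ℝ) 1, β ≤ bb x
  hrγ : ∀ x ∈ Icc (0 : ℝ) 1, γ ≤ rr x
  hco : ∀ ε₂ ∈ Ioc (0 : ℝ) 1, ∀ x ∈ Icc (0 : ℝ) 1, γ ≤ rr x - ε₂ * deriv bb x / 2

namespace DataBounds

variable {bb rr ff : ℝ → ℝ} {A K γ β : ℝ}

lemma abs_b_le (d : DataBounds bb rr ff A K γ β) {x : ℝ} (hx : x ∈ Icc (0 : ℝ) 1) : |bb x| ≤ A := by
  simpa using d.hbA 0 x hx

lemma abs_r_le (d : DataBounds bb rr ff A K γ β) {x : ℝ} (hx : x ∈ Icc (0 : ℝ) 1) : |rr x| ≤ A := by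
  simpa using d.hrA 0 x hx

lemma abs_f_le (d : DataBounds bb rr ff A K γ β) {x : ℝ} (hx : x ∈ Icc (0 : ℝ) 1) : |ff x| ≤ A := by
  simpa using d.hfA 0 x hx

lemma abs_b'_le (d : DataBounds bb rr ff A K γ β) {x : ℝ} (hx : x ∈ Icc (0 : ℝ) 1) :
    |deriv bb x| ≤ A * K := by
  simpa using d.hbA 1 x hx

lemma le_AK (d : DataBounds bb rr ff A K γ β) : A ≤ A * K :=
  le_mul_of_one_le_right (by linarith [d.hA]) d.hK

lemma one_le_AK (d : DataBounds bb rr ff A K γ β) : 1 ≤ A * K := d.hA.trans d.le_AK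

end DataBounds

/-- The squared energy error of every weak Galerkin approximation on `m` is at most `B`. -/
def WGErrorLE {N : ℕ} (m : Mesh N) (ε₁ ε₂ : ℝ) (bb rr ff : ℝ → ℝ) (p : ℕ) (B : ℝ) : Prop :=
  ∀ u : ℝ → ℝ, ContDiff ℝ (⊤ : ℕ∞) u → SolvesBVP ε₁ ε₂ bb rr ff u →
    ∀ (up0 : Fin N → ℝ → ℝ) (upb : Fin (N + 1) → ℝ) (Dup Dcup : Fin N → ℝ → ℝ),
      IsWGsol m ε₁ ε₂ bb rr ff p up0 upb Dup Dcup →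
    ∀ D : Fin N → ℝ → ℝ, IsWeakDeriv m (p - 1) (fun j t => u t - up0 j t)
        (fun i => u (m.pt i) - upb i) D →
      normP2 m ε₁ ε₂ bb (stdPen m ε₁ p) (fun j t => u t - up0 j t)
        (fun i => u (m.pt i) - upb i) D ≤ B

/-- The constant of the abstract error estimate. -/
def quasiConst (A K γ : ℝ) : ℝ :=
  (6 + 4 / γ) * (2 * (148 * (A * K) ^ 2 + 16 * (A * K) ^ 2 / γ)) + 8 / γ + 16 / γ ^ 2 + 8

lemma quasiConst_pos {A K γ : ℝ} (hγ : 0 < γ) : 0 < quasiConst A K γ := by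
  unfold quasiConst; positivity

lemma abs_solution_le {bb rr ff : ℝ → ℝ} {A K γ β ε₁ ε₂ : ℝ} (d : DataBounds bb rr ff A K γ β)
    (hε₁ : 0 < ε₁) (hε₁' : ε₁ ≤ 1) (hε₂ : 0 < ε₂) (hε₂' : ε₂ ≤ 1) {u : ℝ → ℝ}
    (hu : ContDiff ℝ (⊤ : ℕ∞) u) (hsol : SolvesBVP ε₁ ε₂ bb rr ff u) {x : ℝ}
    (hx : x ∈ Icc (0 : ℝ) 1) :
    |u x| ≤ 5 * A * K * (1 + A ^ 2 / γ) / ε₁ ^ 2 ∧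
      |deriv u x| ≤ 5 * A * K * (1 + A ^ 2 / γ) / ε₁ ^ 2 := by
  have hγ := d.hγ
  have hA := d.hA
  have hK := d.hK
  have hu1 : ContDiff ℝ (⊤ : ℕ∞) (deriv u) := (contDiff_infty_iff_deriv.1 hu).2
  have hud : ∀ y, HasDerivAt u (deriv u y) y := fun y => (hu.differentiable (by simp) y).hasDerivAt
  have hu1d : ∀ y, HasDerivAt (deriv u) (deriv (deriv u) y) y :=
    fun y => (hu1.differentiable (by simp) y).hasDerivAt
  have hbd : ∀ y, HasDerivAt bb (deriv bb y) y := fun y =>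
    (d.hb.differentiable (by simp) y).hasDerivAt
  have hu1c : Continuous (deriv u) := hu1.continuous
  have hen := energy_estimate hγ d.hb d.hr.continuous (d.hco ε₂ ⟨hε₂, hε₂'⟩)
    (fun y _ => hud y) (fun y _ => hu1d y) (hu1.continuous_deriv (by simp)).continuousOn
    hsol.1 hsol.2.1 hsol.2.2 (fun y hy => d.abs_f_le hy)
  have hI : ∫ t in (0 : ℝ)..1, deriv u t ^ 2 ≤ A ^ 2 / γ / ε₁ := by
    rw [le_div_iff₀ hε₁]
    have : 0 ≤ γ * (∫ t in (0 : ℝ)..1, u t ^ 2) / 2 := by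
      have := intervalIntegral.integral_nonneg (μ := volume) (zero_le_one (α := ℝ))
        (fun t _ => sq_nonneg (u t))
      positivity
    linarith
  set M := (1 + A ^ 2 / γ) / ε₁ with hM
  have hM1 : 1 ≤ M := by
    rw [hM, le_div_iff₀ hε₁]
    have : 0 ≤ A ^ 2 / γ := by positivity
    linarith
  have hbound : ∀ y ∈ Icc (0 : ℝ) 1, |u y| ≤ M := by
    intro y hy
    have e : u y = ∫ t in (0 : ℝ)..y, deriv u t := by
      rw [intervalIntegral.integral_eq_sub_of_hasDerivAt (fun t _ => hud t)
        (hu1c.intervalIntegrable _ _), hsol.1, sub_zero]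
    rw [e]
    refine (intervalIntegral.abs_integral_le_integral_abs hy.1).trans ?_
    calc ∫ t in (0 : ℝ)..y, |deriv u t| ≤ ∫ t in (0 : ℝ)..1, |deriv u t| :=
          intervalIntegral.integral_mono_interval le_rfl hy.1 hy.2
            (Filter.Eventually.of_forall fun _ => abs_nonneg _)
            (hu1c.abs.intervalIntegrable _ _)
      _ ≤ ∫ t in (0 : ℝ)..1, (1 + deriv u t ^ 2) := by
          refine intervalIntegral.integral_mono_on zero_le_one (hu1c.abs.intervalIntegrable _ _)
            ((by fun_prop : Continuous fun t => 1 + deriv u t ^ 2).intervalIntegrable _ _)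
            fun t _ => ?_
          have := sq_nonneg (|deriv u t| - 1)
          have h2 := sq_abs (deriv u t)
          nlinarith
      _ = 1 + ∫ t in (0 : ℝ)..1, deriv u t ^ 2 := by
          rw [intervalIntegral.integral_add (by simp)
            ((by fun_prop : Continuous fun t => deriv u t ^ 2).intervalIntegrable _ _)]
          simp
      _ ≤ M := by
          have : 1 ≤ 1 / ε₁ := by rw [le_div_iff₀ hε₁]; linarith
          rw [hM, add_div]; linarith
  obtain ⟨ξ, hξ, hξ0⟩ := exists_hasDerivAt_eq_zero (f := u) (f' := deriv u) (zero_lt_one (α := ℝ))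
    hu.continuous.continuousOn (hsol.1.trans hsol.2.1.symm) (fun y _ => hud y)
  have hξ' := Ioo_subset_Icc_self hξ
  have hflux : ∀ y ∈ Icc (0 : ℝ) 1, HasDerivAt (fun t => ε₁ * deriv u t - ε₂ * (bb t * u t))
      (ε₁ * deriv (deriv u) y - ε₂ * (deriv bb y * u y + bb y * deriv u y)) y := fun y _ =>
    ((hu1d y).const_mul ε₁).sub (((hbd y).mul (hud y)).const_mul ε₂)
  have hflux' : ∀ y ∈ Icc (0 : ℝ) 1,
      |ε₁ * deriv (deriv u) y - ε₂ * (deriv bb y * u y + bb y * deriv u y)| ≤ 3 * (A * K) * M := by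
    intro y hy
    have e : ε₁ * deriv (deriv u) y - ε₂ * (deriv bb y * u y + bb y * deriv u y)
        = rr y * u y - ff y - ε₂ * (deriv bb y * u y) := by
      have := hsol.2.2 y hy
      linarith
    rw [e]
    have a1 : |rr y * u y| ≤ A * M := by
      rw [abs_mul]; exact mul_le_mul (d.abs_r_le hy) (hbound y hy) (abs_nonneg _) (by linarith)
    have a2 : |ε₂ * (deriv bb y * u y)| ≤ A * K * M := by
      rw [abs_mul, abs_mul, abs_of_pos hε₂]
      refine (mul_le_of_le_one_left (by positivity) hε₂').trans ?_
      exact mul_le_mul (d.abs_b'_le hy) (hbound y hy) (abs_nonneg _) (by positivity)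
    have a3 := d.abs_f_le hy
    have a4 : A * M ≤ A * K * M := mul_le_mul_of_nonneg_right d.le_AK (by linarith)
    have a5 : A ≤ A * M := le_mul_of_one_le_right (by linarith) hM1
    have := (abs_sub (rr y * u y - ff y) (ε₂ * (deriv bb y * u y))).trans
      (add_le_add_left (abs_sub (rr y * u y) (ff y)) _)
    linarith
  have hdiff := abs_sub_le_of_hasDerivAt hflux hflux' hξ' hx
  have hbu : ∀ y ∈ Icc (0 : ℝ) 1, |ε₂ * (bb y * u y)| ≤ A * K * M := by
    intro y hy
    rw [abs_mul, abs_mul, abs_of_pos hε₂]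
    refine (mul_le_of_le_one_left (by positivity) hε₂').trans ?_
    exact mul_le_mul ((d.abs_b_le hy).trans d.le_AK) (hbound y hy) (abs_nonneg _) (by positivity)
  have hxξ : |x - ξ| ≤ 1 := abs_le.2 ⟨by linarith [hx.1, hξ'.2], by linarith [hx.2, hξ'.1]⟩
  have hd2 : |ε₁ * deriv u x - ε₂ * (bb x * u x) - (ε₁ * deriv u ξ - ε₂ * (bb ξ * u ξ))|
      ≤ 3 * (A * K) * M := hdiff.trans (mul_le_of_le_one_right (by positivity) hxξ)
  have hd3 : ε₁ * |deriv u x| ≤ 5 * (A * K) * M := by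
    rw [← abs_of_pos hε₁, ← abs_mul]
    have e : ε₁ * deriv u x = (ε₁ * deriv u x - ε₂ * (bb x * u x)
        - (ε₁ * deriv u ξ - ε₂ * (bb ξ * u ξ))) + ε₂ * (bb x * u x) - ε₂ * (bb ξ * u ξ) := by
      rw [hξ0]; ring
    rw [e]
    refine (abs_sub _ _).trans ?_
    refine (add_le_add_left (abs_add_le _ _) _).trans ?_
    linarith [hbu x hx, hbu ξ hξ']
  have hAK := d.one_le_AK
  have e2 : 5 * A * K * (1 + A ^ 2 / γ) / ε₁ ^ 2 = 5 * (A * K) * M / ε₁ := by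
    rw [hM]; field_simp
  rw [e2]
  refine ⟨(hbound x hx).trans ?_, ?_⟩
  · rw [le_div_iff₀ hε₁]
    have : M * ε₁ ≤ M := mul_le_of_le_one_right (by linarith) hε₁'
    have h3 : M ≤ A * K * M := le_mul_of_one_le_left (by linarith) hAK
    nlinarith
  · rw [le_div_iff₀ hε₁]; linarith

lemma mesh_one_endpoints (m : Mesh 1) (j : Fin 1) : m.xl j = 0 ∧ m.xr j = 1 := by
  fin_cases j
  exact ⟨m.left, m.right⟩

lemma approxRate_eq_exp {η : ℝ} (hη : 0 < η) (p : ℕ) :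
    approxRate η p = 4 * (1 + η) / η ^ 2 * Real.exp (-Real.log (1 + η) * p) := by
  rw [approxRate, mul_comm (-Real.log _), Real.exp_nat_mul, Real.exp_neg,
    Real.exp_log (by linarith)]

lemma inv_sq_le_exp {ε : ℝ} (hε : 0 < ε) : 1 / ε ^ 2 ≤ 2 * Real.exp (1 / ε) := by
  have := Real.pow_div_factorial_le_exp (1 / ε) (by positivity) 2
  rw [div_pow, one_pow] at this
  norm_num at this
  rw [one_div, one_div]
  linarith

/-- Exponential convergence on the one-cell mesh. -/
theorem wgError_one_cell {bb rr ff : ℝ → ℝ} {A K γ β : ℝ} (d : DataBounds bb rr ff A K γ β) :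
    ∃ κ₀ σ C : ℝ, 0 < κ₀ ∧ 0 < σ ∧ 0 < C ∧ ∀ κ : ℝ, 0 < κ → κ ≤ κ₀ → ∀ ε₁ ε₂ : ℝ, 0 < ε₁ → ε₁ ≤ 1 →
      0 < ε₂ → ε₂ ≤ 1 → ∀ p : ℕ, 1 ≤ p → 1 / 2 ≤ κ * p * ε₁ → ∀ m : Mesh 1,
      WGErrorLE m ε₁ ε₂ bb rr ff p (C * Real.exp (-σ * p) ^ 2) := by
  have hA := d.hA
  have hK := d.hK
  have hγ := d.hγ
  set L := 5 * A + 2 * K with hL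
  have hL0 : 0 < L := by linarith
  set η := 1 / (8 * L) with hη
  have hη0 : 0 < η := by positivity
  set s := Real.log (1 + η) with hs
  have hs0 : 0 < s := Real.log_pos (by linarith)
  set C1 := 2 * (2 * (5 * A * K * (1 + A ^ 2 / γ))) with hC1
  set C2 := 4 * (1 + η) / η ^ 2 * C1 with hC2
  have hC20 : 0 < C2 := by positivity
  refine ⟨s / 8, s / 2, quasiConst A K γ * C2 ^ 2, by positivity, by positivity,
    mul_pos (quasiConst_pos hγ) (by positivity), ?_⟩
  intro κ hκ hκ0 ε₁ ε₂ hε₁ hε₁' hε₂ hε₂' p hp hpe m u hu hsol up0 upb Dup Dcup hwg D hD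
  have hp0 : (0 : ℝ) < p := by exact_mod_cast hp
  have hinv : 1 / ε₁ ≤ 2 * κ * p := by
    rw [div_le_iff₀ hε₁]; linarith
  set M := 5 * A * K * (1 + A ^ 2 / γ) / ε₁ ^ 2 with hM
  have hM0 : 1 ≤ M := by
    rw [hM, le_div_iff₀ (by positivity)]
    have h1 : ε₁ ^ 2 ≤ 1 := pow_le_one₀ hε₁.le hε₁'
    have h2 : 1 ≤ 1 + A ^ 2 / γ := by have : 0 ≤ A ^ 2 / γ := by positivity
                                      linarith
    have h3 : 1 ≤ A * K * (1 + A ^ 2 / γ) := one_le_mul_of_one_le_of_one_le d.one_le_AK h2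
    linarith
  obtain ⟨V, hVd, hVb, hVu⟩ := exists_holomorphic_extension (g := u) (K := L)
    (A := M * Real.exp (1 / ε₁)) hL0 hu (fun n x hx =>
      abs_iteratedDeriv_bvp_le hε₁ hε₂ hε₂' hA hK hM0 d.hb d.hr d.hf hu hsol hx
        (fun n => d.hbA n x hx) (fun n => d.hrA n x hx) (fun n => d.hfA n x hx)
        (abs_solution_le d hε₁ hε₁' hε₂ hε₂' hu hsol hx).1
        (abs_solution_le d hε₁ hε₁' hε₂ hε₂' hu hsol hx).2 n)
  have htube : 1 / (4 * L) = 2 * η * (1 - 0) := by rw [hη]; field_simp; norm_num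
  rw [htube] at hVd hVb
  obtain ⟨q, hqd, hq0, hq1, hq⟩ := exists_poly_approx_deriv zero_lt_one hη0 hVd hVb hp
  set E := approxRate η p * (2 * (M * Real.exp (1 / ε₁))) with hE
  have hEle : E ≤ C2 * Real.exp (-(s / 2) * p) := by
    rw [hE, approxRate_eq_exp hη0, ← hs]
    have h1 : M ≤ 5 * A * K * (1 + A ^ 2 / γ) * (2 * Real.exp (1 / ε₁)) := by
      rw [hM, div_eq_mul_one_div]
      exact mul_le_mul_of_nonneg_left (inv_sq_le_exp hε₁) (by positivity)
    have h2 : Real.exp (1 / ε₁) ≤ Real.exp (2 * κ * p) := Real.exp_le_exp.2 hinv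
    have h3 : M * Real.exp (1 / ε₁) ≤ 5 * A * K * (1 + A ^ 2 / γ) * (2 * Real.exp (2 * κ * p))
        * Real.exp (2 * κ * p) := by
      refine mul_le_mul (h1.trans ?_) h2 (Real.exp_pos _).le (by positivity)
      exact mul_le_mul_of_nonneg_left (by linarith) (by positivity)
    have h4 : Real.exp (-s * p) * (Real.exp (2 * κ * p) * Real.exp (2 * κ * p))
        ≤ Real.exp (-(s / 2) * p) := by
      rw [← Real.exp_add, ← Real.exp_add, Real.exp_le_exp]
      have : κ * p ≤ s / 8 * p := mul_le_mul_of_nonneg_right hκ0 hp0.le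
      linarith
    calc _ ≤ 4 * (1 + η) / η ^ 2 * Real.exp (-s * p) * (2 * (5 * A * K * (1 + A ^ 2 / γ)
          * (2 * Real.exp (2 * κ * p)) * Real.exp (2 * κ * p))) :=
          mul_le_mul_of_nonneg_left (by linarith) (by positivity)
      _ = C2 * (Real.exp (-s * p) * (Real.exp (2 * κ * p) * Real.exp (2 * κ * p))) := by
          rw [hC2, hC1]; ring
      _ ≤ _ := mul_le_mul_of_nonneg_left h4 hC20.le
  have hE0 : 0 ≤ E := by
    have := approxRate_pos hη0 p
    positivity
  have hu1 : ContDiff ℝ (⊤ : ℕ∞) (deriv u) := (contDiff_infty_iff_deriv.1 hu).2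
  have hud : ∀ y, HasDerivAt u (deriv u y) y := fun y => (hu.differentiable (by simp) y).hasDerivAt
  have hq1' : ∀ x ∈ Icc (0 : ℝ) 1, |deriv u x - q.derivative.eval x| ≤ E := by
    intro x hx
    have hmem := ofReal_mem_tube (a := 0) (c := 1) (δ := 2 * η * (1 - 0)) (by simpa using hη0) hx
    have e1 := hasDerivAt_re (isOpen_tube _ _ _) hVd hmem
    have e2 : deriv u x = (deriv V x).re := by
      refine ((uniqueDiffOn_Icc zero_lt_one) x hx).eq_deriv _ (hud x).hasDerivWithinAt
        (e1.hasDerivWithinAt.congr (fun t ht => ?_) ?_)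
      · rw [hVu t ht, Complex.ofReal_re]
      · rw [hVu x hx, Complex.ofReal_re]
    rw [e2]
    have := (hq x hx).1
    simpa using this
  have hq0' : ∀ x ∈ Icc (0 : ℝ) 1, |u x - q.eval x| ≤ E := by
    intro x hx
    have := (hq x hx).2
    rwa [hVu x hx, Complex.ofReal_re] at this
  have hend := mesh_one_endpoints m
  have hI : ∀ {f : ℝ → ℝ}, Continuous f → (∀ x ∈ Icc (0 : ℝ) 1, |f x| ≤ E) →
      ∫ t in (0 : ℝ)..1, f t ^ 2 ≤ E ^ 2 := by
    intro f hf hfE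
    calc ∫ t in (0 : ℝ)..1, f t ^ 2 ≤ ∫ t in (0 : ℝ)..1, E ^ 2 :=
          intervalIntegral.integral_mono_on zero_le_one ((hf.pow 2).intervalIntegrable _ _)
            (by simp) fun t ht => sq_le_sq' (abs_le.1 (hfE t ht)).1 (abs_le.1 (hfE t ht)).2
      _ = E ^ 2 := by simp
  have hI1 := hI (f := fun t => deriv u t - q.derivative.eval t)
    (hu1.continuous.sub q.derivative.continuous) hq1'
  have hI0 := hI (f := fun t => u t - q.eval t) (hu.continuous.sub q.continuous) hq0'
  have hpt : ∀ x ∈ Icc (0 : ℝ) 1, (deriv u x - q.derivative.eval x) ^ 2 ≤ E ^ 2 := fun x hx =>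
    sq_le_sq' (abs_le.1 (hq1' x hx)).1 (abs_le.1 (hq1' x hx)).2
  have hsq : ∀ {c y : ℝ}, 0 ≤ c → c ≤ 1 → y ≤ E ^ 2 → c * y ≤ E ^ 2 := fun h0 h1 hy =>
    (mul_le_mul_of_nonneg_left hy h0).trans (mul_le_of_le_one_left (sq_nonneg _) h1)
  have hz : (0 : ℝ) ∈ Icc (0 : ℝ) 1 := by simp
  have ho : (1 : ℝ) ∈ Icc (0 : ℝ) 1 := by simp
  have hV0 : q.eval 0 = 0 := by
    rw [hq0]
    have := hVu 0 hz
    rw [this, Complex.ofReal_re]; exact hsol.1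
  have hV1 : q.eval 1 = 0 := by
    rw [hq1]
    have := hVu 1 ho
    rw [this, Complex.ofReal_re]; exact hsol.2.1
  have key := galerkin_error m (B := A * K) (η := E) (g := fun _ => 0) (w := u) (w1 := deriv u)
    (w2 := deriv (deriv u)) (P := fun _ => q) (Pb := fun _ => 0)
    (A := fun _ t => deriv u t - q.derivative.eval t) (e := fun _ _ => 0) (e1 := fun _ _ => 0)
    (eb := fun _ => 0) hε₁ hε₁' hε₂ hγ d.one_le_AK d.hb d.hr.continuous d.hf.continuous
    (fun t ht => (d.abs_b_le ht).trans d.le_AK) (fun t ht => d.abs_b'_le ht)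
    (fun t ht => (d.abs_r_le ht).trans d.le_AK) (fun t ht => d.hβ.trans_le (d.hbβ t ht))
    (d.hco ε₂ ⟨hε₂, hε₂'⟩) hu hsol (fun y _ => hud y)
    (fun y _ => (hu1.differentiable (by simp) y).hasDerivAt)
    (hu1.continuous_deriv (by simp)).continuousOn hsol.1 hsol.2.1
    (fun x hx => by rw [sub_zero]; exact hsol.2.2 x hx) (fun x _ => by simpa using hE0) hp hwg hD
    (fun _ => hqd) (fun j => by rw [(hend j).2]; exact hV1)
    (fun j => by rw [(hend j).1]; exact hV0) rfl rfl (fun _ => rfl) (fun _ => rfl)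
    (fun _ => (hu1.continuous.sub q.derivative.continuous).continuousOn)
    (fun _ => continuousOn_const) (fun _ x _ => hasDerivAt_const _ _) (fun _ x _ => by simp)
    (fun j => by rw [(hend j).1, (hend j).2]; exact hsq hε₁.le hε₁' hI1)
    (fun j => by
      rw [Mesh.width, (hend j).1, (hend j).2, sub_zero, mul_one]
      exact hsq hε₁.le hε₁' (hpt 1 ho))
    (fun j => by
      have := d.hβ.trans_le (d.hbβ 1 ho)
      rw [(hend j).2]
      simp only [ne_eq, OfNat.ofNat_ne_zero, not_false_eq_true, zero_pow, mul_zero]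
      positivity)
    (fun j => by
      rw [Mesh.width, (hend j).1, (hend j).2, sub_zero, mul_one]
      exact hsq hε₁.le hε₁' (hpt 0 hz))
    (fun j => by
      rw [(hend j).1, (hend j).2]
      exact hsq (by positivity) (pow_le_one₀ hε₂.le hε₂') hI1)
    (fun j => by simp; positivity) (fun i => by simp; positivity)
    (fun j => by rw [(hend j).1, (hend j).2]; exact hI0)
  refine key.trans ?_
  rw [Nat.cast_one, mul_one]
  change quasiConst A K γ * E ^ 2 ≤ _
  rw [mul_assoc, ← mul_pow]
  exact mul_le_mul_of_nonneg_left (pow_le_pow_left₀ hE0 hEle 2) (quasiConst_pos hγ).le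

/-- Holomorphic extensions of the data to a complex neighbourhood of the unit interval. -/
structure HoloData (B R F : ℂ → ℂ) (bb rr ff : ℝ → ℝ) (Λ γ β ρ : ℝ) : Prop where
  hΛ : 1 ≤ Λ
  hγ : 0 < γ
  hβ : 0 < β
  hβΛ : β ≤ Λ
  hρ : 0 < ρ
  hB : DifferentiableOn ℂ B (tube 0 1 ρ)
  hR : DifferentiableOn ℂ R (tube 0 1 ρ)
  hF : DifferentiableOn ℂ F (tube 0 1 ρ)
  B_le : ∀ z ∈ tube 0 1 ρ, ‖B z‖ ≤ Λ
  R_le : ∀ z ∈ tube 0 1 ρ, ‖R z‖ ≤ Λ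
  F_le : ∀ z ∈ tube 0 1 ρ, ‖F z‖ ≤ Λ
  B'_le : ∀ z ∈ tube 0 1 ρ, ‖deriv B z‖ ≤ Λ
  B_re : ∀ z ∈ tube 0 1 ρ, β / 2 ≤ (B z).re
  Bsq_re : ∀ z ∈ tube 0 1 ρ, 3 / 4 * β ^ 2 ≤ (B z ^ 2).re
  R_re : ∀ z ∈ tube 0 1 ρ, γ / 2 ≤ (R z).re
  B_real : ∀ x ∈ Icc (0 : ℝ) 1, B x = bb x
  R_real : ∀ x ∈ Icc (0 : ℝ) 1, R x = rr x
  F_real : ∀ x ∈ Icc (0 : ℝ) 1, F x = ff x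

lemma norm_sub_le_of_tube {G : ℂ → ℂ} {ρ L : ℝ} (hρ : 0 < ρ)
    (hG : DifferentiableOn ℂ G (tube 0 1 ρ)) (hL : ∀ z ∈ tube 0 1 ρ, ‖deriv G z‖ ≤ L)
    {z : ℂ} {x : ℝ} (hx : x ∈ Icc (0 : ℝ) 1) (hz : ‖z - x‖ < ρ) :
    ‖G z - G x‖ ≤ L * ‖z - x‖ := by
  refine Convex.norm_image_sub_le_of_norm_deriv_le (s := tube 0 1 ρ) (fun w hw =>
    (hG w hw).differentiableAt ((isOpen_tube _ _ _).mem_nhds hw)) hL (convex_tube _ _ _)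
    (ofReal_mem_tube hρ hx) ⟨x, hx, hz⟩

set_option maxHeartbeats 1000000 in
lemma exists_holoData {bb rr ff : ℝ → ℝ} {A K γ β : ℝ} (d : DataBounds bb rr ff A K γ β) :
    ∃ B R F ρ, HoloData B R F bb rr ff (16 * A * K) γ β ρ := by
  have hA := d.hA
  have hK := d.hK
  have hγ := d.hγ
  have hβ := d.hβ
  have hAK := d.one_le_AK
  have h0 : (0 : ℝ) ∈ Icc (0 : ℝ) 1 := by simp
  have hβA : β ≤ A := (d.hbβ 0 h0).trans ((le_abs_self _).trans (d.abs_b_le h0))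
  have hγA : γ ≤ A := (d.hrγ 0 h0).trans ((le_abs_self _).trans (d.abs_r_le h0))
  obtain ⟨B, hB, hB2, hBx⟩ := exists_holomorphic_extension (by linarith) d.hb d.hbA
  obtain ⟨R, hR, hR2, hRx⟩ := exists_holomorphic_extension (by linarith) d.hr d.hrA
  obtain ⟨F, hF, hF2, hFx⟩ := exists_holomorphic_extension (by linarith) d.hf d.hfA
  set ρ := min β γ / (128 * A * K) with hρdef
  have hρ : 0 < ρ := div_pos (lt_min hβ hγ) (by positivity)
  have hρβ : 16 * A * K * ρ ≤ β / 8 := by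
    have : 16 * A * K * ρ = min β γ / 8 := by rw [hρdef]; field_simp; norm_num
    rw [this]; linarith [min_le_left β γ]
  have hργ : 16 * A * K * ρ ≤ γ / 8 := by
    have : 16 * A * K * ρ = min β γ / 8 := by rw [hρdef]; field_simp; norm_num
    rw [this]; linarith [min_le_right β γ]
  have hρK : ρ ≤ 1 / (8 * K) := by
    rw [hρdef, div_le_div_iff₀ (by positivity) (by positivity)]
    have : min β γ * (8 * K) ≤ A * (8 * K) :=
      mul_le_mul_of_nonneg_right ((min_le_left _ _).trans hβA) (by positivity)
    nlinarith
  have hsplit : 1 / (8 * K) + 1 / (8 * K) = 1 / (4 * K) := by field_simp; norm_num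
  have hsub : tube 0 1 ρ ⊆ tube 0 1 (1 / (8 * K)) := tube_mono hρK
  have hsub' : tube 0 1 ρ ⊆ tube 0 1 (1 / (4 * K)) := by
    refine hsub.trans (tube_mono ?_)
    rw [← hsplit]
    have : 0 < 1 / (8 * K) := by positivity
    linarith
  have hder : ∀ {G : ℂ → ℂ}, DifferentiableOn ℂ G (tube 0 1 (1 / (4 * K))) →
      (∀ z ∈ tube 0 1 (1 / (4 * K)), ‖G z‖ ≤ 2 * A) →
      ∀ z ∈ tube 0 1 ρ, ‖deriv G z‖ ≤ 16 * A * K := by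
    intro G hG hG2 z hz
    have := norm_deriv_le_of_tube (F := G) (a := 0) (c := 1) (δ := 1 / (8 * K)) (s := 1 / (8 * K))
      (M := 2 * A) (by positivity) (by rw [hsplit]; exact hG) (by rw [hsplit]; exact hG2) (hsub hz)
    refine this.trans (le_of_eq ?_)
    field_simp; norm_num
  have h2A : 2 * A ≤ 16 * A * K := by nlinarith
  have hBz : ∀ z ∈ tube 0 1 ρ, ∃ x ∈ Icc (0 : ℝ) 1, ‖B z - (bb x : ℝ)‖ ≤ β / 8 := by
    rintro z ⟨x, hx, hzx⟩
    refine ⟨x, hx, ?_⟩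
    have := norm_sub_le_of_tube hρ (hB.mono hsub') (hder hB hB2) hx hzx
    rw [hBx x hx] at this
    exact (this.trans (mul_le_mul_of_nonneg_left hzx.le (by positivity))).trans hρβ
  refine ⟨B, R, F, ρ, ⟨by linarith, hγ, hβ, by nlinarith, hρ, hB.mono hsub', hR.mono hsub',
    hF.mono hsub', fun z hz => (hB2 z (hsub' hz)).trans h2A,
    fun z hz => (hR2 z (hsub' hz)).trans h2A, fun z hz => (hF2 z (hsub' hz)).trans h2A, hder hB hB2,
    ?_, ?_, ?_, hBx, hRx, hFx⟩⟩
  · intro z hz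
    obtain ⟨x, hx, h⟩ := hBz z hz
    have h1 := (abs_le.1 ((Complex.abs_re_le_norm _).trans h)).1
    rw [Complex.sub_re, Complex.ofReal_re] at h1
    linarith [d.hbβ x hx]
  · intro z hz
    obtain ⟨x, hx, h⟩ := hBz z hz
    have h1 := (abs_le.1 ((Complex.abs_re_le_norm _).trans h)).1
    have h2 := abs_le.1 ((Complex.abs_im_le_norm _).trans h)
    rw [Complex.sub_re, Complex.ofReal_re] at h1
    rw [Complex.sub_im, Complex.ofReal_im, sub_zero] at h2
    have h3 := d.hbβ x hx
    rw [sq (B z), Complex.mul_re]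
    have h4 : (7 / 8 * β) ^ 2 ≤ (B z).re ^ 2 := pow_le_pow_left₀ (by positivity) (by linarith) 2
    have h5 : (B z).im ^ 2 ≤ (β / 8) ^ 2 := sq_le_sq' (by linarith) (by linarith)
    nlinarith
  · rintro z ⟨x, hx, hzx⟩
    have := norm_sub_le_of_tube hρ (hR.mono hsub') (hder hR hR2) hx hzx
    rw [hRx x hx] at this
    have h := (this.trans (mul_le_mul_of_nonneg_left hzx.le (by positivity))).trans hργ
    have h1 := (abs_le.1 ((Complex.abs_re_le_norm _).trans h)).1
    rw [Complex.sub_re, Complex.ofReal_re] at h1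
    linarith [d.hrγ x hx]

/-- Holomorphic on `tube 0 1 r` and bounded there by `M`. -/
def HoloBound (s : ℂ → ℂ) (r M : ℝ) : Prop :=
  DifferentiableOn ℂ s (tube 0 1 r) ∧ ∀ z ∈ tube 0 1 r, ‖s z‖ ≤ M

lemma HoloBound.mono {s : ℂ → ℂ} {r r' M : ℝ} (h : HoloBound s r M) (hr : r' ≤ r) :
    HoloBound s r' M := ⟨h.1.mono (tube_mono hr), fun z hz => h.2 z (tube_mono hr hz)⟩

lemma HoloBound.deriv {s : ℂ → ℂ} {r τ M : ℝ} (hτ : 0 < τ) (h : HoloBound s (r + τ) M) :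
    HoloBound (deriv s) r (M / τ) :=
  ⟨(h.1.deriv (isOpen_tube _ _ _)).mono (tube_mono (by linarith)),
    fun _ hz => norm_deriv_le_of_tube hτ h.1 h.2 hz⟩

lemma HoloBound.differentiableAt {s : ℂ → ℂ} {r M : ℝ} (h : HoloBound s r M) {z : ℂ}
    (hz : z ∈ tube 0 1 r) : DifferentiableAt ℂ s z :=
  (h.1 z hz).differentiableAt ((isOpen_tube _ _ _).mem_nhds hz)

lemma HoloBound.sub_le {s t : ℂ → ℂ} {r M M' : ℝ} (h : HoloBound s r M) (h' : HoloBound t r M')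
    {e : ℝ} (he : ∀ z ∈ tube 0 1 r, ‖s z - t z‖ ≤ e) : HoloBound (fun z => s z - t z) r e :=
  ⟨h.1.sub h'.1, he⟩

/-- Iterating a map that loses `τ` of analyticity radius and contracts by `1/2` yields an almost
fixed point. -/
lemma exists_almost_fixed_point {Φ : (ℂ → ℂ) → ℂ → ℂ} {Bd τ ρ : ℝ} (hBd : 0 ≤ Bd) (hτ : 0 < τ)
    (hτρ : 2 * τ ≤ ρ)
    (H1 : ∀ r s, 0 < r → r + τ ≤ ρ → HoloBound s (r + τ) Bd → HoloBound (Φ s) r Bd)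
    (H2 : ∀ r s t e, 0 < r → r + τ ≤ ρ → HoloBound s (r + τ) Bd → HoloBound t (r + τ) Bd →
      (∀ z ∈ tube 0 1 (r + τ), ‖s z - t z‖ ≤ e) → ∀ z ∈ tube 0 1 r, ‖Φ s z - Φ t z‖ ≤ e / 2) :
    ∃ S, HoloBound S (ρ / 2 + τ) Bd ∧ HoloBound (Φ S) (ρ / 2) Bd ∧
      ∀ z ∈ tube 0 1 (ρ / 2), ‖S z - Φ S z‖ ≤ 4 * Bd * Real.exp (-(ρ / (4 * τ))) := by
  have hρ : 0 < ρ := by linarith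
  set it : ℕ → ℂ → ℂ := fun k => Φ^[k] (fun _ => 0) with hit
  have hsucc : ∀ k, it (k + 1) = Φ (it k) := fun k => Function.iterate_succ_apply' _ _ _
  have hb : ∀ k : ℕ, 0 < ρ - k * τ → HoloBound (it k) (ρ - k * τ) Bd := by
    intro k
    induction k with
    | zero =>
      intro _
      exact ⟨differentiableOn_const _, fun z _ => by simpa [hit] using hBd⟩
    | succ k ih =>
      intro h
      rw [hsucc]
      have e : ρ - ((k + 1 : ℕ) : ℝ) * τ + τ = ρ - k * τ := by push_cast; ring
      have hk : 0 ≤ (k : ℝ) * τ := by positivity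
      exact H1 _ _ h (by rw [e]; linarith) (by rw [e]; exact ih (by linarith))
  have hd : ∀ k : ℕ, 0 < ρ - (k + 1 : ℕ) * τ → ∀ z ∈ tube 0 1 (ρ - (k + 1 : ℕ) * τ),
      ‖it k z - it (k + 1) z‖ ≤ Bd * (1 / 2) ^ k := by
    intro k
    induction k with
    | zero =>
      intro h z hz
      have := (hb 1 h).2 z hz
      simpa [hit] using this
    | succ k ih =>
      intro h z hz
      have e : ρ - ((k + 1 + 1 : ℕ) : ℝ) * τ + τ = ρ - (k + 1 : ℕ) * τ := by push_cast; ring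
      have hk : 0 ≤ ((k + 1 : ℕ) : ℝ) * τ := by positivity
      have hk' : (k : ℝ) * τ ≤ ((k + 1 : ℕ) : ℝ) * τ := by push_cast; linarith
      have hpos : 0 < ρ - (k + 1 : ℕ) * τ := by linarith
      have := H2 _ (it k) (it (k + 1)) (Bd * (1 / 2) ^ k) h (by rw [e]; linarith)
        (by rw [e]; exact (hb k (by linarith)).mono (by linarith)) (by rw [e]; exact hb _ hpos)
        (by rw [e]; exact ih hpos) z hz
      rw [hsucc, hsucc (k + 1)]
      refine this.trans (le_of_eq ?_)
      rw [pow_succ]; ring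
  obtain ⟨M, hM⟩ : ∃ M : ℕ, ⌊ρ / (2 * τ)⌋₊ = M + 1 := by
    refine Nat.exists_eq_succ_of_ne_zero (Nat.pos_iff_ne_zero.1 ?_)
    rw [Nat.floor_pos, le_div_iff₀ (by positivity)]; linarith
  have hM1 : ((M + 1 : ℕ) : ℝ) * τ ≤ ρ / 2 := by
    have := Nat.floor_le (by positivity : 0 ≤ ρ / (2 * τ))
    rw [hM, le_div_iff₀ (by positivity)] at this
    linarith
  have hM2 : ρ / (2 * τ) ≤ M + 2 := by
    have := (Nat.lt_floor_add_one (ρ / (2 * τ))).le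
    rw [hM] at this; push_cast at this; linarith
  have hM0 : (M : ℝ) * τ ≤ ((M + 1 : ℕ) : ℝ) * τ := by push_cast; linarith
  have hM3 : ((M + 1 : ℕ) : ℝ) * τ = M * τ + τ := by push_cast; ring
  have hS := (hb M (by linarith)).mono (by linarith : ρ / 2 + τ ≤ _)
  have hS' := (hb (M + 1) (by linarith)).mono (by linarith : ρ / 2 ≤ _)
  refine ⟨it M, hS, by rw [← hsucc]; exact hS', fun z hz => ?_⟩
  rw [← hsucc]
  refine (hd M (by linarith) z (tube_mono (by linarith) hz)).trans ?_
  have h2 : (1 / 2 : ℝ) ^ M ≤ 4 * Real.exp (-(ρ / (4 * τ))) := by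
    have e1 : (1 / 2 : ℝ) ^ M = 4 * Real.exp (-(Real.log 2 * (M + 2))) := by
      have : Real.exp (-(Real.log 2 * (M + 2))) = (1 / 2) ^ (M + 2) := by
        rw [← neg_mul, mul_comm]
        have : ((M : ℝ) + 2) = ((M + 2 : ℕ) : ℝ) := by push_cast; ring
        rw [this, Real.exp_nat_mul, Real.exp_neg, Real.exp_log two_pos, one_div]
      rw [this, pow_add]; norm_num; ring
    rw [e1]
    have hlog := Real.log_two_gt_d9
    have hlog' : 1 / 2 ≤ Real.log 2 := by linarith
    have e2 : ρ / (4 * τ) = 1 / 2 * (ρ / (2 * τ)) := by field_simp; norm_num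
    have : ρ / (4 * τ) ≤ Real.log 2 * (M + 2) := by
      rw [e2]; exact mul_le_mul hlog' hM2 (by positivity) (by linarith)
    gcongr
  calc _ ≤ Bd * (4 * Real.exp (-(ρ / (4 * τ)))) := mul_le_mul_of_nonneg_left h2 hBd
    _ = _ := by ring

/-- The smooth part of the solution: an almost solution of the differential equation that is
bounded on a fixed complex neighbourhood. -/
lemma exists_smooth_part {B R F : ℂ → ℂ} {bb rr ff : ℝ → ℝ} {Λ γ β ρ : ℝ}
    (h : HoloData B R F bb rr ff Λ γ β ρ) {c ε δ : ℝ} (hc : 0 < c)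
    (hcγ : c * (Λ + 4 * c) ≤ γ / 4) (hε : 0 < ε) (hερ : 2 * ε ≤ c * ρ) (hδ : 0 < δ) (hδ1 : δ ≤ 1) :
    ∃ U, HoloBound U (ρ / 2) (4 * Λ / γ) ∧ ∀ z ∈ tube 0 1 (ρ / 2),
      ‖-(δ * ε ^ 2 : ℝ) * deriv (deriv U) z + ε * B z * deriv U z + R z * U z - F z‖
        ≤ 16 * Λ ^ 2 / γ * Real.exp (-(c * ρ / (4 * ε))) := by
  have hΛ := h.hΛ
  have hγ := h.hγ
  set τ := ε / c with hτdef
  have hτ : 0 < τ := by positivity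
  have hRne : ∀ z ∈ tube 0 1 ρ, R z ≠ 0 := fun z hz h0 => by
    have := h.R_re z hz
    rw [h0, Complex.zero_re] at this; linarith
  have hRinv : ∀ z ∈ tube 0 1 ρ, ‖(R z)⁻¹‖ ≤ 2 / γ := fun z hz => by
    rw [norm_inv, inv_le_comm₀ (norm_pos_iff.2 (hRne z hz)) (by positivity), inv_div]
    exact (h.R_re z hz).trans (Complex.re_le_norm _)
  set Φ : (ℂ → ℂ) → ℂ → ℂ := fun s z =>
    (F z - ε * B z * deriv s z + (δ * ε ^ 2 : ℝ) * deriv (deriv s) z) * (R z)⁻¹ with hΦ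
  have hdd : ∀ {r M : ℝ} {s : ℂ → ℂ}, 0 ≤ M → HoloBound s (r + τ) M →
      ∀ z ∈ tube 0 1 r, r + τ ≤ ρ →
      ‖-(ε * B z * deriv s z) + (δ * ε ^ 2 : ℝ) * deriv (deriv s) z‖ ≤ M * (γ / 4) := by
    intro r M s hM hs z hz hr
    have hs' : HoloBound s (r + τ / 2 + τ / 2) M := by
      have : r + τ / 2 + τ / 2 = r + τ := by ring
      rwa [this]
    have h1 := (hs.deriv hτ).2 z hz
    have h2 := ((hs'.deriv (half_pos hτ)).deriv (half_pos hτ)).2 z hz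
    have hBz := h.B_le z (tube_mono (by linarith) hz)
    refine (norm_add_le _ _).trans ?_
    rw [norm_neg, norm_mul, norm_mul, norm_mul, Complex.norm_real, Complex.norm_real,
      Real.norm_of_nonneg hε.le, Real.norm_of_nonneg (by positivity : 0 ≤ δ * ε ^ 2)]
    have h3 : ε * ‖B z‖ * ‖deriv s z‖ ≤ ε * Λ * (M / τ) := by gcongr
    have h4 : δ * ε ^ 2 * ‖deriv (deriv s) z‖ ≤ 1 * ε ^ 2 * (M / (τ / 2) / (τ / 2)) := by gcongr
    have e : ε * Λ * (M / τ) + 1 * ε ^ 2 * (M / (τ / 2) / (τ / 2)) = M * (c * (Λ + 4 * c)) := by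
      rw [hτdef]; field_simp; ring
    have := mul_le_mul_of_nonneg_left hcγ hM
    linarith
  obtain ⟨U, hU, hΦU, hd⟩ := exists_almost_fixed_point (Φ := Φ) (Bd := 4 * Λ / γ) (τ := τ) (ρ := ρ)
    (by positivity) hτ (by rw [hτdef, ← mul_div_assoc, div_le_iff₀ hc]; linarith)
    (by
      intro r s hr hrρ hs
      have hsub : tube 0 1 r ⊆ tube 0 1 ρ := tube_mono (by linarith)
      refine ⟨?_, fun z hz => ?_⟩
      · have d1 := (hs.deriv hτ).1
        have d2 := ((hs.1.deriv (isOpen_tube _ _ _)).deriv (isOpen_tube _ _ _)).mono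
          (tube_mono (by linarith) : tube 0 1 r ⊆ _)
        have d3 := h.hF.mono hsub
        have d4 := h.hB.mono hsub
        have d5 := (h.hR.mono hsub).fun_inv (fun z hz => hRne z (hsub hz))
        exact (((d3.sub ((d4.const_mul _).mul d1)).add (d2.const_mul _)).mul d5)
      · have h1 := hdd (by positivity) hs z hz hrρ
        have h2 := h.F_le z (hsub hz)
        have h3 := hRinv z (hsub hz)
        have e : F z - ε * B z * deriv s z + (δ * ε ^ 2 : ℝ) * deriv (deriv s) z
          = F z + (-(ε * B z * deriv s z) + (δ * ε ^ 2 : ℝ) * deriv (deriv s) z) := by ring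
        simp only [hΦ]
        rw [e, norm_mul]
        have h4 : 4 * Λ / γ * (γ / 4) = Λ := by field_simp
        calc _ ≤ (Λ + Λ) * (2 / γ) := by
              refine mul_le_mul ((norm_add_le _ _).trans ?_) h3 (norm_nonneg _) (by linarith)
              linarith
          _ = _ := by ring)
    (by
      intro r s t e hr hrρ hs ht he z hz
      have hsub : tube 0 1 r ⊆ tube 0 1 ρ := tube_mono (by linarith)
      have he0 : 0 ≤ e := (norm_nonneg _).trans (he z (tube_mono (by linarith) hz))
      have hst := hs.sub_le ht he
      have h1 := hdd he0 hst z hz hrρ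
      have hopen := isOpen_tube 0 1 (r + τ)
      have hz' : z ∈ tube 0 1 (r + τ) := tube_mono (by linarith) hz
      have e1 : ∀ w ∈ tube 0 1 (r + τ),
          deriv (fun z => s z - t z) w = deriv s w - deriv t w := fun w hw =>
        deriv_fun_sub (hs.differentiableAt hw) (ht.differentiableAt hw)
      have e2 : deriv (deriv fun z => s z - t z) z = deriv (deriv s) z - deriv (deriv t) z := by
        rw [Filter.EventuallyEq.deriv_eq (Filter.eventuallyEq_of_mem (hopen.mem_nhds hz') e1)]
        exact deriv_fun_sub
          ((hs.1.deriv hopen z hz').differentiableAt (hopen.mem_nhds hz'))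
          ((ht.1.deriv hopen z hz').differentiableAt (hopen.mem_nhds hz'))
      rw [e1 z hz', e2] at h1
      have e3 : Φ s z - Φ t z = (-(ε * B z * (deriv s z - deriv t z))
          + (δ * ε ^ 2 : ℝ) * (deriv (deriv s) z - deriv (deriv t) z)) * (R z)⁻¹ := by
        simp only [hΦ]; ring
      rw [e3, norm_mul]
      calc _ ≤ e * (γ / 4) * (2 / γ) :=
            mul_le_mul h1 (hRinv z (hsub hz)) (norm_nonneg _) (by positivity)
        _ = _ := by field_simp; ring)
  refine ⟨U, hU.mono (by linarith), fun z hz => ?_⟩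
  have hzρ : z ∈ tube 0 1 ρ := tube_mono (by linarith [h.hρ]) hz
  have hne := hRne z hzρ
  have e : -(δ * ε ^ 2 : ℝ) * deriv (deriv U) z + ε * B z * deriv U z + R z * U z - F z
      = R z * (U z - Φ U z) := by
    simp only [hΦ]; field_simp; ring
  rw [e, norm_mul]
  have hexp : ρ / (4 * τ) = c * ρ / (4 * ε) := by rw [hτdef]; field_simp
  have := hd z hz
  rw [hexp] at this
  calc _ ≤ Λ * (4 * (4 * Λ / γ) * Real.exp (-(c * ρ / (4 * ε)))) :=
        mul_le_mul (h.R_le z hzρ) this (norm_nonneg _) (by linarith)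
    _ = _ := by ring

/-- The principal branch of the square root. -/
def csqrt (z : ℂ) : ℂ := Complex.exp (Complex.log z / 2)

lemma csqrt_sq {z : ℂ} (hz : z ≠ 0) : csqrt z ^ 2 = z := by
  rw [csqrt, ← Complex.exp_nat_mul]
  push_cast
  rw [mul_div_cancel₀ _ two_ne_zero, Complex.exp_log hz]

lemma differentiableAt_csqrt {z : ℂ} (hz : z ∈ Complex.slitPlane) :
    DifferentiableAt ℂ csqrt z :=
  ((Complex.differentiableAt_log hz).div_const 2).cexp

lemma le_csqrt_re {z : ℂ} {b : ℝ} (hb : 0 < b) (hz : b ^ 2 ≤ z.re) : b ≤ (csqrt z).re := by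
  have hz0 : z ≠ 0 := fun h => by
    rw [h, Complex.zero_re] at hz; linarith [pow_pos hb 2]
  have hpos : 0 ≤ (csqrt z).re := by
    rw [csqrt, Complex.exp_re]
    refine mul_nonneg (Real.exp_pos _).le (Real.cos_nonneg_of_mem_Icc ?_)
    have h1 : (Complex.log z / 2).im = Complex.arg z / 2 := by
      have := Complex.div_ofReal_im (Complex.log z) 2
      rw [Complex.log_im] at this
      exact_mod_cast this
    rw [h1]
    have h2 := Complex.neg_pi_lt_arg z
    have h3 := Complex.arg_le_pi z
    constructor <;> linarith
  have h1 : (csqrt z).re ^ 2 - (csqrt z).im ^ 2 = z.re := by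
    have := congrArg Complex.re (csqrt_sq hz0)
    rw [sq, Complex.mul_re] at this
    linarith
  refine (sq_le_sq₀ hb.le hpos).1 ?_
  nlinarith [sq_nonneg (csqrt z).im]

lemma norm_csqrt_le {z : ℂ} {M : ℝ} (hz : z ≠ 0) (hM : 0 ≤ M) (h : ‖z‖ ≤ M ^ 2) :
    ‖csqrt z‖ ≤ M := by
  refine (sq_le_sq₀ (norm_nonneg _) hM).1 ?_
  rw [← norm_pow, csqrt_sq hz]; exact h

/-- Square roots with real part bounded below are Lipschitz functions of the radicand. -/
lemma norm_sub_le_of_sq {v w : ℂ} {b : ℝ} (hb : 0 < b) (hv : b ≤ v.re) (hw : b ≤ w.re) :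
    ‖v - w‖ ≤ ‖v ^ 2 - w ^ 2‖ / (2 * b) := by
  rw [le_div_iff₀ (by positivity), sq_sub_sq, norm_mul, mul_comm]
  refine mul_le_mul_of_nonneg_right ?_ (norm_nonneg _)
  have := Complex.re_le_norm (v + w)
  rw [Complex.add_re] at this
  linarith

set_option maxHeartbeats 1000000 in
/-- Almost solutions of the characteristic (Riccati) equation of the layer functions. -/
lemma exists_char_root {B R F : ℂ → ℂ} {bb rr ff : ℝ → ℝ} {Λ γ β ρ : ℝ}
    (h : HoloData B R F bb rr ff Λ γ β ρ) {c ε δ ς : ℝ} (hς : |ς| = 1) (hc : 0 < c)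
    (hcβ : 4 * c ≤ β) (hcΛ : 48 * Λ * c ≤ β ^ 2) (hε : 0 < ε) (hερ : 2 * ε ≤ c * ρ)
    (hεβ : 16 * Λ * ε ≤ β ^ 2) (hδ : 0 < δ) (hδ1 : δ ≤ 1) :
    ∃ S T, HoloBound S (ρ / 2) (3 * Λ) ∧ HoloBound T (ρ / 2) (3 * Λ) ∧
      ∀ z ∈ tube 0 1 (ρ / 2),
        T z ^ 2 = B z ^ 2 + (4 * δ : ℝ) * R z - (2 * δ * ε : ℝ) * (deriv B z + ς * deriv S z) ∧
        β / 2 ≤ (T z).re ∧ ‖S z - T z‖ ≤ 12 * Λ * Real.exp (-(c * ρ / (4 * ε))) := by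
  have hΛ := h.hΛ
  have hβ := h.hβ
  have hγ := h.hγ
  have hβΛ := h.hβΛ
  set τ := ε / c with hτdef
  have hτ : 0 < τ := by positivity
  have hςn : ‖(ς : ℂ)‖ = 1 := by rw [Complex.norm_real]; exact hς
  set N : (ℂ → ℂ) → ℂ → ℂ := fun s z =>
    B z ^ 2 + (4 * δ : ℝ) * R z - (2 * δ * ε : ℝ) * (deriv B z + ς * deriv s z) with hN
  have hsmall : ∀ {r M : ℝ} {s : ℂ → ℂ}, HoloBound s (r + τ) M → 0 ≤ M → ∀ z ∈ tube 0 1 r,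
      ‖((2 * δ * ε : ℝ) : ℂ) * (ς * deriv s z)‖ ≤ 2 * c * M := by
    intro r M s hs hM z hz
    have h1 := (hs.deriv hτ).2 z hz
    rw [norm_mul, norm_mul, hςn, one_mul, Complex.norm_real,
      Real.norm_of_nonneg (by positivity : 0 ≤ 2 * δ * ε)]
    calc 2 * δ * ε * ‖deriv s z‖ ≤ 2 * 1 * ε * (M / τ) := by gcongr
      _ = _ := by rw [hτdef]; field_simp
  have hkey : ∀ {r : ℝ} {s : ℂ → ℂ}, r + τ ≤ ρ → HoloBound s (r + τ) (3 * Λ) → ∀ z ∈ tube 0 1 r,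
      (β / 2) ^ 2 ≤ (N s z).re ∧ ‖N s z‖ ≤ (3 * Λ) ^ 2 := by
    intro r s hr hs z hz
    have hzρ : z ∈ tube 0 1 ρ := tube_mono (by linarith) hz
    have h1 := hsmall hs (by positivity) z hz
    have h2 : ‖((2 * δ * ε : ℝ) : ℂ) * deriv B z‖ ≤ 2 * ε * Λ := by
      rw [norm_mul, Complex.norm_real, Real.norm_of_nonneg (by positivity : 0 ≤ 2 * δ * ε)]
      have := h.B'_le z hzρ
      calc 2 * δ * ε * ‖deriv B z‖ ≤ 2 * 1 * ε * Λ := by gcongr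
        _ = _ := by ring
    have h3 : ‖((2 * δ * ε : ℝ) : ℂ) * (deriv B z + ς * deriv s z)‖ ≤ β ^ 2 / 4 := by
      rw [mul_add]
      refine (norm_add_le _ _).trans ?_
      linarith
    constructor
    · have h4 := Complex.re_le_norm (((2 * δ * ε : ℝ) : ℂ) * (deriv B z + ς * deriv s z))
      have h5 := h.Bsq_re z hzρ
      have h6 : 0 ≤ (((4 * δ : ℝ) : ℂ) * R z).re := by
        rw [Complex.re_ofReal_mul]
        have := h.R_re z hzρ
        exact mul_nonneg (by positivity) (by linarith)
      simp only [hN, Complex.sub_re, Complex.add_re]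
      nlinarith [sq_nonneg β]
    · have h5 : ‖B z ^ 2‖ ≤ Λ ^ 2 := by
        rw [norm_pow]; exact pow_le_pow_left₀ (norm_nonneg _) (h.B_le z hzρ) 2
      have h6 : ‖((4 * δ : ℝ) : ℂ) * R z‖ ≤ 4 * Λ := by
        rw [norm_mul, Complex.norm_real, Real.norm_of_nonneg (by positivity : 0 ≤ 4 * δ)]
        have := h.R_le z hzρ
        calc 4 * δ * ‖R z‖ ≤ 4 * 1 * Λ := by gcongr
          _ = _ := by ring
      refine (norm_sub_le _ _).trans ?_
      have := norm_add_le (B z ^ 2) (((4 * δ : ℝ) : ℂ) * R z)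
      have h7 : β ^ 2 ≤ Λ ^ 2 := pow_le_pow_left₀ hβ.le hβΛ 2
      have h8 : Λ ≤ Λ ^ 2 := le_self_pow₀ hΛ two_ne_zero
      have e9 : (3 * Λ) ^ 2 = 9 * Λ ^ 2 := by ring
      rw [e9]
      linarith
  have hne : ∀ {w : ℂ}, (β / 2) ^ 2 ≤ w.re → w ≠ 0 := by
    intro w hw h0
    rw [h0, Complex.zero_re] at hw
    have : 0 < (β / 2) ^ 2 := by positivity
    linarith
  have hslit : ∀ {w : ℂ}, (β / 2) ^ 2 ≤ w.re → w ∈ Complex.slitPlane := by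
    intro w hw
    have : 0 < (β / 2) ^ 2 := by positivity
    exact Or.inl (by linarith)
  obtain ⟨S, hS, hT, hd⟩ := exists_almost_fixed_point (Φ := fun s z => csqrt (N s z))
    (Bd := 3 * Λ) (τ := τ) (ρ := ρ)
    (by positivity) hτ (by rw [hτdef, ← mul_div_assoc, div_le_iff₀ hc]; linarith)
    (by
      intro r s hr hrρ hs
      have hsub : tube 0 1 r ⊆ tube 0 1 ρ := tube_mono (by linarith)
      refine ⟨fun z hz => ?_, fun z hz => ?_⟩
      · have d1 := (hs.deriv hτ).1
        have d2 := h.hB.mono hsub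
        have d3 := h.hR.mono hsub
        have d4 := (h.hB.deriv (isOpen_tube _ _ _)).mono hsub
        have dN : DifferentiableOn ℂ (N s) (tube 0 1 r) :=
          ((d2.pow 2).add (d3.const_mul _)).sub ((d4.add (d1.const_mul _)).const_mul _)
        exact (differentiableAt_csqrt (hslit (hkey hrρ hs z hz).1)).comp_differentiableWithinAt z
          (dN z hz)
      · obtain ⟨k1, k2⟩ := hkey hrρ hs z hz
        exact norm_csqrt_le (hne k1) (by positivity) k2)
    (by
      intro r s t e hr hrρ hs ht he z hz
      have he0 : 0 ≤ e := (norm_nonneg _).trans (he z (tube_mono (by linarith) hz))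
      obtain ⟨k1, -⟩ := hkey hrρ hs z hz
      obtain ⟨k2, -⟩ := hkey hrρ ht z hz
      have hz' : z ∈ tube 0 1 (r + τ) := tube_mono (by linarith) hz
      have h1 := hsmall (hs.sub_le ht he) he0 z hz
      rw [deriv_fun_sub (hs.differentiableAt hz') (ht.differentiableAt hz')] at h1
      have e1 : N s z - N t z = -((2 * δ * ε : ℝ) * (ς * (deriv s z - deriv t z))) := by
        simp only [hN]; ring
      refine (norm_sub_le_of_sq (half_pos hβ) (le_csqrt_re (half_pos hβ) k1)
        (le_csqrt_re (half_pos hβ) k2)).trans ?_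
      rw [csqrt_sq (hne k1), csqrt_sq (hne k2), e1, norm_neg, div_le_iff₀ (by positivity)]
      have : 4 * c * e ≤ β * e := mul_le_mul_of_nonneg_right hcβ he0
      linarith)
  have hτρ : τ ≤ ρ / 2 := by rw [hτdef, div_le_iff₀ hc]; linarith
  refine ⟨S, _, hS.mono (by linarith), hT, fun z hz => ?_⟩
  obtain ⟨k, -⟩ := hkey (by linarith) hS z hz
  refine ⟨csqrt_sq (hne k), le_csqrt_re (half_pos hβ) k, (hd z hz).trans (le_of_eq ?_)⟩
  have hexp : ρ / (4 * τ) = c * ρ / (4 * ε) := by rw [hτdef]; field_simp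
  rw [hexp]; ring

lemma mul_sub_le_of_hasDerivAt {f f' : ℝ → ℝ} {l : ℝ}
    (hf : ∀ x ∈ Icc (0 : ℝ) 1, HasDerivAt f (f' x) x) (hl : ∀ x ∈ Icc (0 : ℝ) 1, l ≤ f' x)
    {x y : ℝ} (hx : x ∈ Icc (0 : ℝ) 1) (hy : y ∈ Icc (0 : ℝ) 1) (hxy : x ≤ y) :
    l * (y - x) ≤ f y - f x := by
  refine Convex.mul_sub_le_image_sub_of_le_deriv (convex_Icc 0 1)
    (fun t ht => (hf t ht).continuousAt.continuousWithinAt)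
    (fun t ht => (hf t (interior_subset ht)).differentiableAt.differentiableWithinAt)
    (fun t ht => ?_) x hx y hy hxy
  rw [(hf t (interior_subset ht)).deriv]
  exact hl t (interior_subset ht)

/-- A layer function of `-ε₁ E'' + ε₂ B E' + R E` at the endpoint `x₀`: it decays like
`exp (-l |x - x₀|)`, grows in the complex plane at most like `exp (L |z - x|)`, and solves the
homogeneous equation up to `res`. -/
structure LayerFun (E B R : ℂ → ℂ) (ε₁ ε₂ x₀ l L r res : ℝ) : Prop where
  diff : DifferentiableOn ℂ E (tube 0 1 r)
  one : E x₀ = 1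
  growth : ∀ x ∈ Icc (0 : ℝ) 1, ∀ z : ℂ, ‖z - x‖ < r →
    ‖E z‖ ≤ Real.exp (-(l * |x - x₀|)) * Real.exp (L * ‖z - x‖)
  deriv_le : ∀ x ∈ Icc (0 : ℝ) 1, ‖deriv E x‖ ≤ L * Real.exp (-(l * |x - x₀|))
  residual : ∀ x ∈ Icc (0 : ℝ) 1,
    ‖-(ε₁ : ℂ) * deriv (deriv E) x + ε₂ * B x * deriv E x + R x * E x‖ ≤ res

lemma LayerFun.norm_le {E B R : ℂ → ℂ} {ε₁ ε₂ x₀ l L r res : ℝ}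
    (h : LayerFun E B R ε₁ ε₂ x₀ l L r res) (hr : 0 < r) {x : ℝ} (hx : x ∈ Icc (0 : ℝ) 1) :
    ‖E x‖ ≤ Real.exp (-(l * |x - x₀|)) := by
  simpa using h.growth x hx x (by simpa using hr)

/-- The exponential of a primitive of `lam` is a layer function. -/
lemma layerFun_of_exponent {lam B R D : ℂ → ℂ} {ε₁ ε₂ x₀ l L r res ς : ℝ} (hr : 0 < r)
    (hl0 : 0 ≤ l) (hς : (ς = -1 ∧ x₀ = 0) ∨ (ς = 1 ∧ x₀ = 1))
    (hlam : HoloBound lam r L) (hl : ∀ x ∈ Icc (0 : ℝ) 1, l ≤ ς * (lam x).re)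
    (hD : ∀ x ∈ Icc (0 : ℝ) 1,
      -(ε₁ : ℂ) * (deriv lam x + lam x ^ 2) + ε₂ * B x * lam x + R x = D x)
    (hDres : ∀ x ∈ Icc (0 : ℝ) 1, ‖D x‖ ≤ res) :
    ∃ E, LayerFun E B R ε₁ ε₂ x₀ l L r res := by
  obtain ⟨g, hg⟩ := (convex_tube 0 1 r).exists_forall_hasDerivWithinAt hlam.1
  have hopen := isOpen_tube 0 1 r
  have hg' : ∀ z ∈ tube 0 1 r, HasDerivAt g (lam z) z := fun z hz =>
    (hg z hz).hasDerivAt (hopen.mem_nhds hz)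
  have hgd : DifferentiableOn ℂ g (tube 0 1 r) := fun z hz =>
    (hg' z hz).differentiableAt.differentiableWithinAt
  set E : ℂ → ℂ := fun z => Complex.exp (g z - g x₀) with hE
  have hE' : ∀ z ∈ tube 0 1 r, HasDerivAt E (lam z * E z) z := fun z hz => by
    have := ((hg' z hz).sub_const (g x₀)).cexp
    rwa [mul_comm] at this
  have hreal : ∀ x ∈ Icc (0 : ℝ) 1, (x : ℂ) ∈ tube 0 1 r := fun x hx => ofReal_mem_tube hr hx
  have hdecay : ∀ x ∈ Icc (0 : ℝ) 1, (g x - g x₀).re ≤ -(l * |x - x₀|) := by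
    intro x hx
    have hre : ∀ y ∈ Icc (0 : ℝ) 1, HasDerivAt (fun t : ℝ => ς * (g t).re) (ς * (lam y).re) y := by
      intro y hy
      have := hasDerivAt_re hopen hgd (hreal y hy)
      rw [(hg' y (hreal y hy)).deriv] at this
      exact this.const_mul ς
    rw [Complex.sub_re]
    rcases hς with ⟨rfl, rfl⟩ | ⟨rfl, rfl⟩
    · have := mul_sub_le_of_hasDerivAt hre hl (left_mem_Icc.2 zero_le_one) hx hx.1
      rw [sub_zero] at *
      rw [abs_of_nonneg hx.1]
      linarith
    · have := mul_sub_le_of_hasDerivAt hre hl hx (right_mem_Icc.2 zero_le_one) hx.2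
      rw [abs_sub_comm, abs_of_nonneg (by linarith [hx.2] : (0 : ℝ) ≤ 1 - x)]
      linarith
  have hgrowth : ∀ x ∈ Icc (0 : ℝ) 1, ∀ z : ℂ, ‖z - x‖ < r →
      ‖E z‖ ≤ Real.exp (-(l * |x - x₀|)) * Real.exp (L * ‖z - x‖) := by
    intro x hx z hz
    rw [hE, Complex.norm_exp, ← Real.exp_add, Real.exp_le_exp]
    have h1 := norm_sub_le_of_tube hr hgd (fun w hw => by rw [(hg' w hw).deriv]; exact hlam.2 w hw)
      hx hz
    have h2 := Complex.re_le_norm (g z - g x)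
    have h3 := hdecay x hx
    rw [Complex.sub_re] at *
    linarith
  have hdE : ∀ z ∈ tube 0 1 r, deriv E z = lam z * E z := fun z hz => (hE' z hz).deriv
  refine ⟨E, fun z hz => (hE' z hz).differentiableAt.differentiableWithinAt, by simp [hE], hgrowth,
    fun x hx => ?_, fun x hx => ?_⟩
  · rw [hdE x (hreal x hx), norm_mul]
    have h1 := hgrowth x hx x (by simpa using hr)
    rw [sub_self, norm_zero, mul_zero, Real.exp_zero, mul_one] at h1
    exact mul_le_mul (hlam.2 x (hreal x hx)) h1 (norm_nonneg _)
      ((norm_nonneg _).trans (hlam.2 x (hreal x hx)))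
  · have hx' := hreal x hx
    have h2 : deriv (deriv E) x = (deriv lam x + lam x ^ 2) * E x := by
      rw [Filter.EventuallyEq.deriv_eq (Filter.eventuallyEq_of_mem (hopen.mem_nhds hx') hdE)]
      rw [deriv_fun_mul (hlam.differentiableAt hx') (hE' x hx').differentiableAt, hdE x hx']
      ring
    rw [h2, hdE x hx']
    have e : -(ε₁ : ℂ) * ((deriv lam x + lam x ^ 2) * E x) + ε₂ * B x * (lam x * E x) + R x * E x
        = D x * E x := by rw [← hD x hx]; ring
    rw [e, norm_mul]
    have h1 := hgrowth x hx x (by simpa using hr)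
    rw [sub_self, norm_zero, mul_zero, Real.exp_zero, mul_one] at h1
    have h3 : ‖E x‖ ≤ 1 := h1.trans (Real.exp_le_one_iff.2 (by
      have := mul_nonneg hl0 (abs_nonneg (x - x₀)); linarith))
    exact (mul_le_of_le_one_right (norm_nonneg _) h3).trans (hDres x hx)

/-- Smallness requirements on `ε` and on the contraction parameter `c`. -/
structure SmallParam (Λ γ β ρ c ε : ℝ) : Prop where
  hc : 0 < c
  hε : 0 < ε
  hε1 : ε ≤ 1
  hcγ : c * (Λ + 4 * c) ≤ γ / 4
  hcβ : 4 * c ≤ β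
  hcΛ : 48 * Λ * c ≤ β ^ 2
  hερ : 2 * ε ≤ c * ρ
  hεβ : 16 * Λ * ε ≤ β ^ 2
  hεγ : ε * (Λ + 12 * Λ / ρ) ≤ γ * β ^ 2 / (32 * Λ ^ 2)

/-- The exponent of the layer function satisfies the Riccati equation up to a small error. -/
lemma riccati_residual {B R S T : ℂ → ℂ} {ε δ ς : ℝ} (hε : 0 < ε) (hδ : 0 < δ) (hς : ς ^ 2 = 1)
    {z : ℂ} (hB : DifferentiableAt ℂ B z) (hT : DifferentiableAt ℂ T z)
    (hsq : T z ^ 2 = B z ^ 2 + (4 * δ : ℝ) * R z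
      - (2 * δ * ε : ℝ) * (deriv B z + ς * deriv S z)) :
    -((δ * ε ^ 2 : ℝ) : ℂ) * (deriv (fun w => (B w + ς * T w) / (2 * δ * ε : ℝ)) z
        + ((B z + ς * T z) / (2 * δ * ε : ℝ)) ^ 2)
      + ε * B z * ((B z + ς * T z) / (2 * δ * ε : ℝ)) + R z
      = ς * ε / 2 * (deriv S z - deriv T z) := by
  have hd : deriv (fun w => (B w + ς * T w) / (2 * δ * ε : ℝ)) z
      = (deriv B z + ς * deriv T z) / (2 * δ * ε : ℝ) := by
    rw [deriv_div_const, deriv_fun_add hB (hT.const_mul _), deriv_const_mul _ hT]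
  rw [hd]
  have h1 : (ε : ℂ) ≠ 0 := by exact_mod_cast hε.ne'
  have h2 : (δ : ℂ) ≠ 0 := by exact_mod_cast hδ.ne'
  have h3 : (ς : ℂ) ^ 2 = 1 := by exact_mod_cast hς
  push_cast at hsq ⊢
  have e : (B z + ς * T z) ^ 2 = B z ^ 2 + 2 * ς * B z * T z + T z ^ 2 := by
    calc _ = B z ^ 2 + 2 * ς * B z * T z + ς ^ 2 * T z ^ 2 := by ring
      _ = _ := by rw [h3, one_mul]
  rw [div_pow, e, hsq]
  field_simp
  ring

set_option maxHeartbeats 1000000 in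
lemma exists_layers {B R F : ℂ → ℂ} {bb rr ff : ℝ → ℝ} {Λ γ β ρ c ε δ : ℝ}
    (h : HoloData B R F bb rr ff Λ γ β ρ) (hs : SmallParam Λ γ β ρ c ε) (hδ : 0 < δ)
    (hδ1 : δ ≤ 1) :
    (∃ E, LayerFun E B R (δ * ε ^ 2) ε 0 (γ * β / (32 * Λ ^ 2) / ε) (3 * Λ / β / ε) (ρ / 4)
      (24 * Λ / ρ * Real.exp (-(c * ρ / (4 * ε))))) ∧
    ∃ E, LayerFun E B R (δ * ε ^ 2) ε 1 (β / 2 / (δ * ε)) (2 * Λ / (δ * ε)) (ρ / 4)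
      (24 * Λ / ρ * Real.exp (-(c * ρ / (4 * ε)))) := by
  have hΛ := h.hΛ
  have hβ := h.hβ
  have hγ := h.hγ
  have hβΛ := h.hβΛ
  have hρ := h.hρ
  have hε := hs.hε
  have hsub : tube 0 1 (ρ / 4) ⊆ tube 0 1 (ρ / 2) := tube_mono (by linarith)
  have hsubρ : tube 0 1 (ρ / 4) ⊆ tube 0 1 ρ := tube_mono (by linarith)
  have h44 : ρ / 2 = ρ / 4 + ρ / 4 := by ring
  have hres : ∀ {ς : ℝ} {S T : ℂ → ℂ}, |ς| = 1 → HoloBound S (ρ / 2) (3 * Λ) →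
      HoloBound T (ρ / 2) (3 * Λ) → (∀ z ∈ tube 0 1 (ρ / 2),
        ‖S z - T z‖ ≤ 12 * Λ * Real.exp (-(c * ρ / (4 * ε)))) → ∀ x ∈ Icc (0 : ℝ) 1,
      ‖(ς : ℂ) * ε / 2 * (deriv S x - deriv T x)‖ ≤ 24 * Λ / ρ * Real.exp (-(c * ρ / (4 * ε))) := by
    intro ς S T hς hS hT hST x hx
    have hx' := ofReal_mem_tube (a := 0) (c := 1) (δ := ρ / 4) (by linarith) hx
    have h1 := hS.sub_le hT hST
    rw [h44] at h1
    have h2 := (h1.deriv (by linarith : 0 < ρ / 4)).2 x hx'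
    rw [deriv_fun_sub (hS.differentiableAt (hsub hx')) (hT.differentiableAt (hsub hx'))] at h2
    have h3 : ‖(ς : ℂ) * ε / 2‖ ≤ 1 / 2 := by
      rw [norm_div, norm_mul, Complex.norm_real, Complex.norm_real, Real.norm_eq_abs, hς, one_mul,
        Real.norm_of_nonneg hε.le, Complex.norm_ofNat]
      linarith [hs.hε1]
    rw [norm_mul]
    calc _ ≤ 1 / 2 * (12 * Λ * Real.exp (-(c * ρ / (4 * ε))) / (ρ / 4)) :=
          mul_le_mul h3 h2 (norm_nonneg _) (by norm_num)
      _ = _ := by field_simp; norm_num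
  have hn2 : ‖((2 * δ * ε : ℝ) : ℂ)‖ = 2 * δ * ε := by
    rw [Complex.norm_real, Real.norm_of_nonneg (by positivity)]
  have hlamd : ∀ {ς : ℝ} {T : ℂ → ℂ}, HoloBound T (ρ / 2) (3 * Λ) →
      DifferentiableOn ℂ (fun w => (B w + ς * T w) / (2 * δ * ε : ℝ)) (tube 0 1 (ρ / 4)) := by
    intro ς T hT
    exact ((h.hB.mono hsubρ).add ((hT.1.mono hsub).const_mul _)).div_const _
  have hBd : ∀ x ∈ Icc (0 : ℝ) 1, DifferentiableAt ℂ B x := fun x hx =>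
    (h.hB x (ofReal_mem_tube hρ hx)).differentiableAt
      ((isOpen_tube _ _ _).mem_nhds (ofReal_mem_tube hρ hx))
  have hmem2 : ∀ x ∈ Icc (0 : ℝ) 1, (x : ℂ) ∈ tube 0 1 (ρ / 2) := fun x hx =>
    ofReal_mem_tube (by linarith) hx
  have hmem4 : ∀ x ∈ Icc (0 : ℝ) 1, (x : ℂ) ∈ tube 0 1 (ρ / 4) := fun x hx =>
    ofReal_mem_tube (by linarith) hx
  constructor
  · obtain ⟨S, T, hS, hT, hST⟩ := exists_char_root h (ς := -1) (by simp) hs.hc hs.hcβ hs.hcΛ hε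
      hs.hερ hs.hεβ hδ hδ1
    set W : ℂ → ℂ := fun z => ε * (deriv B z - deriv S z) with hW
    have hWle : ∀ z ∈ tube 0 1 (ρ / 4), ‖W z‖ ≤ γ * β ^ 2 / (32 * Λ ^ 2) := by
      intro z hz
      have hS' := hS
      rw [h44] at hS'
      have h1 := (hS'.deriv (by linarith : 0 < ρ / 4)).2 z hz
      have h2 := h.B'_le z (hsubρ hz)
      rw [hW]
      simp only [norm_mul, Complex.norm_real, Real.norm_of_nonneg hε.le]
      refine le_trans (mul_le_mul_of_nonneg_left ((norm_sub_le _ _).trans (add_le_add h2 h1)) hε.le)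
        (le_trans (le_of_eq ?_) hs.hεγ)
      field_simp; norm_num
    have hv : ∀ z ∈ tube 0 1 (ρ / 4), β ≤ (B z + T z).re ∧ ‖B z + T z‖ ≤ 4 * Λ := by
      intro z hz
      have h1 := h.B_re z (hsubρ hz)
      have h2 := (hST z (hsub hz)).2.1
      have h3 := norm_add_le (B z) (T z)
      have h4 := h.B_le z (hsubρ hz)
      have h5 := hT.2 z (hsub hz)
      rw [Complex.add_re]
      constructor <;> linarith
    have hvne : ∀ z ∈ tube 0 1 (ρ / 4), B z + T z ≠ 0 := fun z hz h0 => by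
      have := (hv z hz).1
      rw [h0, Complex.zero_re] at this; linarith
    have hform : ∀ z ∈ tube 0 1 (ρ / 4), (B z + ((-1 : ℝ) : ℂ) * T z) / (2 * δ * ε : ℝ)
        = -((2 * R z - W z) / (B z + T z)) / ε := by
      intro z hz
      have h0 := hvne z hz
      have h1 : (ε : ℂ) ≠ 0 := by exact_mod_cast hε.ne'
      have h2 : (δ : ℂ) ≠ 0 := by exact_mod_cast hδ.ne'
      have h3 := (hST z (hsub hz)).1
      rw [hW]
      push_cast at h3 ⊢
      have key : (B z + -1 * T z) * (B z + T z)
          = -(2 * δ * (2 * R z - ε * (deriv B z - deriv S z))) := by linear_combination -h3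
      have e : B z + -1 * T z = -(2 * δ * (2 * R z - ε * (deriv B z - deriv S z))) / (B z + T z) := by
        rw [← key, mul_div_cancel_right₀ _ h0]
      rw [e]
      field_simp
    have hW0 : γ * β ^ 2 / (32 * Λ ^ 2) ≤ Λ := by
      have h0 : (0 : ℝ) ∈ Icc (0 : ℝ) 1 := by simp
      have h1 := (h.R_re 0 (by simpa using ofReal_mem_tube hρ h0)).trans
        ((Complex.re_le_norm _).trans (h.R_le 0 (by simpa using ofReal_mem_tube hρ h0)))
      have h2 : β ^ 2 ≤ Λ ^ 2 := pow_le_pow_left₀ hβ.le hβΛ 2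
      rw [div_le_iff₀ (by positivity)]
      have : γ * β ^ 2 ≤ 2 * Λ * Λ ^ 2 := mul_le_mul (by linarith) h2 (by positivity) (by positivity)
      have : 0 < Λ * Λ ^ 2 := by positivity
      linarith
    refine layerFun_of_exponent (ς := -1)
      (lam := fun w => (B w + ((-1 : ℝ) : ℂ) * T w) / (2 * δ * ε : ℝ))
      (D := fun x => ((-1 : ℝ) : ℂ) * ε / 2 * (deriv S x - deriv T x))
      (by linarith) (by positivity) (Or.inl ⟨rfl, rfl⟩) ⟨hlamd hT, fun z hz => ?_⟩ (fun x hx => ?_)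
      (fun x hx => ?_) (hres (by simp) hS hT (fun z hz => (hST z hz).2.2))
    · beta_reduce
      rw [hform z hz, norm_div, norm_neg, norm_div, Complex.norm_real, Real.norm_of_nonneg hε.le]
      have h1 : ‖2 * R z - W z‖ ≤ 3 * Λ := by
        refine (norm_sub_le _ _).trans ?_
        rw [norm_mul, Complex.norm_ofNat]
        linarith [h.R_le z (hsubρ hz), hWle z hz]
      have h2 : β ≤ ‖B z + T z‖ := (hv z hz).1.trans (Complex.re_le_norm _)
      gcongr
    · have hx' := hmem4 x hx
      rw [hform x hx']
      have h1 := (hv x hx').1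
      have h2 := (hv x hx').2
      have h3 := hWle x hx'
      have h4 := h.R_re x (hsubρ hx')
      set v := B x + T x with hvdef
      have hvn : 0 < ‖v‖ := norm_pos_iff.2 (hvne x hx')
      rw [h.R_real x hx] at h4 ⊢
      rw [Complex.ofReal_re] at h4
      have e1 : (-((2 * (rr x : ℂ) - W x) / v) / (ε : ℂ)).re
          = -(2 * rr x * (v⁻¹).re - (W x / v).re) / ε := by
        rw [Complex.div_ofReal_re, Complex.neg_re, sub_div, Complex.sub_re, div_eq_mul_inv (2 * (rr x : ℂ)) v]
        have : (2 * (rr x : ℂ) * v⁻¹).re = 2 * rr x * (v⁻¹).re := by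
          have : 2 * (rr x : ℂ) = ((2 * rr x : ℝ) : ℂ) := by push_cast; ring
          rw [this, Complex.re_ofReal_mul]
        rw [this]
      rw [e1]
      have e2 : β / (16 * Λ ^ 2) ≤ (v⁻¹).re := by
        rw [Complex.inv_re, Complex.normSq_eq_norm_sq]
        have : ‖v‖ ^ 2 ≤ (4 * Λ) ^ 2 := pow_le_pow_left₀ (norm_nonneg _) h2 2
        rw [div_le_div_iff₀ (by positivity) (by positivity)]
        have e3 : (4 * Λ) ^ 2 = 16 * Λ ^ 2 := by ring
        rw [e3] at this
        exact mul_le_mul h1 this (by positivity) (by linarith)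
      have e4 : (W x / v).re ≤ γ * β / (32 * Λ ^ 2) := by
        refine (Complex.re_le_norm _).trans ?_
        rw [norm_div]
        have h5 : β ≤ ‖v‖ := h1.trans (Complex.re_le_norm _)
        calc ‖W x‖ / ‖v‖ ≤ γ * β ^ 2 / (32 * Λ ^ 2) / β := by gcongr
          _ = _ := by field_simp
      have e5 : γ * (β / (16 * Λ ^ 2)) ≤ 2 * rr x * (v⁻¹).re :=
        mul_le_mul (by linarith) e2 (by positivity) (by linarith)
      have e6 : γ * (β / (16 * Λ ^ 2)) = 2 * (γ * β / (32 * Λ ^ 2)) := by field_simp; norm_num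
      rw [← mul_div_assoc]
      gcongr
      linarith
    · exact riccati_residual hε hδ (by norm_num) (hBd x hx) (hT.differentiableAt (hmem2 x hx))
        (hST x (hmem2 x hx)).1
  · obtain ⟨S, T, hS, hT, hST⟩ := exists_char_root h (ς := 1) (by simp) hs.hc hs.hcβ hs.hcΛ hε
      hs.hερ hs.hεβ hδ hδ1
    refine layerFun_of_exponent (ς := 1)
      (lam := fun w => (B w + ((1 : ℝ) : ℂ) * T w) / (2 * δ * ε : ℝ))
      (D := fun x => ((1 : ℝ) : ℂ) * ε / 2 * (deriv S x - deriv T x))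
      (by linarith) (by positivity) (Or.inr ⟨rfl, rfl⟩) ⟨hlamd hT, fun z hz => ?_⟩ (fun x hx => ?_)
      (fun x hx => ?_) (hres (by simp) hS hT (fun z hz => (hST z hz).2.2))
    · rw [norm_div, hn2, Complex.ofReal_one, one_mul, div_le_div_iff₀ (by positivity) (by positivity)]
      have h3 := norm_add_le (B z) (T z)
      have h4 := h.B_le z (hsubρ hz)
      have h5 := hT.2 z (hsub hz)
      calc ‖B z + T z‖ * (δ * ε) ≤ (4 * Λ) * (δ * ε) := by gcongr; linarith
        _ = _ := by ring
    · rw [one_mul, Complex.ofReal_one, one_mul, Complex.div_ofReal_re, Complex.add_re]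
      have h1 := h.B_re x (hsubρ (hmem4 x hx))
      have h2 := (hST x (hmem2 x hx)).2.1
      rw [div_le_div_iff₀ (by positivity) (by positivity)]
      calc β / 2 * (2 * δ * ε) = β * (δ * ε) := by ring
        _ ≤ _ := by gcongr; linarith
    · exact riccati_residual hε hδ (by norm_num) (hBd x hx) (hT.differentiableAt (hmem2 x hx))
        (hST x (hmem2 x hx)).1

lemma integral_sq_le_of_abs_le {f : ℝ → ℝ} {a c M : ℝ} (hac : a ≤ c)
    (hf : ContinuousOn f (Icc a c)) (hM : ∀ x ∈ Icc a c, |f x| ≤ M) :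
    (∫ t in a..c, f t ^ 2) ≤ M ^ 2 * (c - a) := by
  have hi : IntervalIntegrable (fun t => f t ^ 2) volume a c :=
    intervalIntegrable_of_continuousOn_Icc hac (hf.pow 2)
  have h := intervalIntegral.integral_mono_on hac hi
    (intervalIntegrable_const (c := M ^ 2)) (fun x hx => by
      rw [← sq_abs]; exact pow_le_pow_left₀ (abs_nonneg _) (hM x hx) 2)
  rwa [intervalIntegral.integral_const, smul_eq_mul, mul_comm] at h

lemma integral_sq_le_of_decay {f : ℝ → ℝ} {a c x₀ M k : ℝ} (hk : 0 < k) (hac : a ≤ c)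
    (hc : c ≤ x₀) (hf : ContinuousOn f (Icc a c))
    (hM : ∀ x ∈ Icc a c, |f x| ≤ M * Real.exp (-(k * (x₀ - x)))) :
    (∫ t in a..c, f t ^ 2) ≤ M ^ 2 / (2 * k) := by
  set F : ℝ → ℝ := fun t => M ^ 2 / (2 * k) * Real.exp (-(2 * k * (x₀ - t))) with hF
  have hd : ∀ t, HasDerivAt F (M ^ 2 * Real.exp (-(2 * k * (x₀ - t)))) t := by
    intro t
    have h1 : HasDerivAt (fun t : ℝ => -(2 * k * (x₀ - t))) (2 * k) t := by
      have := ((((hasDerivAt_id t).const_sub x₀).const_mul (2 * k))).fun_neg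
      simpa using this
    have h2 := h1.exp.const_mul (M ^ 2 / (2 * k))
    have e : M ^ 2 * Real.exp (-(2 * k * (x₀ - t)))
        = M ^ 2 / (2 * k) * (Real.exp (-(2 * k * (x₀ - t))) * (2 * k)) := by field_simp
    rw [e]
    exact h2
  have hcont : Continuous fun t : ℝ => M ^ 2 * Real.exp (-(2 * k * (x₀ - t))) := by fun_prop
  have hi : IntervalIntegrable (fun t => f t ^ 2) volume a c :=
    intervalIntegrable_of_continuousOn_Icc hac (hf.pow 2)
  have h := intervalIntegral.integral_mono_on hac hi
    (hcont.intervalIntegrable a c) (fun x hx => by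
      have := pow_le_pow_left₀ (abs_nonneg _) (hM x hx) 2
      rw [sq_abs, mul_pow, ← Real.exp_nat_mul] at this
      have e : -(2 * k * (x₀ - x)) = (2 : ℕ) * -(k * (x₀ - x)) := by push_cast; ring
      rw [e]
      exact this)
  rw [intervalIntegral.integral_eq_sub_of_hasDerivAt (fun t _ => hd t)
    (hcont.intervalIntegrable a c)] at h
  have h1 : 0 ≤ F a := by positivity
  have h2 : F c ≤ M ^ 2 / (2 * k) := by
    refine mul_le_of_le_one_right (by positivity) (Real.exp_le_one_iff.2 ?_)
    have : 0 ≤ 2 * k * (x₀ - c) := mul_nonneg (by linarith) (by linarith)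
    linarith
  linarith

lemma mul_exp_neg_le {k w : ℝ} (hk : 0 < k) : w * Real.exp (-(k * w)) ^ 2 ≤ 1 / (2 * k) := by
  rw [← Real.exp_nat_mul]
  push_cast
  have h1 := Real.add_one_le_exp (2 * k * w)
  have h2 : Real.exp (2 * -(k * w)) = (Real.exp (2 * k * w))⁻¹ := by
    rw [← Real.exp_neg]; congr 1; ring
  rw [h2, ← div_eq_mul_inv, div_le_div_iff₀ (Real.exp_pos _) (by positivity)]
  linarith

/-- The abstract error estimate for a comparison function whose derivative error splits into a
part of size `Θ / ε₂` and a convective layer part. -/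
theorem wgError_of_split {N : ℕ} (m : Mesh N) {bb rr ff : ℝ → ℝ} {A K γ β ε₁ ε₂ Θ H : ℝ}
    (d : DataBounds bb rr ff A K γ β) (hε₁ : 0 < ε₁) (hε₂ : 0 < ε₂) (hε₁₂ : ε₁ ≤ ε₂ ^ 2)
    (hε₂' : ε₂ ≤ 1) (hΘ : 0 ≤ Θ) (hH : 0 ≤ H) {w w1 w2 g : ℝ → ℝ}
    (hw : ∀ x ∈ Icc (0 : ℝ) 1, HasDerivAt w (w1 x) x)
    (hw1 : ∀ x ∈ Icc (0 : ℝ) 1, HasDerivAt w1 (w2 x) x)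
    (hw2 : ContinuousOn w2 (Icc 0 1)) (hw0 : w 0 = 0) (hwe : w 1 = 0)
    (heq : ∀ x ∈ Icc (0 : ℝ) 1, -ε₁ * w2 x + ε₂ * bb x * w1 x + rr x * w x = ff x - g x)
    (hg : ∀ x ∈ Icc (0 : ℝ) 1, |g x| ≤ Θ) {p : ℕ} (hp : 1 ≤ p)
    {P : Fin N → Polynomial ℝ} (hPd : ∀ j, (P j).natDegree ≤ p) {Pb : Fin (N + 1) → ℝ}
    (hPr : ∀ j, (P j).eval (m.xr j) = Pb j.succ) (hPl : ∀ j, (P j).eval (m.xl j) = Pb j.castSucc)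
    (hPb0 : Pb 0 = 0) (hPbN : Pb (Fin.last N) = 0)
    {a e e1 : Fin N → ℝ → ℝ} {eb : Fin (N + 1) → ℝ}
    (her : ∀ j, e j (m.xr j) = eb j.succ) (hel : ∀ j, e j (m.xl j) = eb j.castSucc)
    (ha : ∀ j, ContinuousOn (a j) (Icc (m.xl j) (m.xr j)))
    (he1 : ∀ j, ContinuousOn (e1 j) (Icc (m.xl j) (m.xr j)))
    (he : ∀ j, ∀ x ∈ Icc (m.xl j) (m.xr j), HasDerivAt (e j) (e1 j x) x)
    (hsplit : ∀ j, ∀ x ∈ Icc (m.xl j) (m.xr j),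
      w1 x - (P j).derivative.eval x = a j x + e1 j x)
    (hale : ∀ j, ∀ x ∈ Icc (m.xl j) (m.xr j), |a j x| ≤ 2 * Θ / ε₂)
    (he1int : ∀ j, ε₁ * (∫ t in (m.xl j)..(m.xr j), e1 j t ^ 2) ≤ H * Θ ^ 2)
    (he1l : ∀ j, ε₁ * m.width j * e1 j (m.xl j) ^ 2 ≤ H * Θ ^ 2)
    (he1r : ∀ j, |e1 j (m.xr j)| ≤ Θ * (ε₂ / ε₁))
    (heint : ∀ j, ε₂ ^ 2 / ε₁ * (∫ t in (m.xl j)..(m.xr j), e j t ^ 2) ≤ H * Θ ^ 2)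
    (heb : ∀ i, |eb i| ≤ Θ)
    (hwP : ∀ j, ∀ x ∈ Icc (m.xl j) (m.xr j), |w x - (P j).eval x| ≤ 3 * Θ) :
    WGErrorLE m ε₁ ε₂ bb rr ff p (quasiConst A K γ * N * ((9 + 2 * H + 1 / β) * Θ ^ 2)) := by
  intro u hu hsol up0 upb Dup Dcup hwg D hD
  have hβ := d.hβ
  have hq : 0 < 9 + 2 * H + 1 / β := by positivity
  set η : ℝ := Real.sqrt (9 + 2 * H + 1 / β) * Θ with hη
  have hη2 : η ^ 2 = (9 + 2 * H + 1 / β) * Θ ^ 2 := by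
    rw [hη, mul_pow, Real.sq_sqrt hq.le]
  have hΘη : Θ ≤ η := by
    refine le_mul_of_one_le_left hΘ (Real.one_le_sqrt.2 ?_)
    have : 0 < 1 / β := by positivity
    linarith
  have hΘ2 : 0 ≤ Θ ^ 2 := sq_nonneg _
  have hHΘ : 0 ≤ H * Θ ^ 2 := by positivity
  have hβΘ : 0 ≤ 1 / β * Θ ^ 2 := by positivity
  have hηe : η ^ 2 = 9 * Θ ^ 2 + 2 * (H * Θ ^ 2) + 1 / β * Θ ^ 2 := by rw [hη2]; ring
  have hac := m.xl_lt_xr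
  have hwid0 : ∀ j, 0 < m.width j := fun j => sub_pos.2 (hac j)
  have hwid : ∀ j, m.width j ≤ 1 := fun j => by
    have h1 := (m.cell_subset j) (right_mem_Icc.2 (hac j).le)
    have h2 := (m.cell_subset j) (left_mem_Icc.2 (hac j).le)
    rw [Mesh.width]; linarith [h1.2, h2.1]
  have hε₁1 : ε₁ ≤ 1 := hε₁₂.trans (pow_le_one₀ hε₂.le hε₂')
  have hasq : ∀ j, ∀ x ∈ Icc (m.xl j) (m.xr j), ε₂ ^ 2 * a j x ^ 2 ≤ 4 * Θ ^ 2 := by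
    intro j x hx
    have h1 := pow_le_pow_left₀ (abs_nonneg _) (hale j x hx) 2
    rw [sq_abs] at h1
    calc ε₂ ^ 2 * a j x ^ 2 ≤ ε₂ ^ 2 * (2 * Θ / ε₂) ^ 2 := by gcongr
      _ = _ := by field_simp; ring
  have hasq1 : ∀ j, ∀ x ∈ Icc (m.xl j) (m.xr j), ε₁ * a j x ^ 2 ≤ 4 * Θ ^ 2 := fun j x hx =>
    (mul_le_mul_of_nonneg_right hε₁₂ (sq_nonneg _)).trans (hasq j x hx)
  have haint : ∀ j, ε₂ ^ 2 * (∫ t in (m.xl j)..(m.xr j), a j t ^ 2) ≤ 4 * Θ ^ 2 := by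
    intro j
    have h1 := integral_sq_le_of_abs_le (hac j).le (ha j) (hale j)
    calc _ ≤ ε₂ ^ 2 * ((2 * Θ / ε₂) ^ 2 * m.width j) := by
          apply mul_le_mul_of_nonneg_left h1; positivity
      _ = 4 * Θ ^ 2 * m.width j := by field_simp; ring
      _ ≤ _ := mul_le_of_le_one_right (by positivity) (hwid j)
  have haint0 : ∀ j, 0 ≤ ∫ t in (m.xl j)..(m.xr j), a j t ^ 2 := fun j =>
    intervalIntegral.integral_nonneg (hac j).le fun t _ => sq_nonneg _
  have hsq : ∀ x y : ℝ, (x + y) ^ 2 ≤ 2 * x ^ 2 + 2 * y ^ 2 := fun x y => by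
    linarith [sq_nonneg (x - y), (by ring : (x + y) ^ 2 + (x - y) ^ 2 = 2 * x ^ 2 + 2 * y ^ 2)]
  have hwPc : ∀ j, ContinuousOn (fun t => w t - (P j).eval t) (Icc (m.xl j) (m.xr j)) := fun j =>
    ContinuousOn.sub (fun x hx => (hw x (m.cell_subset j hx)).continuousAt.continuousWithinAt)
      (P j).continuous.continuousOn
  have key := galerkin_error m (B := A * K) (η := η) (g := g) (w := w) (w1 := w1) (w2 := w2) (P := P)
    (Pb := Pb) (A := a) (e := e) (e1 := e1) (eb := eb) hε₁ hε₁1 hε₂ d.hγ d.one_le_AK d.hb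
    d.hr.continuous d.hf.continuous
    (fun t ht => (d.abs_b_le ht).trans d.le_AK) (fun t ht => d.abs_b'_le ht)
    (fun t ht => (d.abs_r_le ht).trans d.le_AK) (fun t ht => d.hβ.trans_le (d.hbβ t ht))
    (d.hco ε₂ ⟨hε₂, hε₂'⟩) hu hsol hw hw1 hw2 hw0 hwe heq (fun x hx => (hg x hx).trans hΘη) hp hwg hD
    hPd hPr hPl hPb0 hPbN her hel ha he1 he hsplit ?_ ?_ ?_ ?_ ?_ ?_ ?_ ?_
  · rw [hη2] at key
    exact key
  · intro j
    have hi1 : IntervalIntegrable (fun t => a j t ^ 2) volume (m.xl j) (m.xr j) :=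
      intervalIntegrable_of_continuousOn_Icc (hac j).le ((ha j).pow 2)
    have hi2 : IntervalIntegrable (fun t => e1 j t ^ 2) volume (m.xl j) (m.xr j) :=
      intervalIntegrable_of_continuousOn_Icc (hac j).le ((he1 j).pow 2)
    have h1 : (∫ t in (m.xl j)..(m.xr j), (w1 t - (P j).derivative.eval t) ^ 2)
        ≤ 2 * (∫ t in (m.xl j)..(m.xr j), a j t ^ 2)
          + 2 * ∫ t in (m.xl j)..(m.xr j), e1 j t ^ 2 := by
      rw [← intervalIntegral.integral_const_mul, ← intervalIntegral.integral_const_mul,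
        ← intervalIntegral.integral_add (hi1.const_mul 2) (hi2.const_mul 2)]
      refine intervalIntegral.integral_mono_on (hac j).le ?_ ?_ (fun x hx => ?_)
      · refine intervalIntegrable_of_continuousOn_Icc (hac j).le (ContinuousOn.pow ?_ 2)
        exact ContinuousOn.congr ((ha j).add (he1 j)) (hsplit j)
      · exact (hi1.const_mul 2).add (hi2.const_mul 2)
      · rw [hsplit j x hx]; exact hsq _ _
    have h2 := mul_le_mul_of_nonneg_left h1 hε₁.le
    have h3 := mul_le_mul_of_nonneg_right hε₁₂ (haint0 j)
    have h4 := haint j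
    have h5 := he1int j
    rw [hηe]
    linarith
  · intro j
    have h1 := hasq1 j _ (right_mem_Icc.2 (hac j).le)
    have h2 := mul_le_of_le_one_left (mul_nonneg hε₁.le (sq_nonneg (a j (m.xr j)))) (hwid j)
    rw [hηe]
    linarith
  · intro j
    have h1 := pow_le_pow_left₀ (abs_nonneg _) (he1r j) 2
    rw [sq_abs] at h1
    have h2 := d.hbβ _ ((m.cell_subset j) (right_mem_Icc.2 (hac j).le))
    calc ε₁ ^ 2 * e1 j (m.xr j) ^ 2 ≤ ε₁ ^ 2 * (Θ * (ε₂ / ε₁)) ^ 2 := by gcongr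
      _ = ε₂ * (ε₂ * Θ ^ 2) := by field_simp
      _ ≤ ε₂ * (1 * Θ ^ 2) := by gcongr
      _ = ε₂ * β * (1 / β * Θ ^ 2) := by field_simp
      _ ≤ ε₂ * bb (m.xr j) * η ^ 2 := by
        have : 1 / β * Θ ^ 2 ≤ η ^ 2 := by rw [hηe]; linarith
        have : 0 ≤ bb (m.xr j) := hβ.le.trans h2
        gcongr
  · intro j
    have hl := left_mem_Icc.2 (hac j).le
    have h1 := hasq1 j _ hl
    have h2 := mul_le_of_le_one_left (mul_nonneg hε₁.le (sq_nonneg (a j (m.xl j)))) (hwid j)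
    have h3 := he1l j
    rw [hsplit j _ hl]
    have h4 := mul_le_mul_of_nonneg_left (hsq (a j (m.xl j)) (e1 j (m.xl j)))
      (mul_nonneg hε₁.le (hwid0 j).le)
    rw [hηe]
    linarith
  · intro j
    rw [hηe]
    linarith [haint j]
  · intro j
    rw [hηe]
    linarith [heint j]
  · intro i
    have h1 := pow_le_pow_left₀ (abs_nonneg _) (heb i) 2
    rw [sq_abs] at h1
    have h2 := mul_le_of_le_one_left (sq_nonneg (eb i)) hε₂'
    rw [hηe]
    linarith
  · intro j
    have h1 := integral_sq_le_of_abs_le (hac j).le (hwPc j) (hwP j)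
    have h2 : (3 * Θ) ^ 2 * (m.xr j - m.xl j) ≤ (3 * Θ) ^ 2 :=
      mul_le_of_le_one_right (sq_nonneg _) (hwid j)
    have h3 : (3 * Θ) ^ 2 = 9 * Θ ^ 2 := by ring
    rw [hηe]
    linarith

lemma forall_fin_three {Q : Fin 3 → Prop} (h0 : Q 0) (h1 : Q 1) (h2 : Q 2) : ∀ j, Q j := by
  intro j; fin_cases j <;> assumption

lemma forall_fin_four {Q : Fin 4 → Prop} (h0 : Q 0) (h1 : Q 1) (h2 : Q 2) (h3 : Q 3) :
    ∀ j, Q j := by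
  intro j; fin_cases j <;> assumption

/-- A crude bound that holds on every mesh. -/
lemma wgError_trivial {N : ℕ} (m : Mesh N) {bb rr ff : ℝ → ℝ} {A K γ β ε₁ ε₂ : ℝ}
    (d : DataBounds bb rr ff A K γ β) (hε₁ : 0 < ε₁) (hε₂ : 0 < ε₂) (hε₁₂ : ε₁ ≤ ε₂ ^ 2)
    (hε₂' : ε₂ ≤ 1) {p : ℕ} (hp : 1 ≤ p) :
    WGErrorLE m ε₁ ε₂ bb rr ff p (quasiConst A K γ * N * ((9 + 2 * 0 + 1 / β) * A ^ 2)) := by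
  have hA : 0 ≤ A := by linarith [d.hA]
  refine wgError_of_split m d hε₁ hε₂ hε₁₂ hε₂' hA le_rfl (w := fun _ => 0) (w1 := fun _ => 0)
    (w2 := fun _ => 0) (g := ff) (P := fun _ => 0) (Pb := fun _ => 0) (a := fun _ _ => 0)
    (e := fun _ _ => 0) (e1 := fun _ _ => 0) (eb := fun _ => 0) (fun x _ => hasDerivAt_const x 0)
    (fun x _ => hasDerivAt_const x 0) continuousOn_const rfl rfl (fun x _ => by simp)
    (fun x hx => d.abs_f_le hx) hp (fun _ => by simp) (fun _ => by simp) (fun _ => by simp) rfl rfl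
    (fun _ => rfl) (fun _ => rfl) (fun _ => continuousOn_const) (fun _ => continuousOn_const)
    (fun _ x _ => hasDerivAt_const x 0) (fun _ x _ => by simp) (fun _ x _ => ?_) (fun _ => by simp)
    (fun _ => by simp) (fun _ => ?_) (fun _ => by simp) (fun _ => by simpa using hA)
    (fun _ x _ => by simpa using hA)
  · rw [abs_zero]; positivity
  · rw [abs_zero]; positivity

/-- `f` is within `E` of the polynomial `q` on `[a, c]`, with derivatives within `E'`. -/
structure PolyClose (f f1 : ℝ → ℝ) (q : Polynomial ℝ) (p : ℕ) (a c E E' : ℝ) : Prop where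
  deg : q.natDegree ≤ p
  close : ∀ x ∈ Icc a c, |f x - q.eval x| ≤ E
  close' : ∀ x ∈ Icc a c, |f1 x - q.derivative.eval x| ≤ E'

/-- `f` is twice continuously differentiable on `[0, 1]` with derivatives `f1`, `f2`. -/
structure TwiceDiff (f f1 f2 : ℝ → ℝ) : Prop where
  d1 : ∀ x ∈ Icc (0 : ℝ) 1, HasDerivAt f (f1 x) x
  d2 : ∀ x ∈ Icc (0 : ℝ) 1, HasDerivAt f1 (f2 x) x
  cont : ContinuousOn f2 (Icc 0 1)

lemma TwiceDiff.add {f f1 f2 g g1 g2 : ℝ → ℝ} (hf : TwiceDiff f f1 f2) (hg : TwiceDiff g g1 g2) :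
    TwiceDiff (fun x => f x + g x) (fun x => f1 x + g1 x) (fun x => f2 x + g2 x) :=
  ⟨fun x hx => (hf.d1 x hx).add (hg.d1 x hx), fun x hx => (hf.d2 x hx).add (hg.d2 x hx),
    hf.cont.add hg.cont⟩

lemma TwiceDiff.cont1 {f f1 f2 : ℝ → ℝ} (hf : TwiceDiff f f1 f2) : ContinuousOn f1 (Icc 0 1) :=
  fun x hx => (hf.d2 x hx).continuousAt.continuousWithinAt

lemma TwiceDiff.cont0 {f f1 f2 : ℝ → ℝ} (hf : TwiceDiff f f1 f2) : ContinuousOn f (Icc 0 1) :=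
  fun x hx => (hf.d1 x hx).continuousAt.continuousWithinAt

set_option maxHeartbeats 1000000 in
/-- Error estimate on a three-cell mesh from a decomposition into a smooth part `S`, a layer `Y`
at `0` and a convective layer `Z` at `1`. -/
theorem wgError_three_cells (m : Mesh 3) {bb rr ff : ℝ → ℝ} {A K γ β ε₁ ε₂ Θ H l : ℝ}
    (d : DataBounds bb rr ff A K γ β) (hε₁ : 0 < ε₁) (hε₂ : 0 < ε₂) (hε₁₂ : ε₁ ≤ ε₂ ^ 2)
    (hε₂' : ε₂ ≤ 1) (hΘ : 0 ≤ Θ) (hl : 0 < l) (hH : ε₂ * (ε₂ / ε₁) * (1 - m.pt 2) ≤ H)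
    {S S1 S2 Y Y1 Y2 Z Z1 Z2 g : ℝ → ℝ} (hS : TwiceDiff S S1 S2) (hY : TwiceDiff Y Y1 Y2)
    (hZ : TwiceDiff Z Z1 Z2) (hw0 : S 0 + Y 0 + Z 0 = 0) (hwe : S 1 + Y 1 + Z 1 = 0)
    (heq : ∀ x ∈ Icc (0 : ℝ) 1, -ε₁ * (S2 x + Y2 x + Z2 x) + ε₂ * bb x * (S1 x + Y1 x + Z1 x)
      + rr x * (S x + Y x + Z x) = ff x - g x)
    (hg : ∀ x ∈ Icc (0 : ℝ) 1, |g x| ≤ Θ) {p : ℕ} (hp : 1 ≤ p) {qS qY qZ : Polynomial ℝ}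
    (hqS : PolyClose S S1 qS p 0 1 Θ Θ)
    (hqY : PolyClose Y Y1 qY p 0 (m.pt 1) Θ (Θ / ε₂))
    (hqY1 : qY.eval (m.pt 1) = 0) (hPb0 : qS.eval 0 + qY.eval 0 = 0)
    (hqZ : PolyClose Z Z1 qZ p (m.pt 2) 1 Θ (Θ * (ε₂ / ε₁))) (hqZ0 : qZ.eval (m.pt 2) = 0)
    (hqZ1 : qZ.eval 1 = Z 1) (hPbN : qS.eval 1 + qZ.eval 1 = 0)
    (hYle : ∀ x ∈ Icc (m.pt 1) 1, |Y x| ≤ Θ ∧ |Y1 x| ≤ Θ / ε₂)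
    (hZle : ∀ x ∈ Icc 0 (m.pt 2), |Z x| ≤ Θ * Real.exp (-(l * (ε₂ / ε₁) * (m.pt 2 - x))) ∧
      |Z1 x| ≤ Θ * (ε₂ / ε₁) * Real.exp (-(l * (ε₂ / ε₁) * (m.pt 2 - x)))) :
    WGErrorLE m ε₁ ε₂ bb rr ff p
      (quasiConst A K γ * (3 : ℕ) * ((9 + 2 * (H + 1 / (2 * l)) + 1 / β) * Θ ^ 2)) := by
  have hx0 : m.xl 0 = 0 := m.left
  have hx3 : m.xr 2 = 1 := m.right
  have hx01 : m.xr 0 = m.pt 1 := rfl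
  have hx10 : m.xl 1 = m.pt 1 := rfl
  have hx12 : m.xr 1 = m.pt 2 := rfl
  have hx21 : m.xl 2 = m.pt 2 := rfl
  have h01 : 0 < m.pt 1 := by have := m.xl_lt_xr 0; rwa [hx0] at this
  have h12 : m.pt 1 < m.pt 2 := m.xl_lt_xr 1
  have h23 : m.pt 2 < 1 := by have := m.xl_lt_xr 2; rwa [hx3] at this
  have hs := m.cell_subset
  set a1 := ε₂ / ε₁ with ha1
  have ha1pos : 0 < a1 := by positivity
  have hε₁a1 : ε₁ * a1 = ε₂ := by rw [ha1]; field_simp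
  have hH0 : 0 ≤ H := le_trans (mul_nonneg (by positivity) (by linarith)) hH
  have hHl : 0 ≤ H + 1 / (2 * l) := by positivity
  have hΘε : Θ ≤ Θ / ε₂ := (le_div_iff₀ hε₂).2 (mul_le_of_le_one_right hΘ hε₂')
  have hsum : ∀ {x y : ℝ}, |x| ≤ Θ → |y| ≤ Θ / ε₂ → |x + y| ≤ 2 * Θ / ε₂ := by
    intro x y hx hy
    have := abs_add_le x y
    have e : 2 * Θ / ε₂ = Θ / ε₂ + Θ / ε₂ := by ring
    rw [e]; linarith
  have hk : 0 < l * a1 := by positivity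
  have hexp1 : ∀ {x}, x ≤ m.pt 2 → Real.exp (-(l * a1 * (m.pt 2 - x))) ≤ 1 := fun {x} hx =>
    Real.exp_le_one_iff.2 (by
      have := mul_nonneg hk.le (sub_nonneg.2 hx); linarith)
  have hΘ2 : 0 ≤ Θ ^ 2 := sq_nonneg _
  have hlim : ε₂ * Θ ^ 2 / (2 * l) ≤ (H + 1 / (2 * l)) * Θ ^ 2 := by
    calc ε₂ * Θ ^ 2 / (2 * l) ≤ 1 * Θ ^ 2 / (2 * l) := by gcongr
      _ ≤ H * Θ ^ 2 + 1 * Θ ^ 2 / (2 * l) := by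
        have := mul_nonneg hH0 hΘ2; linarith
      _ = _ := by ring
  have hlimH : ε₂ * a1 * (1 - m.pt 2) * Θ ^ 2 ≤ (H + 1 / (2 * l)) * Θ ^ 2 := by
    have : 0 ≤ 1 / (2 * l) := by positivity
    gcongr
    linarith
  -- bounds for the layer away from its cell
  have outer : ∀ s t : ℝ, 0 ≤ s → s ≤ t → t ≤ m.pt 2 →
      ε₁ * (∫ x in s..t, Z1 x ^ 2) ≤ (H + 1 / (2 * l)) * Θ ^ 2 ∧
      ε₁ * (t - s) * Z1 s ^ 2 ≤ (H + 1 / (2 * l)) * Θ ^ 2 ∧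
      |Z1 t| ≤ Θ * a1 ∧ ε₂ ^ 2 / ε₁ * (∫ x in s..t, Z x ^ 2) ≤ (H + 1 / (2 * l)) * Θ ^ 2 := by
    intro s t hs0 hst ht
    have hsub : Icc s t ⊆ Icc 0 1 := Icc_subset_Icc hs0 (by linarith)
    have hsub2 : Icc s t ⊆ Icc 0 (m.pt 2) := Icc_subset_Icc hs0 ht
    refine ⟨?_, ?_, ?_, ?_⟩
    · have h1 := integral_sq_le_of_decay hk hst ht (hZ.cont1.mono hsub)
        (fun x hx => (hZle x (hsub2 hx)).2)
      refine le_trans (mul_le_mul_of_nonneg_left h1 hε₁.le) (le_trans (le_of_eq ?_) hlim)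
      rw [← hε₁a1]; field_simp
    · have h1 := (hZle s ⟨hs0, hst.trans ht⟩).2
      have h2 := pow_le_pow_left₀ (abs_nonneg _) h1 2
      rw [sq_abs] at h2
      have h3 := mul_exp_neg_le (w := m.pt 2 - s) hk
      refine le_trans ?_ hlim
      calc ε₁ * (t - s) * Z1 s ^ 2
          ≤ ε₁ * (m.pt 2 - s) * (Θ * a1 * Real.exp (-(l * a1 * (m.pt 2 - s)))) ^ 2 := by
            have : 0 ≤ m.pt 2 - s := by linarith
            gcongr
        _ = ε₁ * (Θ * a1) ^ 2 * ((m.pt 2 - s) * Real.exp (-(l * a1 * (m.pt 2 - s))) ^ 2) := by ring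
        _ ≤ ε₁ * (Θ * a1) ^ 2 * (1 / (2 * (l * a1))) := by gcongr
        _ = _ := by rw [← hε₁a1]; field_simp
    · exact (hZle t ⟨hs0.trans hst, ht⟩).2.trans
        (mul_le_of_le_one_right (by positivity) (hexp1 ht))
    · have h1 := integral_sq_le_of_decay hk hst ht (hZ.cont0.mono hsub)
        (fun x hx => (hZle x (hsub2 hx)).1)
      refine le_trans (mul_le_mul_of_nonneg_left h1 (by positivity)) (le_trans (le_of_eq ?_) hlim)
      rw [ha1]; field_simp
  have hZ01 : ∀ x ∈ Icc 0 (m.pt 2), |Z x| ≤ Θ := fun x hx =>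
    (hZle x hx).1.trans (mul_le_of_le_one_right hΘ (hexp1 hx.2))
  have hsub2 : Icc (m.pt 2) 1 ⊆ Icc 0 1 := Icc_subset_Icc (by linarith) le_rfl
  have hsub0 : Icc 0 (m.pt 1) ⊆ Icc 0 1 := Icc_subset_Icc le_rfl (by linarith)
  have hsub1 : Icc (m.pt 1) (m.pt 2) ⊆ Icc 0 1 := Icc_subset_Icc h01.le h23.le
  have hpc : ∀ (q : Polynomial ℝ) (s : Set ℝ), ContinuousOn (fun x => q.eval x) s := fun q s =>
    q.continuous.continuousOn
  have h3' : ∀ {x y z : ℝ}, |x| ≤ Θ → |y| ≤ Θ → |z| ≤ Θ → |x + y + z| ≤ 3 * Θ := by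
    intro x y z hx hy hz
    have := abs_add_three x y z
    linarith
  refine wgError_of_split m d hε₁ hε₂ hε₁₂ hε₂' hΘ hHl (w := fun x => S x + Y x + Z x)
    (w1 := fun x => S1 x + Y1 x + Z1 x) (w2 := fun x => S2 x + Y2 x + Z2 x) (g := g)
    (P := ![qS + qY, qS, qS + qZ]) (Pb := ![0, qS.eval (m.pt 1), qS.eval (m.pt 2), 0])
    (a := ![fun x => (S1 x - qS.derivative.eval x) + (Y1 x - qY.derivative.eval x),
      fun x => (S1 x - qS.derivative.eval x) + Y1 x, fun x => (S1 x - qS.derivative.eval x) + Y1 x])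
    (e := ![Z, Z, fun x => Z x - qZ.eval x]) (e1 := ![Z1, Z1, fun x => Z1 x - qZ.derivative.eval x])
    (eb := ![Z 0, Z (m.pt 1), Z (m.pt 2), 0]) ((hS.add hY).add hZ).d1 ((hS.add hY).add hZ).d2
    ((hS.add hY).add hZ).cont hw0 hwe heq hg hp ?_ ?_ ?_ rfl rfl ?_ ?_ ?_ ?_ ?_ ?_ ?_ ?_ ?_ ?_ ?_ ?_ ?_
  · refine forall_fin_three ?_ hqS.deg ?_
    · exact (Polynomial.natDegree_add_le _ _).trans (max_le hqS.deg hqY.deg)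
    · exact (Polynomial.natDegree_add_le _ _).trans (max_le hqS.deg hqZ.deg)
  · refine forall_fin_three ?_ ?_ ?_
    · change (qS + qY).eval (m.pt 1) = qS.eval (m.pt 1)
      rw [Polynomial.eval_add, hqY1, add_zero]
    · rfl
    · change (qS + qZ).eval (m.xr 2) = 0
      rw [hx3, Polynomial.eval_add, hPbN]
  · refine forall_fin_three ?_ ?_ ?_
    · change (qS + qY).eval (m.xl 0) = 0
      rw [hx0, Polynomial.eval_add, hPb0]
    · rfl
    · change (qS + qZ).eval (m.pt 2) = qS.eval (m.pt 2)
      rw [Polynomial.eval_add, hqZ0, add_zero]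
  · refine forall_fin_three rfl rfl ?_
    change Z (m.xr 2) - qZ.eval (m.xr 2) = 0
    rw [hx3, hqZ1, sub_self]
  · refine forall_fin_three ?_ rfl ?_
    · change Z (m.xl 0) = Z 0
      rw [hx0]
    · change Z (m.pt 2) - qZ.eval (m.pt 2) = Z (m.pt 2)
      rw [hqZ0, sub_zero]
  · refine forall_fin_three ?_ ?_ ?_
    · exact ((hS.cont1.mono (hs 0)).sub (hpc _ _)).add ((hY.cont1.mono (hs 0)).sub (hpc _ _))
    · exact ((hS.cont1.mono (hs 1)).sub (hpc _ _)).add (hY.cont1.mono (hs 1))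
    · exact ((hS.cont1.mono (hs 2)).sub (hpc _ _)).add (hY.cont1.mono (hs 2))
  · refine forall_fin_three (hZ.cont1.mono (hs 0)) (hZ.cont1.mono (hs 1)) ?_
    exact (hZ.cont1.mono (hs 2)).sub (hpc _ _)
  · refine forall_fin_three (fun x hx => hZ.d1 x (hs 0 hx)) (fun x hx => hZ.d1 x (hs 1 hx))
      (fun x hx => ?_)
    exact (hZ.d1 x (hs 2 hx)).sub (qZ.hasDerivAt x)
  · refine forall_fin_three (fun x _ => ?_) (fun x _ => ?_) (fun x _ => ?_)
    · change S1 x + Y1 x + Z1 x - (qS + qY).derivative.eval x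
        = (S1 x - qS.derivative.eval x) + (Y1 x - qY.derivative.eval x) + Z1 x
      rw [Polynomial.derivative_add, Polynomial.eval_add]; ring
    · change S1 x + Y1 x + Z1 x - qS.derivative.eval x
        = (S1 x - qS.derivative.eval x) + Y1 x + Z1 x
      ring
    · change S1 x + Y1 x + Z1 x - (qS + qZ).derivative.eval x
        = (S1 x - qS.derivative.eval x) + Y1 x + (Z1 x - qZ.derivative.eval x)
      rw [Polynomial.derivative_add, Polynomial.eval_add]; ring
  · refine forall_fin_three (fun x hx => ?_) (fun x hx => ?_) (fun x hx => ?_)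
    · refine hsum (hqS.close' x (hs 0 hx)) (hqY.close' x ?_)
      rwa [hx0, hx01] at hx
    · exact hsum (hqS.close' x (hs 1 hx)) (hYle x ⟨hx.1, hx.2.trans h23.le⟩).2
    · exact hsum (hqS.close' x (hs 2 hx)) (hYle x ⟨h12.le.trans hx.1, (hs 2 hx).2⟩).2
  · refine forall_fin_three ?_ ?_ ?_
    · rw [hx0, hx01]; exact (outer 0 (m.pt 1) le_rfl h01.le h12.le).1
    · exact (outer (m.pt 1) (m.pt 2) h01.le h12.le le_rfl).1
    · rw [hx3, hx21]
      have h1 := integral_sq_le_of_abs_le h23.le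
        ((hZ.cont1.mono hsub2).sub (hpc qZ.derivative _)) hqZ.close'
      refine le_trans (mul_le_mul_of_nonneg_left h1 hε₁.le) (le_trans (le_of_eq ?_) hlimH)
      rw [← hε₁a1]; ring
  · refine forall_fin_three ?_ ?_ ?_
    · rw [Mesh.width, hx0, hx01]; exact (outer 0 (m.pt 1) le_rfl h01.le h12.le).2.1
    · exact (outer (m.pt 1) (m.pt 2) h01.le h12.le le_rfl).2.1
    · rw [Mesh.width, hx3, hx21]
      have h1 := pow_le_pow_left₀ (abs_nonneg _) (hqZ.close' _ (left_mem_Icc.2 h23.le)) 2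
      rw [sq_abs] at h1
      refine le_trans (mul_le_mul_of_nonneg_left h1 (mul_nonneg hε₁.le (by linarith)))
        (le_trans (le_of_eq ?_) hlimH)
      rw [← hε₁a1]; ring
  · refine forall_fin_three ?_ ?_ ?_
    · exact (outer 0 (m.pt 1) le_rfl h01.le h12.le).2.2.1
    · exact (outer (m.pt 1) (m.pt 2) h01.le h12.le le_rfl).2.2.1
    · rw [hx3]; exact hqZ.close' 1 (right_mem_Icc.2 h23.le)
  · refine forall_fin_three ?_ ?_ ?_
    · rw [hx0, hx01]; exact (outer 0 (m.pt 1) le_rfl h01.le h12.le).2.2.2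
    · exact (outer (m.pt 1) (m.pt 2) h01.le h12.le le_rfl).2.2.2
    · rw [hx3, hx21]
      have h1 := integral_sq_le_of_abs_le h23.le
        ((hZ.cont0.mono hsub2).sub (hpc qZ _)) hqZ.close
      refine le_trans (mul_le_mul_of_nonneg_left h1 (by positivity)) (le_trans (le_of_eq ?_) hlimH)
      rw [ha1]; ring
  · refine forall_fin_four ?_ ?_ ?_ ?_
    · exact hZ01 0 ⟨le_rfl, by linarith⟩
    · exact hZ01 _ ⟨h01.le, h12.le⟩
    · exact hZ01 _ ⟨by linarith, le_rfl⟩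
    · change |(0 : ℝ)| ≤ Θ
      rwa [abs_zero]
  · refine forall_fin_three (fun x hx => ?_) (fun x hx => ?_) (fun x hx => ?_)
    · change |S x + Y x + Z x - (qS + qY).eval x| ≤ 3 * Θ
      rw [hx0, hx01] at hx
      rw [Polynomial.eval_add, show S x + Y x + Z x - (qS.eval x + qY.eval x)
        = (S x - qS.eval x) + (Y x - qY.eval x) + Z x by ring]
      exact h3' (hqS.close x (hsub0 hx)) (hqY.close x hx) (hZ01 x ⟨hx.1, hx.2.trans h12.le⟩)
    · change |S x + Y x + Z x - qS.eval x| ≤ 3 * Θ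
      rw [hx10, hx12] at hx
      rw [show S x + Y x + Z x - qS.eval x = (S x - qS.eval x) + Y x + Z x by ring]
      exact h3' (hqS.close x (hsub1 hx)) (hYle x ⟨hx.1, hx.2.trans h23.le⟩).1
        (hZ01 x ⟨h01.le.trans hx.1, hx.2⟩)
    · change |S x + Y x + Z x - (qS + qZ).eval x| ≤ 3 * Θ
      rw [hx21, hx3] at hx
      rw [Polynomial.eval_add, show S x + Y x + Z x - (qS.eval x + qZ.eval x)
        = (S x - qS.eval x) + Y x + (Z x - qZ.eval x) by ring]
      exact h3' (hqS.close x (hsub2 hx)) (hYle x ⟨h12.le.trans hx.1, hx.2⟩).1 (hqZ.close x hx)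

lemma muVal_mem {bb rr : ℝ → ℝ} {sgn ε₁ ε₂ lo hi : ℝ}
    (h : ∀ x ∈ Icc (0 : ℝ) 1, (sgn * ε₂ * bb x + Real.sqrt (ε₂ ^ 2 * (bb x) ^ 2 + 4 * ε₁ * rr x))
      / (2 * ε₁) ∈ Icc lo hi) : muVal sgn ε₁ ε₂ bb rr ∈ Icc lo hi := by
  have h0 : (0 : ℝ) ∈ Icc (0 : ℝ) 1 := by simp
  have hlb : ∀ y ∈ (fun x => (sgn * ε₂ * bb x + Real.sqrt (ε₂ ^ 2 * (bb x) ^ 2 + 4 * ε₁ * rr x))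
      / (2 * ε₁)) '' Icc 0 1, lo ≤ y := by
    rintro _ ⟨x, hx, rfl⟩
    exact (h x hx).1
  exact ⟨le_csInf ⟨_, mem_image_of_mem _ h0⟩ hlb,
    (csInf_le ⟨lo, hlb⟩ (mem_image_of_mem _ h0)).trans (h 0 h0).2⟩

lemma DataBounds.mu_bounds {bb rr ff : ℝ → ℝ} {A K γ β ε₁ ε₂ : ℝ}
    (d : DataBounds bb rr ff A K γ β) (hε₁ : 0 < ε₁) (hε₂ : 0 < ε₂) (hε₁₂ : ε₁ ≤ ε₂ ^ 2) :
    mu0 ε₁ ε₂ bb rr ∈ Icc (γ / (2 * A * ε₂)) (A / (β * ε₂)) ∧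
      mu1 ε₁ ε₂ bb rr ∈ Icc (β * (ε₂ / ε₁)) (2 * A * (ε₂ / ε₁)) := by
  have hA := d.hA
  have hβ := d.hβ
  have hγ := d.hγ
  have key : ∀ x ∈ Icc (0 : ℝ) 1, ∃ s, s = Real.sqrt (ε₂ ^ 2 * (bb x) ^ 2 + 4 * ε₁ * rr x) ∧
      β ≤ bb x ∧ bb x ≤ A ∧ γ ≤ rr x ∧ rr x ≤ A ∧ ε₂ * bb x ≤ s ∧ s ≤ 3 * A * ε₂ ∧
      (s - ε₂ * bb x) * (s + ε₂ * bb x) = 4 * ε₁ * rr x := by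
    intro x hx
    have h1 := d.hbβ x hx
    have h2 := (le_abs_self _).trans (d.abs_b_le hx)
    have h3 := d.hrγ x hx
    have h4 := (le_abs_self _).trans (d.abs_r_le hx)
    have h5 : 0 ≤ 4 * ε₁ * rr x := mul_nonneg (by linarith) (by linarith)
    have h6 : 0 ≤ ε₂ ^ 2 * bb x ^ 2 := by positivity
    refine ⟨_, rfl, h1, h2, h3, h4, ?_, ?_, ?_⟩
    · refine Real.le_sqrt_of_sq_le ?_
      rw [mul_pow]; linarith
    · refine Real.sqrt_le_iff.2 ⟨by positivity, ?_⟩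
      have e1 : bb x ^ 2 ≤ A ^ 2 := pow_le_pow_left₀ (by linarith) h2 2
      have e2 : rr x ≤ A ^ 2 := h4.trans (by rw [sq]; exact le_mul_of_one_le_left (by linarith) hA)
      have e3 : ε₁ * rr x ≤ ε₂ ^ 2 * A ^ 2 := mul_le_mul hε₁₂ e2 (by linarith) (by positivity)
      have e4 : ε₂ ^ 2 * bb x ^ 2 ≤ ε₂ ^ 2 * A ^ 2 := by gcongr
      have e5 : (3 * A * ε₂) ^ 2 = 9 * (ε₂ ^ 2 * A ^ 2) := by ring
      have e6 : 0 ≤ ε₂ ^ 2 * A ^ 2 := by positivity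
      rw [e5]; linarith
    · have e := Real.sq_sqrt (add_nonneg h6 h5)
      calc _ = Real.sqrt (ε₂ ^ 2 * bb x ^ 2 + 4 * ε₁ * rr x) ^ 2 - ε₂ ^ 2 * bb x ^ 2 := by ring
        _ = _ := by rw [e]; ring
  constructor
  · refine muVal_mem fun x hx => ?_
    obtain ⟨s, hs, h1, h2, h3, h4, h5, h6, h7⟩ := key x hx
    rw [← hs]
    have h8 : ε₂ * bb x ≤ A * ε₂ := by rw [mul_comm]; gcongr
    constructor
    · rw [div_le_div_iff₀ (by positivity) (by positivity)]
      have e1 : (s - ε₂ * bb x) * (s + ε₂ * bb x) ≤ (s - ε₂ * bb x) * (4 * A * ε₂) :=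
        mul_le_mul_of_nonneg_left (by linarith) (by linarith)
      have e2 : 4 * ε₁ * γ ≤ 4 * ε₁ * rr x := by gcongr
      linarith
    · rw [div_le_div_iff₀ (by positivity) (by positivity)]
      have h9 : β * ε₂ ≤ ε₂ * bb x := by rw [mul_comm]; gcongr
      have e1 : (s - ε₂ * bb x) * (2 * (β * ε₂)) ≤ (s - ε₂ * bb x) * (s + ε₂ * bb x) :=
        mul_le_mul_of_nonneg_left (by linarith) (by linarith)
      have e2 : 4 * ε₁ * rr x ≤ 4 * ε₁ * A := by gcongr
      linarith
  · refine muVal_mem fun x hx => ?_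
    obtain ⟨s, hs, h1, h2, h3, h4, h5, h6, h7⟩ := key x hx
    rw [← hs, ← mul_div_assoc, ← mul_div_assoc]
    have h8 : ε₂ * bb x ≤ A * ε₂ := by rw [mul_comm]; gcongr
    have h9 : β * ε₂ ≤ ε₂ * bb x := by rw [mul_comm]; gcongr
    constructor
    · rw [div_le_div_iff₀ (by positivity) (by positivity)]
      calc β * ε₂ * (2 * ε₁) = (2 * (β * ε₂)) * ε₁ := by ring
        _ ≤ _ := by gcongr; linarith
    · rw [div_le_div_iff₀ (by positivity) (by positivity)]
      calc _ ≤ (4 * (A * ε₂)) * ε₁ := by gcongr; linarith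
        _ = _ := by ring

/-- Polynomial approximation of a holomorphic function with prescribed values at the endpoints. -/
lemma exists_poly_interp {F : ℂ → ℂ} {a c η M E : ℝ} (hac : a < c) (hη : 0 < η)
    (hF : DifferentiableOn ℂ F (tube a c (2 * η * (c - a))))
    (hM : ∀ z ∈ tube a c (2 * η * (c - a)), ‖F z‖ ≤ M) {p : ℕ} (hp : 1 ≤ p) (s t : ℝ)
    (hE : approxRate η p * M + |(F a).re - s| + |(F c).re - t| ≤ E) :
    ∃ q : Polynomial ℝ, PolyClose (fun x => (F x).re) (fun x => (deriv F x).re) q p a c E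
      (E / (c - a)) ∧ q.eval a = s ∧ q.eval c = t := by
  obtain ⟨q, hqd, hqa, hqc, hq⟩ := exists_poly_approx_deriv hac hη hF hM hp
  have hca : 0 < c - a := sub_pos.2 hac
  set α := (F a).re - s with hα
  set τ := (F c).re - t with hτ
  set r : Polynomial ℝ := Polynomial.C (α / (c - a)) * (Polynomial.C c - Polynomial.X)
    + Polynomial.C (τ / (c - a)) * (Polynomial.X - Polynomial.C a) with hr
  have hre : ∀ x, r.eval x = α / (c - a) * (c - x) + τ / (c - a) * (x - a) := fun x => by simp [hr]
  have hrd : ∀ x, r.derivative.eval x = (τ - α) / (c - a) := fun x => by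
    simp [hr]; ring
  have hrdeg : r.natDegree ≤ p := by
    refine le_trans ?_ hp
    rw [hr]
    compute_degree
  refine ⟨q - r, ⟨?_, fun x hx => ?_, fun x hx => ?_⟩, ?_, ?_⟩
  · exact (Polynomial.natDegree_sub_le _ _).trans (max_le hqd hrdeg)
  · rw [Polynomial.eval_sub, hre, show (F x).re - (q.eval x - (α / (c - a) * (c - x)
      + τ / (c - a) * (x - a))) = ((F x).re - q.eval x) + α / (c - a) * (c - x)
      + τ / (c - a) * (x - a) by ring]
    have h1 : |α / (c - a) * (c - x)| ≤ |α| := by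
      rw [abs_mul, abs_div, abs_of_pos hca, abs_of_nonneg (by linarith [hx.2] : (0 : ℝ) ≤ c - x),
        div_mul_eq_mul_div, div_le_iff₀ hca]
      exact mul_le_mul_of_nonneg_left (by linarith [hx.1]) (abs_nonneg _)
    have h2 : |τ / (c - a) * (x - a)| ≤ |τ| := by
      rw [abs_mul, abs_div, abs_of_pos hca, abs_of_nonneg (by linarith [hx.1] : (0 : ℝ) ≤ x - a),
        div_mul_eq_mul_div, div_le_iff₀ hca]
      exact mul_le_mul_of_nonneg_left (by linarith [hx.2]) (abs_nonneg _)
    have h3 := (hq x hx).2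
    have h4 := abs_add_three ((F x).re - q.eval x) (α / (c - a) * (c - x)) (τ / (c - a) * (x - a))
    linarith
  · rw [Polynomial.derivative_sub, Polynomial.eval_sub, hrd, show (deriv F x).re
      - (q.derivative.eval x - (τ - α) / (c - a))
      = ((deriv F x).re - q.derivative.eval x) + (τ - α) / (c - a) by ring]
    have h1 := (hq x hx).1
    have h2 : |(τ - α) / (c - a)| ≤ (|α| + |τ|) / (c - a) := by
      rw [abs_div, abs_of_pos hca]
      gcongr
      have := abs_sub τ α
      linarith
    refine (abs_add_le _ _).trans ((add_le_add h1 h2).trans ?_)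
    rw [← add_div]
    gcongr
    linarith
  · rw [Polynomial.eval_sub, hre, hqa, hα]
    field_simp
    ring
  · rw [Polynomial.eval_sub, hre, hqc, hτ]
    field_simp
    ring

lemma twiceDiff_re {F : ℂ → ℂ} {r : ℝ} (hr : 0 < r) (hF : DifferentiableOn ℂ F (tube 0 1 r)) :
    TwiceDiff (fun x => (F x).re) (fun x => (deriv F x).re) (fun x => (deriv (deriv F) x).re) := by
  have ho := isOpen_tube 0 1 r
  have hm : ∀ x ∈ Icc (0 : ℝ) 1, (x : ℂ) ∈ tube 0 1 r := fun x hx => ofReal_mem_tube hr hx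
  have h1 : DifferentiableOn ℂ (deriv F) (tube 0 1 r) := hF.deriv ho
  have h2 : DifferentiableOn ℂ (deriv (deriv F)) (tube 0 1 r) := h1.deriv ho
  refine ⟨fun x hx => hasDerivAt_re ho hF (hm x hx), fun x hx => hasDerivAt_re ho h1 (hm x hx), ?_⟩
  exact fun x hx => (hasDerivAt_re ho h2 (hm x hx)).continuousAt.continuousWithinAt

lemma LayerFun.norm_le_of_tube {E B R : ℂ → ℂ} {ε₁ ε₂ x₀ l L r res a c s : ℝ}
    (h : LayerFun E B R ε₁ ε₂ x₀ l L r res) (hl : 0 ≤ l) (hL : 0 ≤ L) (ha : 0 ≤ a) (hc : c ≤ 1)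
    (hs : s ≤ r) {z : ℂ} (hz : z ∈ tube a c s) : ‖E z‖ ≤ Real.exp (L * s) := by
  obtain ⟨x, hx, hzx⟩ := hz
  refine (h.growth x ⟨ha.trans hx.1, hx.2.trans hc⟩ z (hzx.trans_le hs)).trans ?_
  have h1 : Real.exp (-(l * |x - x₀|)) ≤ 1 := Real.exp_le_one_iff.2 (by
    have := mul_nonneg hl (abs_nonneg (x - x₀)); linarith)
  have h2 : Real.exp (L * ‖z - x‖) ≤ Real.exp (L * s) :=
    Real.exp_le_exp.2 (mul_le_mul_of_nonneg_left hzx.le hL)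
  exact (mul_le_of_le_one_left (Real.exp_nonneg _) h1).trans h2

lemma tube_subset_tube {a c s r : ℝ} (ha : 0 ≤ a) (hc : c ≤ 1) (hs : s ≤ r) :
    tube a c s ⊆ tube 0 1 r := fun _ ⟨x, hx, hzx⟩ =>
  ⟨x, ⟨ha.trans hx.1, hx.2.trans hc⟩, hzx.trans_le hs⟩

set_option maxHeartbeats 2000000 in
/-- Error estimate on the layer-adapted mesh in terms of the smooth part and the two layer
functions. -/
theorem wgError_of_layers (m : Mesh 3) {bb rr ff : ℝ → ℝ} {B R F U E₀ E₁ : ℂ → ℂ}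
    {A K γ β Λ ρ ε₁ ε₂ M θ res l₀ L₀ l₁ L₁ η s Θ H : ℝ}
    (d : DataBounds bb rr ff A K γ β) (h : HoloData B R F bb rr ff Λ γ β ρ)
    (hε₁ : 0 < ε₁) (hε₂ : 0 < ε₂) (hε₁₂ : ε₁ ≤ ε₂ ^ 2) (hε₂' : ε₂ ≤ 1)
    (hU : HoloBound U (ρ / 2) M)
    (hUres : ∀ x ∈ Icc (0 : ℝ) 1,
      ‖-(ε₁ : ℂ) * deriv (deriv U) x + ε₂ * B x * deriv U x + R x * U x - F x‖ ≤ θ)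
    (hl₀ : 0 < l₀) (hL₀ : 0 ≤ L₀) (hl₁ : 0 < l₁) (hL₁ : 0 ≤ L₁)
    (hE₀ : LayerFun E₀ B R ε₁ ε₂ 0 (l₀ / ε₂) (L₀ / ε₂) (ρ / 4) res)
    (hE₁ : LayerFun E₁ B R ε₁ ε₂ 1 (l₁ * (ε₂ / ε₁)) (L₁ * (ε₂ / ε₁)) (ρ / 4) res)
    (hη : 0 < η) (hηρ : 2 * η ≤ ρ / 4) (hη1 : 2 * η ≤ 1) {p : ℕ} (hp : 1 ≤ p)
    (hr1 : approxRate η p ≤ s)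
    (hr2 : approxRate η p * Real.exp (L₀ / ε₂ * (2 * η * m.pt 1)) ≤ s)
    (hr3 : approxRate η p * Real.exp (L₁ * (ε₂ / ε₁) * (2 * η * (1 - m.pt 2))) ≤ s)
    (hy : Real.exp (-(l₀ / ε₂ * m.pt 1)) ≤ s)
    (hz : Real.exp (-(l₁ * (ε₂ / ε₁) * (1 - m.pt 2))) ≤ s)
    (hΘ1 : θ + 3 * Λ * (M * s) + 2 * (M * res) ≤ Θ) (hΘ2 : 8 * (M * s) ≤ Θ)
    (hΘ3 : 2 * (M * s) * ε₂ ≤ Θ * m.pt 1) (hΘ4 : 2 * (M * s) ≤ Θ * (ε₂ / ε₁ * (1 - m.pt 2)))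
    (hΘ5 : L₀ * (M * s) ≤ Θ) (hΘ6 : L₁ * (M * s) ≤ Θ)
    (hH : ε₂ * (ε₂ / ε₁) * (1 - m.pt 2) ≤ H) :
    WGErrorLE m ε₁ ε₂ bb rr ff p
      (quasiConst A K γ * (3 : ℕ) * ((9 + 2 * (H + 1 / (2 * l₁)) + 1 / β) * Θ ^ 2)) := by
  have h01 : 0 < m.pt 1 := by
    have := m.xl_lt_xr 0; rwa [show m.xl 0 = 0 from m.left] at this
  have h12 : m.pt 1 < m.pt 2 := m.xl_lt_xr 1
  have h23 : m.pt 2 < 1 := by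
    have := m.xl_lt_xr 2; rwa [show m.xr 2 = 1 from m.right] at this
  set x₁ := m.pt 1 with hx₁
  set x₂ := m.pt 2 with hx₂
  have hρ := h.hρ
  have hΛ := h.hΛ
  set a1 := ε₂ / ε₁ with ha1
  have ha1pos : 0 < a1 := by positivity
  have hl0 : 0 ≤ l₀ / ε₂ := by positivity
  have hL0 : 0 ≤ L₀ / ε₂ := by positivity
  have hl1 : 0 ≤ l₁ * a1 := by positivity
  have hL1 : 0 ≤ L₁ * a1 := by positivity
  have hρ4 : 0 < ρ / 4 := by linarith
  have m0 : (0 : ℝ) ∈ Icc (0 : ℝ) 1 := by simp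
  have m1 : (1 : ℝ) ∈ Icc (0 : ℝ) 1 := by simp
  have hs0 : 0 ≤ s := (Real.exp_nonneg _).trans hy
  set ca : ℂ := -U ((0 : ℝ) : ℂ) with hca
  set cb : ℂ := -U ((1 : ℝ) : ℂ) with hcb
  have hcaM : ‖ca‖ ≤ M := by
    rw [hca, norm_neg]; exact hU.2 _ (ofReal_mem_tube (by linarith) m0)
  have hcbM : ‖cb‖ ≤ M := by
    rw [hcb, norm_neg]; exact hU.2 _ (ofReal_mem_tube (by linarith) m1)
  have hM0 : 0 ≤ M := (norm_nonneg _).trans hcaM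
  have hMs : 0 ≤ M * s := by positivity
  have hΘ : 0 ≤ Θ := by linarith
  set FY : ℂ → ℂ := fun z => ca * E₀ z with hFY
  set FZ : ℂ → ℂ := fun z => cb * E₁ z with hFZ
  have hdFY : ∀ z, deriv FY z = ca * deriv E₀ z := fun z => deriv_const_mul_field _
  have hdFZ : ∀ z, deriv FZ z = cb * deriv E₁ z := fun z => deriv_const_mul_field _
  have hddFY : ∀ z, deriv (deriv FY) z = ca * deriv (deriv E₀) z := fun z => by
    rw [show deriv FY = fun z => ca * deriv E₀ z from funext hdFY]; exact deriv_const_mul_field _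
  have hddFZ : ∀ z, deriv (deriv FZ) z = cb * deriv (deriv E₁) z := fun z => by
    rw [show deriv FZ = fun z => cb * deriv E₁ z from funext hdFZ]; exact deriv_const_mul_field _
  -- real bounds for the layers
  have hYx : ∀ x ∈ Icc (0 : ℝ) 1, ‖FY x‖ ≤ M * Real.exp (-(l₀ / ε₂ * x)) ∧
      ‖deriv FY x‖ ≤ L₀ / ε₂ * (M * Real.exp (-(l₀ / ε₂ * x))) := by
    intro x hx
    have e1 := hE₀.norm_le hρ4 hx
    have e2 := hE₀.deriv_le x hx
    rw [sub_zero, abs_of_nonneg hx.1] at e1 e2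
    rw [hdFY]
    simp only [hFY, norm_mul]
    refine ⟨mul_le_mul hcaM e1 (norm_nonneg _) hM0,
      (mul_le_mul hcaM e2 (norm_nonneg _) hM0).trans (le_of_eq (by ring))⟩
  have hZx : ∀ x ∈ Icc (0 : ℝ) 1, ‖FZ x‖ ≤ M * Real.exp (-(l₁ * a1 * (1 - x))) ∧
      ‖deriv FZ x‖ ≤ L₁ * a1 * (M * Real.exp (-(l₁ * a1 * (1 - x)))) := by
    intro x hx
    have e1 := hE₁.norm_le hρ4 hx
    have e2 := hE₁.deriv_le x hx
    rw [abs_sub_comm, abs_of_nonneg (by linarith [hx.2] : (0 : ℝ) ≤ 1 - x)] at e1 e2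
    rw [hdFZ]
    simp only [hFZ, norm_mul]
    refine ⟨mul_le_mul hcbM e1 (norm_nonneg _) hM0,
      (mul_le_mul hcbM e2 (norm_nonneg _) hM0).trans (le_of_eq (by ring))⟩
  have hexpY : ∀ x, x₁ ≤ x → Real.exp (-(l₀ / ε₂ * x)) ≤ s := fun x hx =>
    le_trans (Real.exp_le_exp.2 (neg_le_neg (mul_le_mul_of_nonneg_left hx hl0))) hy
  have hexpZ : ∀ x, x ≤ x₂ → Real.exp (-(l₁ * a1 * (1 - x)))
      ≤ s * Real.exp (-(l₁ * a1 * (x₂ - x))) := fun x _ => by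
    rw [show -(l₁ * a1 * (1 - x)) = -(l₁ * a1 * (1 - x₂)) + -(l₁ * a1 * (x₂ - x)) by ring,
      Real.exp_add]
    exact mul_le_mul_of_nonneg_right hz (Real.exp_nonneg _)
  have hexpZ1 : ∀ x, x ≤ x₂ → Real.exp (-(l₁ * a1 * (1 - x))) ≤ s := fun x hx =>
    le_trans (Real.exp_le_exp.2 (neg_le_neg
      (mul_le_mul_of_nonneg_left (by linarith : 1 - x₂ ≤ 1 - x) hl1))) hz
  set y1 : ℝ := (FY ((1 : ℝ) : ℂ)).re with hy1
  set z0 : ℝ := (FZ ((0 : ℝ) : ℂ)).re with hz0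
  have hy1s : |y1| ≤ M * s := (Complex.abs_re_le_norm _).trans ((hYx 1 m1).1.trans
    (mul_le_mul_of_nonneg_left (hexpY 1 (by linarith)) hM0))
  have hz0s : |z0| ≤ M * s := (Complex.abs_re_le_norm _).trans ((hZx 0 m0).1.trans
    (mul_le_mul_of_nonneg_left (hexpZ1 0 (by linarith)) hM0))
  have hy1M : |y1| ≤ M := (Complex.abs_re_le_norm _).trans ((hYx 1 m1).1.trans
    (mul_le_of_le_one_right hM0 (Real.exp_le_one_iff.2 (by linarith))))
  have hz0M : |z0| ≤ M := (Complex.abs_re_le_norm _).trans ((hZx 0 m0).1.trans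
    (mul_le_of_le_one_right hM0 (Real.exp_le_one_iff.2 (by linarith))))
  have hsl : |y1 - z0| ≤ |y1| + |z0| := abs_sub _ _
  set FS : ℂ → ℂ := fun z => U z - ((z0 : ℂ) + ((y1 - z0 : ℝ) : ℂ) * z) with hFS
  have hlin : ∀ z : ℂ, HasDerivAt (fun z : ℂ => (z0 : ℂ) + ((y1 - z0 : ℝ) : ℂ) * z)
      ((y1 - z0 : ℝ) : ℂ) z := fun z => by
    simpa using ((hasDerivAt_id z).const_mul ((y1 - z0 : ℝ) : ℂ)).const_add (z0 : ℂ)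
  have hopen := isOpen_tube 0 1 (ρ / 2)
  have hdFS : ∀ z ∈ tube 0 1 (ρ / 2), deriv FS z = deriv U z - ((y1 - z0 : ℝ) : ℂ) := fun z hz =>
    ((hU.differentiableAt hz).hasDerivAt.sub (hlin z)).deriv
  have hddFS : ∀ z ∈ tube 0 1 (ρ / 2), deriv (deriv FS) z = deriv (deriv U) z := fun z hz => by
    rw [Filter.EventuallyEq.deriv_eq (Filter.eventuallyEq_of_mem (hopen.mem_nhds hz) hdFS),
      deriv_sub_const]
  have hFSd : DifferentiableOn ℂ FS (tube 0 1 (ρ / 2)) := fun z hz =>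
    ((hU.differentiableAt hz).sub (hlin z).differentiableAt).differentiableWithinAt
  have hFYd : DifferentiableOn ℂ FY (tube 0 1 (ρ / 4)) := hE₀.diff.const_mul _
  have hFZd : DifferentiableOn ℂ FZ (tube 0 1 (ρ / 4)) := hE₁.diff.const_mul _
  have hY0 : (FY ((0 : ℝ) : ℂ)).re = -(U ((0 : ℝ) : ℂ)).re := by
    simp only [hFY]; rw [hE₀.one, mul_one, hca, Complex.neg_re]
  have hZ1 : (FZ ((1 : ℝ) : ℂ)).re = -(U ((1 : ℝ) : ℂ)).re := by
    simp only [hFZ]; rw [hE₁.one, mul_one, hcb, Complex.neg_re]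
  have hS0 : (FS ((0 : ℝ) : ℂ)).re = (U ((0 : ℝ) : ℂ)).re - z0 := by simp [hFS]
  have hS1 : (FS ((1 : ℝ) : ℂ)).re = (U ((1 : ℝ) : ℂ)).re - y1 := by simp [hFS]
  -- polynomial approximations
  obtain ⟨qS, hqS, hqS0, hqS1⟩ := exists_poly_interp (F := FS) (a := 0) (c := 1) (M := 6 * M)
    (E := Θ) zero_lt_one hη
    (hFSd.mono (tube_mono (by linarith))) (fun z hz => by
      obtain ⟨x, hx, hzx⟩ := hz
      have hzU : z ∈ tube 0 1 (ρ / 2) := ⟨x, hx, by linarith⟩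
      have e1 := hU.2 z hzU
      have e2 : ‖z‖ ≤ 2 := by
        have e3 := norm_add_le (z - x) (x : ℂ)
        rw [sub_add_cancel, Complex.norm_real, Real.norm_of_nonneg hx.1] at e3
        linarith [hx.2]
      have e4 : ‖(z0 : ℂ) + ((y1 - z0 : ℝ) : ℂ) * z‖ ≤ M + (M + M) * 2 := by
        refine (norm_add_le _ _).trans (add_le_add ?_ ?_)
        · rw [Complex.norm_real]; exact hz0M
        · rw [norm_mul, Complex.norm_real]
          exact mul_le_mul (hsl.trans (add_le_add hy1M hz0M)) e2 (norm_nonneg _) (by linarith)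
      have e5 := norm_sub_le (U z) ((z0 : ℂ) + ((y1 - z0 : ℝ) : ℂ) * z)
      simp only [hFS]
      linarith) hp (U ((0 : ℝ) : ℂ)).re (U ((1 : ℝ) : ℂ)).re (by
      rw [hS0, hS1, sub_sub_cancel_left, sub_sub_cancel_left, abs_neg, abs_neg]
      have e1 : approxRate η p * (6 * M) ≤ 6 * (M * s) := by
        calc _ ≤ s * (6 * M) := mul_le_mul_of_nonneg_right hr1 (by linarith)
          _ = _ := by ring
      linarith)
  rw [sub_zero, div_one] at hqS
  obtain ⟨qY, hqY, hqY0, hqY1⟩ := exists_poly_interp (F := FY) (a := 0) (c := x₁)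
    (M := M * Real.exp (L₀ / ε₂ * (2 * η * x₁))) (E := 2 * (M * s)) h01 hη
    (hFYd.mono (tube_subset_tube le_rfl (by linarith) (by
      have : 2 * η * (x₁ - 0) ≤ 2 * η := mul_le_of_le_one_right (by linarith) (by linarith)
      linarith))) (fun z hz => by
      rw [sub_zero] at hz
      have e1 : 2 * η * x₁ ≤ ρ / 4 := by
        have : 2 * η * x₁ ≤ 2 * η := mul_le_of_le_one_right (by linarith) (by linarith)
        linarith
      simp only [hFY, norm_mul]
      exact mul_le_mul hcaM (hE₀.norm_le_of_tube hl0 hL0 le_rfl (by linarith) e1 hz)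
        (norm_nonneg _) hM0) hp (-(U ((0 : ℝ) : ℂ)).re) 0 (by
      rw [hY0, sub_self, abs_zero, add_zero, sub_zero]
      have e1 : approxRate η p * (M * Real.exp (L₀ / ε₂ * (2 * η * x₁))) ≤ M * s := by
        calc _ = M * (approxRate η p * Real.exp (L₀ / ε₂ * (2 * η * x₁))) := by ring
          _ ≤ _ := mul_le_mul_of_nonneg_left hr2 hM0
      have e2 := (Complex.abs_re_le_norm _).trans ((hYx x₁ ⟨h01.le, by linarith⟩).1.trans
        (mul_le_mul_of_nonneg_left (hexpY x₁ le_rfl) hM0))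
      linarith)
  obtain ⟨qZ, hqZ, hqZ0, hqZ1⟩ := exists_poly_interp (F := FZ) (a := x₂) (c := 1)
    (M := M * Real.exp (L₁ * a1 * (2 * η * (1 - x₂)))) (E := 2 * (M * s)) h23 hη
    (hFZd.mono (tube_subset_tube (by linarith) le_rfl (by
      have : 2 * η * (1 - x₂) ≤ 2 * η := mul_le_of_le_one_right (by linarith) (by linarith)
      linarith))) (fun z hz => by
      have e1 : 2 * η * (1 - x₂) ≤ ρ / 4 := by
        have : 2 * η * (1 - x₂) ≤ 2 * η := mul_le_of_le_one_right (by linarith) (by linarith)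
        linarith
      simp only [hFZ, norm_mul]
      exact mul_le_mul hcbM (hE₁.norm_le_of_tube hl1 hL1 (by linarith) le_rfl e1 hz)
        (norm_nonneg _) hM0) hp 0 (-(U ((1 : ℝ) : ℂ)).re) (by
      rw [hZ1, sub_self, abs_zero, add_zero, sub_zero]
      have e1 : approxRate η p * (M * Real.exp (L₁ * a1 * (2 * η * (1 - x₂)))) ≤ M * s := by
        calc _ = M * (approxRate η p * Real.exp (L₁ * a1 * (2 * η * (1 - x₂)))) := by ring
          _ ≤ _ := mul_le_mul_of_nonneg_left hr3 hM0
      have e2 := (Complex.abs_re_le_norm _).trans ((hZx x₂ ⟨by linarith, h23.le⟩).1.trans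
        (mul_le_mul_of_nonneg_left (hexpZ1 x₂ le_rfl) hM0))
      linarith)
  refine wgError_three_cells m d hε₁ hε₂ hε₁₂ hε₂' hΘ hl₁ hH
    (twiceDiff_re (by linarith) hFSd) (twiceDiff_re hρ4 hFYd) (twiceDiff_re hρ4 hFZd)
    (g := fun x => ff x - (-ε₁ * ((deriv (deriv FS) x).re + (deriv (deriv FY) x).re
      + (deriv (deriv FZ) x).re) + ε₂ * bb x * ((deriv FS x).re + (deriv FY x).re + (deriv FZ x).re)
      + rr x * ((FS x).re + (FY x).re + (FZ x).re))) ?_ ?_ (fun x _ => by ring) ?_ hp hqS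
    (qY := qY) ?_ hqY1 ?_ (qZ := qZ) ?_ hqZ0 ?_ ?_ ?_ ?_
  · rw [hS0, hY0]; ring
  · rw [hS1, hZ1]; ring
  · intro x hx
    have hxU : (x : ℂ) ∈ tube 0 1 (ρ / 2) := ofReal_mem_tube (by linarith) hx
    have hxρ : (x : ℂ) ∈ tube 0 1 ρ := ofReal_mem_tube hρ hx
    set rU := -(ε₁ : ℂ) * deriv (deriv U) x + ε₂ * B x * deriv U x + R x * U x - F x with hrU
    set rY := -(ε₁ : ℂ) * deriv (deriv E₀) x + ε₂ * B x * deriv E₀ x + R x * E₀ x with hrY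
    set rZ := -(ε₁ : ℂ) * deriv (deriv E₁) x + ε₂ * B x * deriv E₁ x + R x * E₁ x with hrZ
    set rl := (ε₂ : ℂ) * B x * ((y1 - z0 : ℝ) : ℂ)
      + R x * ((z0 : ℂ) + ((y1 - z0 : ℝ) : ℂ) * x) with hrl
    have hG : ff x - (-ε₁ * ((deriv (deriv FS) x).re + (deriv (deriv FY) x).re
        + (deriv (deriv FZ) x).re) + ε₂ * bb x * ((deriv FS x).re + (deriv FY x).re
        + (deriv FZ x).re) + rr x * ((FS x).re + (FY x).re + (FZ x).re))
        = -(rU - rl + ca * rY + cb * rZ).re := by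
      have e : rU - rl + ca * rY + cb * rZ
          = -((ε₁ : ℝ) : ℂ) * (deriv (deriv FS) x + deriv (deriv FY) x + deriv (deriv FZ) x)
            + ((ε₂ * bb x : ℝ) : ℂ) * (deriv FS x + deriv FY x + deriv FZ x)
            + ((rr x : ℝ) : ℂ) * (FS x + FY x + FZ x) - ((ff x : ℝ) : ℂ) := by
        rw [hddFS x hxU, hddFY, hddFZ, hdFS x hxU, hdFY, hdFZ, hrU, hrY, hrZ, hrl, h.B_real x hx,
          h.R_real x hx, h.F_real x hx]
        simp only [hFS, hFY, hFZ]
        push_cast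
        ring
      rw [e, ← Complex.ofReal_neg]
      simp only [Complex.sub_re, Complex.add_re, Complex.re_ofReal_mul, Complex.ofReal_re]
      ring
    change |ff x - _| ≤ Θ
    rw [hG, abs_neg]
    have e1 := hUres x hx
    have e2 := hE₀.residual x hx
    have e3 := hE₁.residual x hx
    have e4 : ‖rl‖ ≤ 3 * Λ * (M * s) := by
      have f1 : ‖(ε₂ : ℂ) * B x * ((y1 - z0 : ℝ) : ℂ)‖ ≤ Λ * (M * s + M * s) := by
        rw [norm_mul, norm_mul, Complex.norm_real, Complex.norm_real, Real.norm_of_nonneg hε₂.le,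
          Real.norm_eq_abs]
        refine mul_le_mul ?_ (hsl.trans (add_le_add hy1s hz0s)) (abs_nonneg _) (by linarith)
        exact (mul_le_of_le_one_left (norm_nonneg _) hε₂').trans (h.B_le x hxρ)
      have f2 : ‖R x * ((z0 : ℂ) + ((y1 - z0 : ℝ) : ℂ) * x)‖ ≤ Λ * (M * s) := by
        rw [norm_mul]
        refine mul_le_mul (h.R_le x hxρ) ?_ (norm_nonneg _) (by linarith)
        have g1 : (z0 : ℂ) + ((y1 - z0 : ℝ) : ℂ) * x = ((z0 * (1 - x) + y1 * x : ℝ) : ℂ) := by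
          push_cast; ring
        rw [g1, Complex.norm_real, Real.norm_eq_abs]
        refine (abs_add_le _ _).trans ?_
        rw [abs_mul, abs_mul, abs_of_nonneg hx.1,
          abs_of_nonneg (by linarith [hx.2] : (0 : ℝ) ≤ 1 - x)]
        have g2 := mul_le_mul_of_nonneg_right hz0s (by linarith [hx.2] : (0 : ℝ) ≤ 1 - x)
        have g3 := mul_le_mul_of_nonneg_right hy1s hx.1
        linarith
      have f3 := norm_add_le ((ε₂ : ℂ) * B x * ((y1 - z0 : ℝ) : ℂ))
        (R x * ((z0 : ℂ) + ((y1 - z0 : ℝ) : ℂ) * x))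
      linarith
    have e5 : ‖ca * rY‖ ≤ M * res := by
      rw [norm_mul]; exact mul_le_mul hcaM e2 (norm_nonneg _) hM0
    have e6 : ‖cb * rZ‖ ≤ M * res := by
      rw [norm_mul]; exact mul_le_mul hcbM e3 (norm_nonneg _) hM0
    have e7 := Complex.abs_re_le_norm (rU - rl + ca * rY + cb * rZ)
    have e8 := norm_add_le (rU - rl + ca * rY) (cb * rZ)
    have e9 := norm_add_le (rU - rl) (ca * rY)
    have e10 := norm_sub_le rU rl
    linarith
  · refine ⟨hqY.deg, fun x hx => (hqY.close x hx).trans (by linarith),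
      fun x hx => (hqY.close' x hx).trans ?_⟩
    rw [sub_zero, div_le_div_iff₀ h01 hε₂]
    exact hΘ3
  · rw [hqS0, hqY0]; ring
  · refine ⟨hqZ.deg, fun x hx => (hqZ.close x hx).trans (by linarith),
      fun x hx => (hqZ.close' x hx).trans ?_⟩
    rw [div_le_iff₀ (by linarith), mul_assoc]
    exact hΘ4
  · rw [hqZ1]; exact hZ1.symm
  · rw [hqS1, hqZ1]; ring
  · intro x hx
    have hx' : x ∈ Icc (0 : ℝ) 1 := ⟨h01.le.trans hx.1, hx.2⟩
    have e1 := mul_le_mul_of_nonneg_left (hexpY x hx.1) hM0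
    refine ⟨(Complex.abs_re_le_norm _).trans ((hYx x hx').1.trans (by linarith)),
      (Complex.abs_re_le_norm _).trans ((hYx x hx').2.trans ?_)⟩
    rw [div_mul_eq_mul_div]
    refine div_le_div_of_nonneg_right (le_trans (mul_le_mul_of_nonneg_left e1 hL₀) hΘ5) hε₂.le
  · intro x hx
    have hx' : x ∈ Icc (0 : ℝ) 1 := ⟨hx.1, hx.2.trans h23.le⟩
    have e1 := mul_le_mul_of_nonneg_left (hexpZ x hx.2) hM0
    have e0 := Real.exp_nonneg (-(l₁ * a1 * (x₂ - x)))
    refine ⟨(Complex.abs_re_le_norm _).trans ((hZx x hx').1.trans (e1.trans ?_)),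
      (Complex.abs_re_le_norm _).trans ((hZx x hx').2.trans ?_)⟩
    · rw [← mul_assoc]
      exact mul_le_mul_of_nonneg_right (by linarith) e0
    · calc _ ≤ L₁ * a1 * (M * (s * Real.exp (-(l₁ * a1 * (x₂ - x))))) :=
            mul_le_mul_of_nonneg_left e1 hL1
        _ = L₁ * (M * s) * a1 * Real.exp (-(l₁ * a1 * (x₂ - x))) := by ring
        _ ≤ _ := by gcongr

lemma HoloData.exists_smallParam {B R F : ℂ → ℂ} {bb rr ff : ℝ → ℝ} {Λ γ β ρ : ℝ}
    (h : HoloData B R F bb rr ff Λ γ β ρ) :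
    ∃ c e : ℝ, 0 < e ∧ 0 < c ∧ ∀ ε : ℝ, 0 < ε → ε ≤ e → SmallParam Λ γ β ρ c ε := by
  have hΛ := h.hΛ
  have hγ := h.hγ
  have hβ := h.hβ
  have hρ := h.hρ
  have hΛ0 : 0 < Λ := by linarith
  obtain ⟨c, hc, hc1, hc2, hc3, hc4⟩ : ∃ c : ℝ, 0 < c ∧ c ≤ 1 ∧ c ≤ γ / (4 * (Λ + 4)) ∧
      c ≤ β / 4 ∧ c ≤ β ^ 2 / (48 * Λ) :=
    ⟨min (min 1 (γ / (4 * (Λ + 4)))) (min (β / 4) (β ^ 2 / (48 * Λ))),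
      lt_min (lt_min one_pos (by positivity)) (lt_min (by positivity) (by positivity)),
      (min_le_left _ _).trans (min_le_left _ _), (min_le_left _ _).trans (min_le_right _ _),
      (min_le_right _ _).trans (min_le_left _ _), (min_le_right _ _).trans (min_le_right _ _)⟩
  obtain ⟨e, he, he1, he2, he3, he4⟩ : ∃ e : ℝ, 0 < e ∧ e ≤ 1 ∧ e ≤ c * ρ / 2 ∧
      e ≤ β ^ 2 / (16 * Λ) ∧ e ≤ γ * β ^ 2 / (32 * Λ ^ 2) / (Λ + 12 * Λ / ρ) :=
    ⟨min (min 1 (c * ρ / 2))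
        (min (β ^ 2 / (16 * Λ)) (γ * β ^ 2 / (32 * Λ ^ 2) / (Λ + 12 * Λ / ρ))),
      lt_min (lt_min one_pos (by positivity)) (lt_min (by positivity) (by positivity)),
      (min_le_left _ _).trans (min_le_left _ _), (min_le_left _ _).trans (min_le_right _ _),
      (min_le_right _ _).trans (min_le_left _ _), (min_le_right _ _).trans (min_le_right _ _)⟩
  refine ⟨c, e, he, hc, fun ε hε hεe => ⟨hc, hε, by linarith, ?_, by linarith, ?_, by linarith, ?_, ?_⟩⟩
  · rw [le_div_iff₀ (by positivity)] at hc2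
    calc c * (Λ + 4 * c) ≤ c * (Λ + 4) := by gcongr; linarith
      _ ≤ γ / 4 := by linarith
  · rw [le_div_iff₀ (by positivity)] at hc4
    linarith
  · have := hεe.trans he3
    rw [le_div_iff₀ (by positivity)] at this
    linarith
  · have := hεe.trans he4
    rwa [le_div_iff₀ (by positivity)] at this

lemma DataBounds.mesh_bounds {bb rr ff : ℝ → ℝ} {A K γ β ε₁ ε₂ κ : ℝ} {p : ℕ}
    (d : DataBounds bb rr ff A K γ β) (hε₁ : 0 < ε₁) (hε₂ : 0 < ε₂) (hε₁₂ : ε₁ ≤ ε₂ ^ 2)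
    (hκ : 0 < κ) {x₁ x₂ : ℝ} (h₁ : x₁ = κ * p / mu0 ε₁ ε₂ bb rr)
    (h₂ : x₂ = 1 - κ * p / mu1 ε₁ ε₂ bb rr) :
    x₁ / ε₂ ∈ Icc (β * κ / A * p) (2 * A * κ / γ * p) ∧
      ε₂ / ε₁ * (1 - x₂) ∈ Icc (κ / (2 * A) * p) (κ / β * p) := by
  obtain ⟨⟨h0l, h0r⟩, h1l, h1r⟩ := d.mu_bounds hε₁ hε₂ hε₁₂
  have hA : 0 < A := by linarith [d.hA]
  have hγ := d.hγ
  have hβ := d.hβ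
  have hkp : 0 ≤ κ * p := by positivity
  have hm0 : 0 < mu0 ε₁ ε₂ bb rr := lt_of_lt_of_le (by positivity) h0l
  have hm1 : 0 < mu1 ε₁ ε₂ bb rr := lt_of_lt_of_le (by positivity) h1l
  have e1 : x₁ / ε₂ = κ * p / (mu0 ε₁ ε₂ bb rr * ε₂) := by rw [h₁]; field_simp
  have e2 : ε₂ / ε₁ * (1 - x₂) = κ * p / (mu1 ε₁ ε₂ bb rr / (ε₂ / ε₁)) := by
    rw [h₂]; field_simp; ring
  have ha : 0 < ε₂ / ε₁ := by positivity
  have b1 : γ / (2 * A) ≤ mu0 ε₁ ε₂ bb rr * ε₂ := by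
    calc γ / (2 * A) = γ / (2 * A * ε₂) * ε₂ := by field_simp
      _ ≤ _ := by gcongr
  have b2 : mu0 ε₁ ε₂ bb rr * ε₂ ≤ A / β := by
    calc _ ≤ A / (β * ε₂) * ε₂ := by gcongr
      _ = _ := by field_simp
  have b3 : β ≤ mu1 ε₁ ε₂ bb rr / (ε₂ / ε₁) := by rwa [le_div_iff₀ ha]
  have b4 : mu1 ε₁ ε₂ bb rr / (ε₂ / ε₁) ≤ 2 * A := by rwa [div_le_iff₀ ha]
  have hpos : 0 < mu1 ε₁ ε₂ bb rr / (ε₂ / ε₁) := by positivity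
  rw [e1, e2]
  refine ⟨⟨?_, ?_⟩, ?_, ?_⟩
  · calc β * κ / A * p = κ * p / (A / β) := by field_simp
      _ ≤ _ := by gcongr
  · calc _ ≤ κ * p / (γ / (2 * A)) := by gcongr
      _ = _ := by field_simp
  · calc κ / (2 * A) * p = κ * p / (2 * A) := by field_simp
      _ ≤ _ := by gcongr
  · calc _ ≤ κ * p / β := by gcongr
      _ = _ := by field_simp

/-- Error bound on the three-cell mesh for small `ε₂`, with explicit constants. -/
lemma wgError_of_smallParam (m : Mesh 3) {bb rr ff : ℝ → ℝ} {B R F : ℂ → ℂ}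
    {A K γ β Λ ρ c ε₁ ε₂ η κ σ s P : ℝ} {p : ℕ} (d : DataBounds bb rr ff A K γ β)
    (h : HoloData B R F bb rr ff Λ γ β ρ) (hs : SmallParam Λ γ β ρ c ε₂) (hε₁ : 0 < ε₁)
    (hε₁₂ : ε₁ ≤ ε₂ ^ 2) (hη : 0 < η) (hηρ : 2 * η ≤ ρ / 4) (hη1 : 2 * η ≤ 1) (hp : 1 ≤ p)
    (hκ : 0 < κ) (hκε : κ * p * ε₂ < 1 / 2)
    (h₁ : m.pt 1 = κ * p / mu0 ε₁ ε₂ bb rr) (h₂ : m.pt 2 = 1 - κ * p / mu1 ε₁ ε₂ bb rr)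
    (hκ₀ : 3 * Λ / β * (2 * η * (2 * A * κ / γ)) ≤ Real.log (1 + η) / 2)
    (hκ₁ : 2 * Λ * (2 * η * (κ / β)) ≤ Real.log (1 + η) / 2)
    (hσ₁ : σ ≤ Real.log (1 + η) / 2) (hσ₂ : σ ≤ γ * β / (32 * Λ ^ 2) * (β * κ / A))
    (hσ₃ : σ ≤ β / 2 * (κ / (2 * A))) (hσ₄ : σ ≤ c * ρ / 2 * κ)
    (hsdef : s = 4 * (1 + η) / η ^ 2 * Real.exp (-σ * p))
    (hP : P = (16 * Λ ^ 2 / γ + 3 * Λ * (4 * Λ / γ) + 2 * (4 * Λ / γ * (24 * Λ / ρ)))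
      + 8 * (4 * Λ / γ) + 2 * (4 * Λ / γ) / (β * κ / A) + 2 * (4 * Λ / γ) / (κ / (2 * A))
      + 3 * Λ / β * (4 * Λ / γ) + 2 * Λ * (4 * Λ / γ)) :
    WGErrorLE m ε₁ ε₂ bb rr ff p (quasiConst A K γ * (3 : ℕ) *
      ((9 + 2 * (1 / (2 * β) + 1 / (2 * (β / 2))) + 1 / β) * (P * s) ^ 2)) := by
  have hΛ : 0 < Λ := by linarith [h.hΛ]
  have hγ := h.hγ
  have hβ := h.hβ
  have hρ := h.hρ
  have hA : 0 < A := by linarith [d.hA]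
  have hε₂ := hs.hε
  have hp0 : (1 : ℝ) ≤ p := by exact_mod_cast hp
  obtain ⟨⟨hx1l, hx1r⟩, hx2l, hx2r⟩ := d.mesh_bounds (p := p) hε₁ hε₂ hε₁₂ hκ h₁ h₂
  have ha : 0 < ε₂ / ε₁ := by positivity
  have hδ : 0 < ε₁ / ε₂ ^ 2 := by positivity
  have hδ1 : ε₁ / ε₂ ^ 2 ≤ 1 := by rw [div_le_one (by positivity)]; exact hε₁₂
  have hδε : ε₁ / ε₂ ^ 2 * ε₂ ^ 2 = ε₁ := by field_simp
  obtain ⟨U, hU, hUres⟩ := exists_smooth_part h hs.hc hs.hcγ hε₂ hs.hερ hδ hδ1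
  obtain ⟨⟨E₀, hE₀⟩, E₁, hE₁⟩ := exists_layers h hs hδ hδ1
  rw [hδε] at hUres hE₀ hE₁
  rw [show β / 2 / (ε₁ / ε₂ ^ 2 * ε₂) = β / 2 * (ε₂ / ε₁) by field_simp,
    show 2 * Λ / (ε₁ / ε₂ ^ 2 * ε₂) = 2 * Λ * (ε₂ / ε₁) by field_simp] at hE₁
  set M := 4 * Λ / γ with hM
  have hM0 : 0 < M := by positivity
  set Cr := 4 * (1 + η) / η ^ 2 with hCr
  have hCr1 : 1 ≤ Cr := by
    rw [hCr, le_div_iff₀ (by positivity)]; nlinarith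
  have hexp : 0 < Real.exp (-σ * p) := Real.exp_pos _
  have hexps : Real.exp (-σ * p) ≤ s := by
    rw [hsdef]; exact le_mul_of_one_le_left hexp.le hCr1
  have hs0 : 0 < s := hexp.trans_le hexps
  have hlog : 0 ≤ Real.log (1 + η) := Real.log_nonneg (by linarith)
  have ht : Real.exp (-(c * ρ / (4 * ε₂))) ≤ s := by
    refine le_trans (Real.exp_le_exp.mpr ?_) hexps
    have hc := hs.hc
    have hk : 2 * (κ * p) ≤ 1 / ε₂ := by rw [le_div_iff₀ hε₂]; linarith
    have e : c * ρ / (4 * ε₂) = c * ρ / 4 * (1 / ε₂) := by field_simp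
    have e1 : c * ρ / 4 * (2 * (κ * p)) ≤ c * ρ / 4 * (1 / ε₂) :=
      mul_le_mul_of_nonneg_left hk (by positivity)
    have e2 : σ * p ≤ c * ρ / 2 * κ * p := mul_le_mul_of_nonneg_right hσ₄ (by positivity)
    rw [e]; linarith
  have hrate : ∀ y : ℝ, y ≤ Real.log (1 + η) / 2 * p →
      approxRate η p * Real.exp y ≤ s := by
    intro y hy
    rw [approxRate_eq_exp hη p, mul_assoc, ← Real.exp_add, hsdef]
    have e2 : σ * p ≤ Real.log (1 + η) / 2 * p := mul_le_mul_of_nonneg_right hσ₁ (by positivity)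
    refine mul_le_mul_of_nonneg_left (Real.exp_le_exp.mpr ?_) (by linarith)
    linarith
  have hH : ε₂ * (ε₂ / ε₁) * (1 - m.pt 2) ≤ 1 / (2 * β) := by
    calc ε₂ * (ε₂ / ε₁) * (1 - m.pt 2) = ε₂ * (ε₂ / ε₁ * (1 - m.pt 2)) := by ring
      _ ≤ ε₂ * (κ / β * p) := mul_le_mul_of_nonneg_left hx2r hε₂.le
      _ = κ * p * ε₂ / β := by ring
      _ ≤ 1 / 2 / β := by gcongr
      _ = _ := by field_simp
  have t1 : 0 < 16 * Λ ^ 2 / γ + 3 * Λ * M + 2 * (M * (24 * Λ / ρ)) := by positivity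
  have t2 : 0 < 8 * M := by positivity
  have t3 : 0 < 2 * M / (β * κ / A) := by positivity
  have t4 : 0 < 2 * M / (κ / (2 * A)) := by positivity
  have t5 : 0 < 3 * Λ / β * M := by positivity
  have t6 : 0 < 2 * Λ * M := by positivity
  have hP0 : 0 < P := by rw [hP]; positivity
  have hPs : ∀ y, y ≤ P → y * s ≤ P * s := fun y hy => mul_le_mul_of_nonneg_right hy hs0.le
  refine wgError_of_layers m d h hε₁ hε₂ hε₁₂ hs.hε1 hU (s := s)
    (θ := 16 * Λ ^ 2 / γ * s)
    (res := 24 * Λ / ρ * Real.exp (-(c * ρ / (4 * ε₂)))) ?_ (by positivity) (by positivity)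
    (by positivity) (by positivity) hE₀ hE₁ hη hηρ hη1 hp ?_ ?_ ?_ ?_ ?_ ?_ ?_ ?_ ?_ ?_ ?_ hH
  · intro x hx
    refine (hUres x (ofReal_mem_tube (by positivity) hx)).trans ?_
    gcongr
  · simpa using hrate 0 (by positivity)
  · refine hrate _ ?_
    calc 3 * Λ / β / ε₂ * (2 * η * m.pt 1) = 3 * Λ / β * (2 * η) * (m.pt 1 / ε₂) := by ring
      _ ≤ 3 * Λ / β * (2 * η) * (2 * A * κ / γ * p) := by gcongr
      _ = 3 * Λ / β * (2 * η * (2 * A * κ / γ)) * p := by ring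
      _ ≤ _ := by gcongr
  · refine hrate _ ?_
    calc 2 * Λ * (ε₂ / ε₁) * (2 * η * (1 - m.pt 2))
        = 2 * Λ * (2 * η) * (ε₂ / ε₁ * (1 - m.pt 2)) := by ring
      _ ≤ 2 * Λ * (2 * η) * (κ / β * p) := by gcongr
      _ = 2 * Λ * (2 * η * (κ / β)) * p := by ring
      _ ≤ _ := by gcongr
  · refine le_trans (Real.exp_le_exp.mpr ?_) hexps
    have : σ * p ≤ γ * β / (32 * Λ ^ 2) / ε₂ * m.pt 1 := by
      calc σ * p ≤ γ * β / (32 * Λ ^ 2) * (β * κ / A) * p := by gcongr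
        _ = γ * β / (32 * Λ ^ 2) * (β * κ / A * p) := by ring
        _ ≤ γ * β / (32 * Λ ^ 2) * (m.pt 1 / ε₂) := by gcongr
        _ = _ := by ring
    linarith
  · refine le_trans (Real.exp_le_exp.mpr ?_) hexps
    have : σ * p ≤ β / 2 * (ε₂ / ε₁) * (1 - m.pt 2) := by
      calc σ * p ≤ β / 2 * (κ / (2 * A)) * p := by gcongr
        _ = β / 2 * (κ / (2 * A) * p) := by ring
        _ ≤ β / 2 * (ε₂ / ε₁ * (1 - m.pt 2)) := by gcongr
        _ = _ := by ring
    linarith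
  · calc _ ≤ 16 * Λ ^ 2 / γ * s + 3 * Λ * (M * s) + 2 * (M * (24 * Λ / ρ * s)) := by gcongr
      _ = (16 * Λ ^ 2 / γ + 3 * Λ * M + 2 * (M * (24 * Λ / ρ))) * s := by ring
      _ ≤ _ := hPs _ (by linarith)
  · rw [← mul_assoc]; exact hPs _ (by linarith)
  · calc 2 * (M * s) * ε₂ = 2 * M / (β * κ / A) * s * (β * κ / A * 1) * ε₂ := by field_simp
      _ ≤ P * s * (m.pt 1 / ε₂) * ε₂ := by
        have e1 : β * κ / A * 1 ≤ m.pt 1 / ε₂ := le_trans (by gcongr) hx1l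
        have e2 := hPs (2 * M / (β * κ / A)) (by linarith)
        gcongr
      _ = P * s * m.pt 1 := by field_simp
  · calc 2 * (M * s) = 2 * M / (κ / (2 * A)) * s * (κ / (2 * A) * 1) := by field_simp
      _ ≤ P * s * (ε₂ / ε₁ * (1 - m.pt 2)) := by
        have e1 : κ / (2 * A) * 1 ≤ ε₂ / ε₁ * (1 - m.pt 2) := le_trans (by gcongr) hx2l
        have e2 := hPs (2 * M / (κ / (2 * A))) (by linarith)
        gcongr
  · rw [← mul_assoc]; exact hPs _ (by linarith)
  · rw [← mul_assoc]; exact hPs _ (by linarith)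

lemma WGErrorLE.mono {N : ℕ} {m : Mesh N} {ε₁ ε₂ : ℝ} {bb rr ff : ℝ → ℝ} {p : ℕ} {b b' : ℝ}
    (h : WGErrorLE m ε₁ ε₂ bb rr ff p b) (hb : b ≤ b') : WGErrorLE m ε₁ ε₂ bb rr ff p b' :=
  fun u hu hs up0 upb Dup Dcup hw D hD => (h u hu hs up0 upb Dup Dcup hw D hD).trans hb

/-- Exponential convergence on the three-cell mesh, uniformly in `ε₁`, `ε₂`. -/
theorem wgError_three_cells_uniform {bb rr ff : ℝ → ℝ} {A K γ β : ℝ}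
    (d : DataBounds bb rr ff A K γ β) :
    ∃ κ₂ : ℝ, 0 < κ₂ ∧ ∀ κ : ℝ, 0 < κ → κ ≤ κ₂ → ∃ σ C : ℝ, 0 < σ ∧ 0 < C ∧
      ∀ ε₁ ε₂ : ℝ, 0 < ε₁ → 0 < ε₂ → ε₁ ≤ ε₂ ^ 2 → ε₂ ≤ 1 → ∀ p : ℕ, 1 ≤ p →
      κ * p * ε₂ < 1 / 2 → ∀ m : Mesh 3, m.pt 1 = κ * p / mu0 ε₁ ε₂ bb rr →
      m.pt 2 = 1 - κ * p / mu1 ε₁ ε₂ bb rr →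
      WGErrorLE m ε₁ ε₂ bb rr ff p (C * Real.exp (-σ * p) ^ 2) := by
  obtain ⟨B, R, F, ρ, h⟩ := exists_holoData d
  obtain ⟨c, e, he, hc, hsmall⟩ := h.exists_smallParam
  set Λ := 16 * A * K
  have hΛ : 0 < Λ := by linarith [h.hΛ]
  have hγ := h.hγ
  have hβ := h.hβ
  have hρ := h.hρ
  have hA : 0 < A := by linarith [d.hA]
  obtain ⟨η, hη, hηρ, hη1⟩ : ∃ η : ℝ, 0 < η ∧ 2 * η ≤ ρ / 4 ∧ 2 * η ≤ 1 :=
    ⟨min (ρ / 8) (1 / 2), lt_min (by positivity) (by positivity),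
      by linarith [min_le_left (ρ / 8) (1 / 2)], by linarith [min_le_right (ρ / 8) (1 / 2)]⟩
  have hlog : 0 < Real.log (1 + η) := Real.log_pos (by linarith)
  have hq0 : 0 < 3 * Λ / β * (2 * η * (2 * A / γ)) := by positivity
  have hq1 : 0 < 2 * Λ * (2 * η / β) := by positivity
  refine ⟨min (Real.log (1 + η) / 2 / (3 * Λ / β * (2 * η * (2 * A / γ))))
    (Real.log (1 + η) / 2 / (2 * Λ * (2 * η / β))), lt_min (by positivity) (by positivity), ?_⟩
  intro κ hκ hκle
  have hκ₀ := hκle.trans (min_le_left _ _)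
  have hκ₁ := hκle.trans (min_le_right _ _)
  rw [le_div_iff₀ hq0] at hκ₀
  rw [le_div_iff₀ hq1] at hκ₁
  obtain ⟨σ, hσ, hσ₁, hσ₂, hσ₃, hσ₄⟩ : ∃ σ : ℝ, 0 < σ ∧ σ ≤ Real.log (1 + η) / 2 ∧
      σ ≤ γ * β / (32 * Λ ^ 2) * (β * κ / A) ∧ σ ≤ β / 2 * (κ / (2 * A)) ∧
      σ ≤ c * ρ / 2 * κ :=
    ⟨min (min (Real.log (1 + η) / 2) (γ * β / (32 * Λ ^ 2) * (β * κ / A)))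
        (min (β / 2 * (κ / (2 * A))) (c * ρ / 2 * κ)),
      lt_min (lt_min (by positivity) (by positivity)) (lt_min (by positivity) (by positivity)),
      (min_le_left _ _).trans (min_le_left _ _), (min_le_left _ _).trans (min_le_right _ _),
      (min_le_right _ _).trans (min_le_left _ _), (min_le_right _ _).trans (min_le_right _ _)⟩
  set P := (16 * Λ ^ 2 / γ + 3 * Λ * (4 * Λ / γ) + 2 * (4 * Λ / γ * (24 * Λ / ρ)))
      + 8 * (4 * Λ / γ) + 2 * (4 * Λ / γ) / (β * κ / A) + 2 * (4 * Λ / γ) / (κ / (2 * A))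
      + 3 * Λ / β * (4 * Λ / γ) + 2 * Λ * (4 * Λ / γ) with hP
  have hQ := quasiConst_pos (A := A) (K := K) hγ
  set Q := quasiConst A K γ
  set C₁ := Q * (3 : ℕ) * ((9 + 2 * (1 / (2 * β) + 1 / (2 * (β / 2))) + 1 / β) *
    (P * (4 * (1 + η) / η ^ 2)) ^ 2) with hC₁
  set C₂ := Q * (3 : ℕ) * ((9 + 2 * 0 + 1 / β) * A ^ 2) with hC₂
  have hC₁0 : 0 ≤ C₁ := by positivity
  have hC₂0 : 0 < C₂ := by positivity
  refine ⟨σ, C₁ + C₂ * Real.exp (σ / (κ * e)), hσ, by positivity, ?_⟩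
  intro ε₁ ε₂ hε₁ hε₂ hε₁₂ hε₂' p hp hκε m h₁ h₂
  rcases le_or_gt ε₂ e with hle | hgt
  · refine (wgError_of_smallParam m d h (hsmall ε₂ hε₂ hle) hε₁ hε₁₂ hη hηρ hη1 hp hκ hκε h₁ h₂
      ?_ ?_ hσ₁ hσ₂ hσ₃ hσ₄ rfl hP).mono ?_
    · calc _ = κ * (3 * Λ / β * (2 * η * (2 * A / γ))) := by ring
        _ ≤ _ := hκ₀
    · calc _ = κ * (2 * Λ * (2 * η / β)) := by ring
        _ ≤ _ := hκ₁
    · calc _ = C₁ * Real.exp (-σ * p) ^ 2 := by rw [hC₁]; ring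
        _ ≤ _ := by
          gcongr
          have : 0 < C₂ * Real.exp (σ / (κ * e)) := by positivity
          linarith
  · refine (wgError_trivial m d hε₁ hε₂ hε₁₂ hε₂' hp).mono ?_
    have hpe : p ≤ 1 / (2 * (κ * e)) := by
      rw [le_div_iff₀ (by positivity)]
      have : κ * p * e ≤ κ * p * ε₂ := by gcongr
      linarith
    have hexp : 1 ≤ Real.exp (σ / (κ * e)) * Real.exp (-σ * p) ^ 2 := by
      rw [← Real.exp_nat_mul, ← Real.exp_add]
      refine Real.one_le_exp ?_
      have : σ * p ≤ σ * (1 / (2 * (κ * e))) := by gcongr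
      have e1 : σ * (1 / (2 * (κ * e))) = σ / (κ * e) / 2 := by field_simp
      push_cast
      linarith
    calc C₂ ≤ C₂ * (Real.exp (σ / (κ * e)) * Real.exp (-σ * p) ^ 2) :=
          le_mul_of_one_le_right hC₂0.le hexp
      _ ≤ _ := by
        have : 0 ≤ C₁ * Real.exp (-σ * p) ^ 2 := by positivity
        linarith

lemma exists_dataBounds {bb rr ff : ℝ → ℝ}
    (hb : AnalyticData bb) (hr : AnalyticData rr) (hf : AnalyticData ff)
    (hbpos : ∀ x ∈ Set.Icc (0 : ℝ) 1, 0 < bb x) {γ : ℝ} (hγ : 0 < γ)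
    (hγ' : ∀ ε₂ ∈ Set.Ioc (0 : ℝ) 1, ∀ x ∈ Set.Icc (0 : ℝ) 1,
      γ ≤ rr x - ε₂ * deriv bb x / 2) : ∃ A K β, DataBounds bb rr ff A K γ β := by
  obtain ⟨hb, C₁, k₁, hC₁, hk₁, h₁⟩ := hb
  obtain ⟨hr, C₂, k₂, hC₂, hk₂, h₂⟩ := hr
  obtain ⟨hf, C₃, k₃, hC₃, hk₃, h₃⟩ := hf
  obtain ⟨x₀, hx₀, hmin⟩ := isCompact_Icc.exists_isMinOn (nonempty_Icc.mpr zero_le_one)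
    (hb.continuous.continuousOn (s := Icc (0 : ℝ) 1))
  have key : ∀ {C k A K : ℝ} (n : ℕ), 0 < C → 0 < k → C ≤ A → k ≤ K →
      C * n.factorial * k ^ n ≤ A * n.factorial * K ^ n := by
    intro C k A K n hC hk hCA hkK
    have : 0 ≤ A := hC.le.trans hCA
    gcongr
  refine ⟨1 + C₁ + C₂ + C₃, 1 + k₁ + k₂ + k₃, bb x₀, hb, hr, hf, by linarith, by linarith, hγ,
    hbpos x₀ hx₀, fun n x hx => (h₁ n x hx).trans (key n hC₁ hk₁ (by linarith) (by linarith)),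
    fun n x hx => (h₂ n x hx).trans (key n hC₂ hk₂ (by linarith) (by linarith)),
    fun n x hx => (h₃ n x hx).trans (key n hC₃ hk₃ (by linarith) (by linarith)),
    fun x hx => hmin hx, fun x hx => ?_, hγ'⟩
  have hcont : Continuous fun ε₂ : ℝ => rr x - ε₂ * deriv bb x / 2 := by fun_prop
  have hlim : Filter.Tendsto (fun ε₂ : ℝ => rr x - ε₂ * deriv bb x / 2) (nhdsWithin 0 (Ioi 0))
      (nhds (rr x)) := by
    simpa using (hcont.tendsto 0).mono_left nhdsWithin_le_nhds
  refine ge_of_tendsto hlim ?_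
  filter_upwards [Ioc_mem_nhdsGT (zero_lt_one (α := ℝ))] with ε₂ h using hγ' ε₂ h x hx

/-- Robust exponential convergence in the reaction-convection-diffusion
regime `ε₁ ≪ ε₂² ≪ 1`: on the Spectral Boundary Layer mesh `ω_BL(κ,p)` there holds
`|||u − u_p|||_p ≤ C e^{−σ p}`, uniformly in `ε₁, ε₂` and `p`. -/
theorem statement9 (bb rr ff : ℝ → ℝ)
    (hb : AnalyticData bb) (hr : AnalyticData rr) (hf : AnalyticData ff)
    (hbpos : ∀ x ∈ Set.Icc (0 : ℝ) 1, 0 < bb x)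
    (hrpos : ∀ x ∈ Set.Icc (0 : ℝ) 1, 0 ≤ rr x)
    (γ : ℝ) (hγ : 0 < γ)
    (hγ' : ∀ ε₂ ∈ Set.Ioc (0 : ℝ) 1, ∀ x ∈ Set.Icc (0 : ℝ) 1,
      γ ≤ rr x - ε₂ * deriv bb x / 2) :
    ∃ κ σ C : ℝ, 0 < κ ∧ 0 < σ ∧ 0 < C ∧
      ∀ ε₁ ε₂ : ℝ, 0 < ε₁ → 0 < ε₂ → ε₁ ≤ ε₂ ^ 2 → ε₂ ≤ 1 →
      ∀ p : ℕ, 1 ≤ p →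
      ∀ (N : ℕ) (m : Mesh N), IsSBLmeshRCD κ p ε₁ ε₂ bb rr m →
      ∀ u : ℝ → ℝ, ContDiff ℝ (⊤ : ℕ∞) u → SolvesBVP ε₁ ε₂ bb rr ff u →
      ∀ (up0 : Fin N → ℝ → ℝ) (upb : Fin (N + 1) → ℝ) (Dup Dcup : Fin N → ℝ → ℝ),
        IsWGsol m ε₁ ε₂ bb rr ff p up0 upb Dup Dcup →
      ∀ D : Fin N → ℝ → ℝ,
        IsWeakDeriv m (p - 1) (fun j t => u t - up0 j t)
          (fun i => u (m.pt i) - upb i) D →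
        Real.sqrt (normP2 m ε₁ ε₂ bb (stdPen m ε₁ p)
            (fun j t => u t - up0 j t) (fun i => u (m.pt i) - upb i) D)
          ≤ C * Real.exp (-σ * p) := by
  obtain ⟨A, K, β, d⟩ := exists_dataBounds hb hr hf hbpos hγ hγ'
  obtain ⟨κ₁, σ₁, C₁, hκ₁, hσ₁, hC₁, h₁⟩ := wgError_one_cell d
  obtain ⟨κ₂, hκ₂, h₂⟩ := wgError_three_cells_uniform d
  have hκ : 0 < min κ₁ κ₂ := lt_min hκ₁ hκ₂
  obtain ⟨σ₂, C₂, hσ₂, hC₂, h₂⟩ := h₂ (min κ₁ κ₂) hκ (min_le_right _ _)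
  refine ⟨min κ₁ κ₂, min σ₁ σ₂, Real.sqrt (C₁ + C₂), hκ, lt_min hσ₁ hσ₂,
    Real.sqrt_pos.mpr (by linarith), ?_⟩
  intro ε₁ ε₂ hε₁ hε₂ hε₁₂ hε₂' p hp N m hm u hu hsol up0 upb Dup Dcup hw D hD
  have hmono : ∀ C σ : ℝ, 0 ≤ C → C ≤ C₁ + C₂ → min σ₁ σ₂ ≤ σ →
      C * Real.exp (-σ * p) ^ 2 ≤ (C₁ + C₂) * Real.exp (-min σ₁ σ₂ * p) ^ 2 := by
    intro C σ hC hCle hσ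
    have : Real.exp (-σ * p) ≤ Real.exp (-min σ₁ σ₂ * p) := by gcongr
    gcongr
  have hbound : WGErrorLE m ε₁ ε₂ bb rr ff p
      ((C₁ + C₂) * Real.exp (-min σ₁ σ₂ * p) ^ 2) := by
    rcases hm with ⟨hk, rfl⟩ | ⟨hk, rfl, hm₁, hm₂⟩
    · exact (h₁ _ hκ (min_le_left _ _) ε₁ ε₂ hε₁ (hε₁₂.trans (pow_le_one₀ hε₂.le hε₂')) hε₂ hε₂'
        p hp hk m).mono (hmono _ _ hC₁.le (by linarith) (min_le_left _ _))
    · exact (h₂ ε₁ ε₂ hε₁ hε₂ hε₁₂ hε₂' p hp hk m hm₁ hm₂).mono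
        (hmono _ _ hC₂.le (by linarith) (min_le_right _ _))
  calc _ ≤ Real.sqrt ((C₁ + C₂) * Real.exp (-min σ₁ σ₂ * p) ^ 2) :=
        Real.sqrt_le_sqrt (hbound u hu hsol up0 upb Dup Dcup hw D hD)
    _ = _ := by rw [Real.sqrt_mul (by linarith), Real.sqrt_sq (Real.exp_pos _).le]
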